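/- arXiv:0912.1886 — 4 statements merged into one kernel-verified Lean document; each statement's English description precedes it below -/
import Mathlib

section
/- Let λ > 0, r ∈ ℕ, and let ã₁, …, ã_r be real numbers. Define the signed measure ν on the non-negative integers by ν{j} := Po(λ){j}·(1 + Σ_{l=1}^r (−1)^l ã_l C_l(j;λ)) for j ≥ 0 (and ν{j} = 0 for j < 0). Then the characteristic function of ν satisfies, for all θ ∈ ℝ, Σ_{j≥0} e^{ijθ} ν{j} = (1 + Σ_{l=1}^r ã_l (e^{iθ} − 1)^l)·exp{λ(e^{iθ} − 1)}. -/
open Real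

noncomputable section

/-- The Poisson point probabilities `Po(λ){j}` for `j : ℤ` (zero for `j < 0`). -/
def poissonPmf (lam : ℝ) (j : ℤ) : ℝ :=
  if 0 ≤ j then Real.exp (-lam) * lam ^ j.toNat / (Nat.factorial j.toNat) else 0

/-- The `l`-th Charlier polynomial `C_l(j;λ)`. -/
def charlier (l : ℕ) (lam : ℝ) (j : ℕ) : ℝ :=
  ∑ k ∈ Finset.range (l + 1),
    (-1 : ℝ) ^ k * (Nat.choose l k) * (Nat.choose j k) * (Nat.factorial k) * lam ^ (-(k : ℤ))

/-- The Poisson–Charlier signed measure `ν_r(λ; ã₁,…,ã_r)` on `ℤ` (supported on `ℕ`). -/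
def pcMeasure (lam : ℝ) (r : ℕ) (ta : ℕ → ℝ) (j : ℤ) : ℝ :=
  poissonPmf lam j *
    (1 + ∑ l ∈ Finset.Icc 1 r, (-1 : ℝ) ^ l * ta l * charlier l lam j.toNat)

/-- Factorial moments generating series. -/
lemma hasSum_fact_moment (x : ℂ) (k : ℕ) :
    HasSum (fun j : ℕ => x ^ j / (Nat.factorial j : ℂ) * (Nat.choose j k) * (Nat.factorial k))
      (x ^ k * Complex.exp x) := by
  have h0 : HasSum (fun j : ℕ => x ^ j / (Nat.factorial j : ℂ)) (Complex.exp x) := by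
    rw [Complex.exp_eq_exp_ℂ]
    exact NormedSpace.expSeries_div_hasSum_exp x
  have h1 := h0.mul_left (x ^ k)
  refine ((add_left_injective k).hasSum_iff ?_).1 ?_
  · intro j hj
    have : j < k := by
      by_contra h
      exact hj ⟨j - k, by simp only; omega⟩
    simp [Nat.choose_eq_zero_of_lt this]
  · convert h1 using 1
    · rfl
    funext j
    have h2 := Nat.add_choose_mul_factorial_mul_factorial j k
    have h3 : (((j + k).choose k : ℕ) : ℂ) * (Nat.factorial j) * (Nat.factorial k)
        = (Nat.factorial (j + k) : ℂ) := by exact_mod_cast h2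
    have hj : (Nat.factorial j : ℂ) ≠ 0 := by exact_mod_cast Nat.factorial_ne_zero j
    have hjk : (Nat.factorial (j + k) : ℂ) ≠ 0 := by
      exact_mod_cast Nat.factorial_ne_zero (j + k)
    simp only [Function.comp]
    field_simp
    rw [← h3]
    ring

/-- The transform of one Charlier term. -/
lemma hasSum_charlier (lam : ℝ) (hlam : 0 < lam) (z : ℂ) (l : ℕ) :
    HasSum (fun j : ℕ => z ^ j * ((poissonPmf lam j : ℝ) : ℂ) * (charlier l lam j : ℂ))
      ((1 - z) ^ l * Complex.exp (lam * (z - 1))) := by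
  have hl : (lam : ℂ) ≠ 0 := by exact_mod_cast hlam.ne'
  have h := hasSum_sum (s := Finset.range (l + 1)) fun k _ =>
    (hasSum_fact_moment (lam * z) k).mul_left
      (Complex.exp (-lam) * ((-1 : ℂ) ^ k * (Nat.choose l k) * (lam : ℂ) ^ (-(k : ℤ))))
  convert h using 1
  · rfl
  · funext j
    simp only [poissonPmf, charlier]
    push_cast
    simp only [Int.toNat_natCast, Nat.cast_nonneg, if_true]
    push_cast
    rw [Finset.mul_sum]
    refine Finset.sum_congr rfl fun k _ => ?_
    rw [mul_pow]
    ring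
  · have e : Complex.exp (lam * (z - 1)) = Complex.exp (-lam) * Complex.exp (lam * z) := by
      rw [← Complex.exp_add]
      congr 1
      ring
    have b : (1 - z) ^ l = ((-z) + 1) ^ l := by ring
    rw [e, b, add_pow, Finset.sum_mul]
    refine Finset.sum_congr rfl fun k _ => ?_
    rw [mul_pow, zpow_neg, zpow_natCast, neg_pow z]
    field_simp
    simp

/-- Equation (3.6)/(3.7): the Poisson–Charlier signed measure
`ν{j} = Po(λ){j}(1 + Σ_{l=1}^r (-1)^l ã_l C_l(j;λ))` has characteristic function
`(1 + Σ_{l=1}^r ã_l (e^{iθ}-1)^l) e^{λ(e^{iθ}-1)}`. -/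
theorem pcMeasure_charFun (lam : ℝ) (hlam : 0 < lam) (r : ℕ) (ta : ℕ → ℝ) :
    ∀ θ : ℝ,
      (∑' j : ℕ, Complex.exp (Complex.I * (j : ℂ) * (θ : ℂ)) * (pcMeasure lam r ta j : ℂ)) =
        (1 + ∑ l ∈ Finset.Icc 1 r, (ta l : ℂ) * (Complex.exp (Complex.I * θ) - 1) ^ l) *
          Complex.exp (lam * (Complex.exp (Complex.I * θ) - 1)) := by
  intro θ
  set z : ℂ := Complex.exp (Complex.I * θ) with hz
  have h0 := hasSum_charlier lam hlam z 0
  have h := h0.add (hasSum_sum (s := Finset.Icc 1 r) fun l _ =>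
    (hasSum_charlier lam hlam z l).mul_left ((-1 : ℂ) ^ l * (ta l : ℂ)))
  refine HasSum.tsum_eq ?_
  convert h using 1
  · funext j
    have e : Complex.exp (Complex.I * (j : ℂ) * (θ : ℂ)) = z ^ j := by
      rw [hz, ← Complex.exp_nat_mul]
      congr 1
      ring
    have c0 : charlier 0 lam j = 1 := by simp [charlier]
    rw [e, c0]
    simp only [pcMeasure, Int.toNat_natCast]
    push_cast
    rw [mul_add, mul_add, Finset.mul_sum, Finset.mul_sum]
    congr 1
    · ring
    · refine Finset.sum_congr rfl fun l _ => ?_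
      ring
  · rw [add_mul, Finset.sum_mul, pow_zero]
    congr 1
    refine Finset.sum_congr rfl fun l _ => ?_
    have : (z - 1) ^ l = (-1) ^ l * (1 - z) ^ l := by
      rw [← mul_pow]
      congr 1
      ring
    rw [this]
    ring

end
end

section
/- Let λ > 0, r ∈ ℕ, and let ã₁, …, ã_r be real numbers, and let ν be the Poisson–Charlier signed measure ν{j} := Po(λ){j}·(1 + Σ_{l=1}^r (−1)^l ã_l C_l(j;λ)) for j ≥ 0. Set Ā_r := 1 + Σ_{l=1}^r 2^l|ã_l|. Then: (1) for every integer m with 0 ≤ m ≤ λ, Σ_{j=0}^m |ν{j}| ≤ Ā_r e^{−(λ−m)²/(3λ)}; and (2) for every integer m with λ + r ≤ m ≤ 2λ, Σ_{j≥m} |ν{j}| ≤ Ā_r e^{−(m−r−λ)²/(3λ)}. -/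
open Real

noncomputable section

/-- Poisson weights on the naturals. -/
def pw (lam : ℝ) (j : ℕ) : ℝ := Real.exp (-lam) * lam ^ j / (Nat.factorial j)

lemma pw_nonneg {lam : ℝ} (h : 0 < lam) (j : ℕ) : 0 ≤ pw lam j := by
  unfold pw; positivity

lemma pw_chernoff {lam : ℝ} (h : 0 < lam) {z : ℝ} (hz : 0 < z) (n : ℕ) (T : Finset ℕ)
    (hT : ∀ i ∈ T, z ^ n ≤ z ^ i) :
    ∑ i ∈ T, pw lam i ≤ Real.exp (lam * (z - 1)) / z ^ n := by
  rw [le_div_iff₀ (by positivity), Finset.sum_mul]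
  have hs : HasSum (fun i : ℕ => Real.exp (-lam) * ((lam * z) ^ i / (Nat.factorial i)))
      (Real.exp (-lam) * Real.exp (lam * z)) := by
    have := NormedSpace.expSeries_div_hasSum_exp (lam * z)
    rw [← Real.exp_eq_exp_ℝ] at this
    exact this.mul_left _
  calc ∑ i ∈ T, pw lam i * z ^ n
      ≤ ∑ i ∈ T, Real.exp (-lam) * ((lam * z) ^ i / (Nat.factorial i)) := by
        refine Finset.sum_le_sum fun i hi => ?_
        calc pw lam i * z ^ n ≤ pw lam i * z ^ i :=
              mul_le_mul_of_nonneg_left (hT i hi) (pw_nonneg h i)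
          _ = _ := by unfold pw; rw [mul_pow]; ring
    _ ≤ Real.exp (-lam) * Real.exp (lam * z) :=
        sum_le_hasSum T (fun i _ => by positivity) hs
    _ = Real.exp (lam * (z - 1)) := by rw [← Real.exp_add]; ring_nf

lemma pw_lower {lam : ℝ} (h : 0 < lam) (m : ℕ) (hm : (m : ℝ) ≤ lam) (T : Finset ℕ)
    (hT : ∀ i ∈ T, i ≤ m) :
    ∑ i ∈ T, pw lam i ≤ Real.exp (-(lam - m) ^ 2 / (3 * lam)) := by
  set u : ℝ := (lam - m) / lam with hu
  have hu0 : 0 ≤ u := div_nonneg (by linarith) h.le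
  have hmu : (m : ℝ) = lam * (1 - u) := by rw [hu]; field_simp; ring
  have hz1 : Real.exp (-u) ≤ 1 := by simpa using hu0
  refine (pw_chernoff h (Real.exp_pos (-u)) m T
    (fun i hi => pow_le_pow_of_le_one (Real.exp_pos _).le hz1 (hT i hi))).trans ?_
  rw [← Real.exp_nat_mul, ← Real.exp_sub, Real.exp_le_exp]
  have he : Real.exp (-u) ≤ 1 - u + u ^ 2 / 2 := by
    have h1 := Real.quadratic_le_exp_of_nonneg hu0
    have h2 : Real.exp (-u) * Real.exp u = 1 := by rw [← Real.exp_add]; simp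
    have h3 := Real.exp_pos (-u)
    have h4 : 0 < 1 + u + u ^ 2 / 2 := by positivity
    have h5 : Real.exp (-u) * (1 + u + u ^ 2 / 2) ≤ 1 := by
      exact (mul_le_mul_of_nonneg_left h1 h3.le).trans h2.le
    have h6 : 1 ≤ (1 - u + u ^ 2 / 2) * (1 + u + u ^ 2 / 2) := by
      nlinarith [sq_nonneg (u ^ 2)]
    exact le_of_mul_le_mul_right (h5.trans h6) h4
  have e : -(lam - m) ^ 2 / (3 * lam) = lam * (-(u ^ 2) / 3) := by
    rw [hmu]; field_simp; ring
  rw [e, hmu]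
  have : lam * (Real.exp (-u) - 1) - lam * (1 - u) * -u
      = lam * (Real.exp (-u) - 1 + (1 - u) * u) := by ring
  rw [this]
  exact mul_le_mul_of_nonneg_left (by nlinarith [sq_nonneg u]) h.le

lemma pw_upper {lam : ℝ} (h : 0 < lam) (n : ℕ) (hn : lam ≤ (n : ℝ)) (hn2 : (n : ℝ) ≤ 2 * lam)
    (T : Finset ℕ) (hT : ∀ i ∈ T, n ≤ i) :
    ∑ i ∈ T, pw lam i ≤ Real.exp (-((n : ℝ) - lam) ^ 2 / (3 * lam)) := by
  set u : ℝ := (n - lam) / lam with hu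
  have hu0 : 0 ≤ u := div_nonneg (by linarith) h.le
  have hu1 : u ≤ 1 := by rw [hu, div_le_one h]; linarith
  have hmu : (n : ℝ) = lam * (1 + u) := by rw [hu]; field_simp; ring
  have hz : 0 < 1 + u := by linarith
  refine (pw_chernoff h hz n T
    (fun i hi => pow_le_pow_right₀ (by linarith) (hT i hi))).trans ?_
  have hp : (1 + u) ^ n = Real.exp (n * Real.log (1 + u)) := by
    rw [Real.exp_nat_mul, Real.exp_log hz]
  rw [hp, ← Real.exp_sub, Real.exp_le_exp]
  have hl := Real.le_log_one_add_of_nonneg hu0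
  have hl2 : u + u ^ 2 / 3 ≤ (1 + u) * Real.log (1 + u) := by
    refine le_trans ?_ (mul_le_mul_of_nonneg_left hl hz.le)
    rw [← mul_div_assoc, le_div_iff₀ (by linarith)]
    nlinarith [mul_nonneg (mul_nonneg hu0 hu0) (sub_nonneg.2 hu1)]
  have e : -((n : ℝ) - lam) ^ 2 / (3 * lam) = lam * (-(u ^ 2) / 3) := by
    rw [hmu]; field_simp; ring
  rw [e, hmu]
  have : lam * (1 + u - 1) - lam * (1 + u) * Real.log (1 + u)
      = lam * (u - (1 + u) * Real.log (1 + u)) := by ring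
  rw [this]
  exact mul_le_mul_of_nonneg_left (by linarith) h.le

/-- Shifted Poisson weights. -/
def qw (lam : ℝ) (k j : ℕ) : ℝ := if k ≤ j then pw lam (j - k) else 0

lemma pw_shift {lam : ℝ} (h : 0 < lam) (k j : ℕ) :
    pw lam j * ((Nat.choose j k) * (Nat.factorial k) * lam ^ (-(k : ℤ))) = qw lam k j := by
  unfold qw
  split_ifs with hk
  · unfold pw
    have hc : ((Nat.choose j k : ℕ) : ℝ) * (Nat.factorial k) * (Nat.factorial (j - k))
        = Nat.factorial j := by exact_mod_cast Nat.choose_mul_factorial_mul_factorial hk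
    have hl : lam ^ j = lam ^ (j - k) * lam ^ k := by rw [← pow_add, Nat.sub_add_cancel hk]
    rw [zpow_neg, zpow_natCast, ← hc, hl]
    have : (Nat.choose j k : ℝ) ≠ 0 := by exact_mod_cast (Nat.choose_pos hk).ne'
    have := Nat.factorial_ne_zero k
    have := Nat.factorial_ne_zero (j - k)
    field_simp
  · rw [Nat.choose_eq_zero_of_lt (by omega)]; simp

lemma pc_abs {lam : ℝ} (h : 0 < lam) (r : ℕ) (ta : ℕ → ℝ) (j : ℕ) :
    |pcMeasure lam r ta j| ≤ qw lam 0 j + ∑ l ∈ Finset.Icc 1 r,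
      |ta l| * ∑ k ∈ Finset.range (l + 1), (Nat.choose l k) * qw lam k j := by
  have h0 : pcMeasure lam r ta j = pw lam j *
    (1 + ∑ l ∈ Finset.Icc 1 r, (-1 : ℝ) ^ l * ta l * charlier l lam j) := by
    simp [pcMeasure, poissonPmf, pw]
  have hq0 : qw lam 0 j = pw lam j := by simp [qw]
  rw [h0, mul_add, mul_one, hq0, Finset.mul_sum]
  refine (abs_add_le _ _).trans ?_
  rw [abs_of_nonneg (pw_nonneg h j)]
  gcongr
  refine (Finset.abs_sum_le_sum_abs _ _).trans (Finset.sum_le_sum fun l _ => ?_)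
  have : |pw lam j * ((-1 : ℝ) ^ l * ta l * charlier l lam j)|
      = |ta l| * |pw lam j * charlier l lam j| := by
    simp only [abs_mul, abs_pow, abs_neg, abs_one, one_pow]; ring
  rw [this]
  gcongr
  rw [charlier, Finset.mul_sum]
  refine (Finset.abs_sum_le_sum_abs _ _).trans (Finset.sum_le_sum fun k _ => ?_)
  have hq : 0 ≤ qw lam k j := by
    unfold qw; split_ifs
    · exact pw_nonneg h _
    · exact le_rfl
  have e : pw lam j * ((-1 : ℝ) ^ k * (Nat.choose l k) * (Nat.choose j k) * (Nat.factorial k)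
      * lam ^ (-(k : ℤ))) = (-1 : ℝ) ^ k * ((Nat.choose l k) * qw lam k j) := by
    rw [← pw_shift h]; ring
  rw [e, abs_mul, abs_pow, abs_neg, abs_one, one_pow, one_mul, abs_of_nonneg (by positivity)]

lemma pc_sum {lam : ℝ} (h : 0 < lam) (r : ℕ) (ta : ℕ → ℝ) (s : Finset ℕ) (B : ℝ)
    (hB : ∀ k ≤ r, ∑ j ∈ s, qw lam k j ≤ B) :
    ∑ j ∈ s, |pcMeasure lam r ta j| ≤ (1 + ∑ l ∈ Finset.Icc 1 r, 2 ^ l * |ta l|) * B := by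
  refine (Finset.sum_le_sum fun j _ => pc_abs h r ta j).trans ?_
  rw [Finset.sum_add_distrib, add_mul, one_mul, Finset.sum_comm, Finset.sum_mul]
  refine add_le_add (hB 0 (Nat.zero_le _)) (Finset.sum_le_sum fun l hl => ?_)
  rw [← Finset.mul_sum, Finset.sum_comm]
  have hl' := (Finset.mem_Icc.1 hl).2
  have : ∑ k ∈ Finset.range (l + 1), ∑ j ∈ s, (Nat.choose l k : ℝ) * qw lam k j ≤ 2 ^ l * B := by
    have h2 : (2 : ℝ) ^ l = ∑ k ∈ Finset.range (l + 1), (Nat.choose l k : ℝ) := by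
      exact_mod_cast (Nat.sum_range_choose l).symm
    rw [h2, Finset.sum_mul]
    refine Finset.sum_le_sum fun k hk => ?_
    rw [← Finset.mul_sum]
    have := Finset.mem_range.1 hk
    exact mul_le_mul_of_nonneg_left (hB k (by omega)) (by positivity)
  calc _ ≤ |ta l| * (2 ^ l * B) := mul_le_mul_of_nonneg_left this (abs_nonneg _)
    _ = _ := by ring

lemma qw_sum (lam : ℝ) (k : ℕ) (s : Finset ℕ) :
    ∑ j ∈ s, qw lam k j = ∑ i ∈ (s.filter (k ≤ ·)).image (· - k), pw lam i := by
  rw [Finset.sum_image, Finset.sum_filter]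
  · rfl
  · intro a ha b hb hab
    simp at ha hb hab
    omega

/-- Display (3.10): concentration of the Poisson–Charlier signed measure
`ν{j} = Po(λ){j}(1 + Σ_{l=1}^r (-1)^l ã_l C_l(j;λ))` on a scale `√λ` around `λ`:
with `Ā_r := 1 + Σ_{l=1}^r 2^l|ã_l|`, the absolute mass of `[0,m]` is at most
`Ā_r e^{-(λ-m)²/(3λ)}` for `0 ≤ m ≤ λ`, and the absolute mass of `[m,∞)` is at most
`Ā_r e^{-(m-r-λ)²/(3λ)}` for `λ + r ≤ m ≤ 2λ`. -/
theorem pcMeasure_tails (lam : ℝ) (hlam : 0 < lam) (r : ℕ) (ta : ℕ → ℝ) :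
    (∀ m : ℕ, (m : ℝ) ≤ lam →
      (∑ j ∈ Finset.range (m + 1), |pcMeasure lam r ta j|) ≤
        (1 + ∑ l ∈ Finset.Icc 1 r, 2 ^ l * |ta l|) *
          Real.exp (-(lam - m) ^ 2 / (3 * lam))) ∧
    (∀ m : ℕ, lam + r ≤ (m : ℝ) → (m : ℝ) ≤ 2 * lam →
      (∑' j : {j : ℕ // m ≤ j}, |pcMeasure lam r ta j.val|) ≤
        (1 + ∑ l ∈ Finset.Icc 1 r, 2 ^ l * |ta l|) *
          Real.exp (-((m : ℝ) - r - lam) ^ 2 / (3 * lam))) := by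
  refine ⟨fun m hm => ?_, fun m hm hm2 => ?_⟩
  · refine pc_sum hlam r ta _ _ fun k _ => ?_
    rw [qw_sum]
    refine pw_lower hlam m hm _ fun i hi => ?_
    simp only [Finset.mem_image, Finset.mem_filter, Finset.mem_range] at hi
    obtain ⟨a, ha, rfl⟩ := hi
    omega
  · have hr : r ≤ m := by
      have : (r : ℝ) ≤ m := by linarith
      exact_mod_cast this
    have hc : ((m - r : ℕ) : ℝ) = (m : ℝ) - r := Nat.cast_sub hr
    have hr0 : (0 : ℝ) ≤ r := Nat.cast_nonneg r
    refine tsum_le_of_sum_le' (by positivity) fun s => ?_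
    have e : ∑ j ∈ s, |pcMeasure lam r ta j.val|
        = ∑ j ∈ s.map (Function.Embedding.subtype _), |pcMeasure lam r ta j| := by
      rw [Finset.sum_map]; rfl
    rw [e]
    refine pc_sum hlam r ta _ _ fun k hk => ?_
    rw [qw_sum, ← hc]
    refine pw_upper hlam (m - r) (by rw [hc]; linarith) (by rw [hc]; linarith) _ fun i hi => ?_
    simp only [Finset.mem_image, Finset.mem_filter, Finset.mem_map] at hi
    obtain ⟨a, ⟨⟨b, _, rfl⟩, hka⟩, rfl⟩ := hi
    have := b.2
    simp only [Function.Embedding.subtype_apply]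
    omega

end
end

section
/- Let (R_λ)_{λ≥1} be a family of probability distributions on ℤ such that, for Z_λ ∼ R_λ, the mean μ(λ) := E Z_λ and the variance σ²(λ) := Var Z_λ exist and are continuous functions of λ ∈ [1,∞), with σ²(λ) strictly increasing and σ²(λ) → ∞ as λ → ∞. Let X be an integer-valued random variable with finite mean E X and variance Var X satisfying Var X ≥ σ²(1) + 1/4. Then there exist λ' ≥ 1, m ∈ ℤ and p ∈ [0,1] such that m + μ(λ') + p = E X and σ²(λ') + p(1−p) = Var X. -/
open Real

noncomputable section

/-- Matching of mean and variance within a translated family (Section 5): given a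
family `(R_λ)_{λ≥1}` of probability distributions on `ℤ` with continuous mean `μ(λ)`
and continuous, strictly increasing variance `σ²(λ) → ∞`, and a random variable `X`
with `Var X ≥ σ²(1) + 1/4`, there exist `λ' ≥ 1`, `m ∈ ℤ` and `p ∈ [0,1]` with
`m + μ(λ') + p = E X` and `σ²(λ') + p(1-p) = Var X`; these say that the mixture
`Q{j} = p·R_{λ'}{j-m-1} + (1-p)·R_{λ'}{j-m}` has the same mean and variance as `X`. -/
theorem translated_family_mean_variance_matching
    (R : ℝ → ℤ → ℝ) (meanR varR : ℝ → ℝ)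
    (hprob : ∀ lam ≥ (1 : ℝ), (∀ j, 0 ≤ R lam j) ∧ (∑' j : ℤ, R lam j) = 1)
    (hmean : ∀ lam ≥ (1 : ℝ), Summable (fun j : ℤ => (j : ℝ) * R lam j) ∧
      meanR lam = ∑' j : ℤ, (j : ℝ) * R lam j)
    (hvar : ∀ lam ≥ (1 : ℝ),
      Summable (fun j : ℤ => ((j : ℝ) - meanR lam) ^ 2 * R lam j) ∧
      varR lam = ∑' j : ℤ, ((j : ℝ) - meanR lam) ^ 2 * R lam j)
    (hmeanCont : ContinuousOn meanR (Set.Ici 1))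
    (hvarCont : ContinuousOn varR (Set.Ici 1))
    (hvarMono : StrictMonoOn varR (Set.Ici 1))
    (hvarTop : Filter.Tendsto varR Filter.atTop Filter.atTop)
    (EX VX : ℝ) (hVX : varR 1 + 1 / 4 ≤ VX) :
    ∃ (lam' : ℝ) (m : ℤ) (p : ℝ), 1 ≤ lam' ∧ 0 ≤ p ∧ p ≤ 1 ∧
      (m : ℝ) + meanR lam' + p = EX ∧ varR lam' + p * (1 - p) = VX := by
  have hf : Continuous ((fun x : ℝ => x * (1 - x)) ∘ (Int.fract : ℝ → ℝ)) :=
    ContinuousOn.comp_fract'' (by fun_prop) (by norm_num)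
  have hg : ContinuousOn (fun l => varR l +
      ((fun x : ℝ => x * (1 - x)) ∘ (Int.fract : ℝ → ℝ)) (EX - meanR l)) (Set.Ici 1) :=
    hvarCont.add (hf.comp_continuousOn (continuousOn_const.sub hmeanCont))
  obtain ⟨L, hL, hL1⟩ := ((hvarTop.eventually_ge_atTop VX).and
    (Filter.eventually_ge_atTop (1 : ℝ))).exists
  have hnn : ∀ x : ℝ, 0 ≤ Int.fract x * (1 - Int.fract x) := fun x =>
    mul_nonneg (Int.fract_nonneg x) (by linarith [Int.fract_lt_one x])
  have key := intermediate_value_Icc hL1 (hg.mono Set.Icc_subset_Ici_self)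
  have hmem : VX ∈ Set.Icc
      (varR 1 + Int.fract (EX - meanR 1) * (1 - Int.fract (EX - meanR 1)))
      (varR L + Int.fract (EX - meanR L) * (1 - Int.fract (EX - meanR L))) := by
    constructor
    · nlinarith [sq_nonneg (Int.fract (EX - meanR 1) - 1 / 2)]
    · linarith [hnn (EX - meanR L)]
  obtain ⟨l, hl, hle⟩ := key hmem
  refine ⟨l, ⌊EX - meanR l⌋, Int.fract (EX - meanR l), hl.1, Int.fract_nonneg _,
    (Int.fract_lt_one _).le, ?_, hle⟩
  linarith [Int.floor_add_fract (EX - meanR l)]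

end
end

section
/- Let N_n be uniformly distributed on {1, 2, …, n}, and let ω(k) denote the number of distinct prime divisors of k. Let Φ₁(w) := (1/Γ(1+w))·∏_{q prime} (1 + w/q)(1 − 1/q)^w, which is analytic in a neighbourhood of w = 0, and let ã_{l} denote its Taylor coefficients at 0 (so ã_0 = 1). Fix r ≥ 1 and put λ_n := log log n and ν_r^{(1)}{j} := Po(λ_n){j}·(1 + Σ_{l=1}^r (−1)^l ã_{l} C_l(j;λ_n)). Then there exist constants C_{r} and C̃ such that for all n ≥ 16: sup_{j} |P(ω(N_n) = j) − ν_r^{(1)}{j}| ≤ C_{r}(log log n)^{−1−r/2} + ã_1 C̃ / log n, and sup_{l} |P(ω(N_n) ≤ l) − ν_r^{(1)}{[0,l]}| ≤ C_{r}(log log n)^{−(r+1)/2} + C̃ · (log log n)/log n. -/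
open Real

noncomputable section

/-- The `l`-th Taylor coefficient at `0` of a function `ℂ → ℂ`. -/
def taylorCoeff (f : ℂ → ℂ) (l : ℕ) : ℂ := iteratedDeriv l f 0 / (Nat.factorial l)

/-- `ω(k)`, the number of distinct prime divisors of `k`. -/
def smallOmega (k : ℕ) : ℕ := k.primeFactors.card

/-- The arithmetic factor `Φ₁(w) = Γ(1+w)⁻¹ ∏_q (1+w/q)(1-1/q)^w` appearing in the
Rényi–Turán / Selberg formula for the characteristic function of `ω(N_n)`. -/
def Phi1 (w : ℂ) : ℂ :=
  (1 / Complex.Gamma (1 + w)) *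
    ∏' q : Nat.Primes, ((1 + w / ((q : ℕ) : ℂ)) * (1 - 1 / ((q : ℕ) : ℂ)) ^ w)

namespace EK

/-- local Euler factor -/
def Ef (w y : ℂ) : ℂ := (1 + w * y) * Complex.exp (w * Complex.log (1 - y))

def CE : ℝ := 22 + 3 * (36 * Real.exp 4)

lemma CE_pos : 0 < CE := by unfold CE; positivity

lemma log_one_sub_bound {y : ℂ} (hy : ‖y‖ ≤ 3 / 5) :
    ‖Complex.log (1 - y) + y‖ ≤ 5 / 4 * ‖y‖ ^ 2 := by
  have h := Complex.norm_log_one_add_sub_self_le (z := -y) (by rw [norm_neg]; linarith)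
  rw [norm_neg, ← sub_eq_add_neg, sub_neg_eq_add] at h
  refine h.trans ?_
  have : (1 - ‖y‖)⁻¹ ≤ 5 / 2 := by
    rw [inv_le_comm₀ (by linarith) (by norm_num)]; norm_num; linarith
  nlinarith [sq_nonneg ‖y‖, mul_le_mul_of_nonneg_left this (sq_nonneg ‖y‖)]

lemma log_one_sub_bound' {y : ℂ} (hy : ‖y‖ ≤ 3 / 5) :
    ‖Complex.log (1 - y)‖ ≤ 2 * ‖y‖ := by
  have h := log_one_sub_bound hy
  have h2 : ‖Complex.log (1 - y)‖ ≤ ‖Complex.log (1 - y) + y‖ + ‖y‖ := by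
    have := norm_sub_le (Complex.log (1 - y) + y) y
    simpa using this
  nlinarith [norm_nonneg y]

lemma Ef_bound {w y : ℂ} (hw : ‖w‖ ≤ 3) (hy : ‖y‖ ≤ 3 / 5) : ‖Ef w y - 1‖ ≤ CE * ‖y‖ ^ 2 := by
  set L := Complex.log (1 - y) with hL
  have h1 := log_one_sub_bound hy
  have h2 := log_one_sub_bound' hy
  rw [← hL] at h1 h2
  have h0 := norm_nonneg y
  have hwL : ‖w * L‖ ≤ 6 * ‖y‖ := by
    rw [norm_mul]
    calc ‖w‖ * ‖L‖ ≤ 3 * (2 * ‖y‖) := by gcongr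
      _ = _ := by ring
  have hR : ‖Complex.exp (w * L) - 1 - w * L‖ ≤ 36 * Real.exp 4 * ‖y‖ ^ 2 := by
    have h := Complex.norm_exp_sub_sum_le_norm_mul_exp (w * L) 2
    simp [Finset.sum_range_succ] at h
    rw [← norm_mul] at h
    rw [sub_sub]
    refine h.trans ?_
    calc ‖w * L‖ ^ 2 * Real.exp ‖w * L‖ ≤ (6 * ‖y‖) ^ 2 * Real.exp 4 := by
          gcongr
          linarith
      _ = _ := by ring
  set R := Complex.exp (w * L) - 1 - w * L with hRd
  have e : Ef w y - 1 = w * (L + y) + R + (w * y) * (w * L) + (w * y) * R := by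
    rw [hRd]; unfold Ef; rw [← hL]; ring
  rw [e]
  have hwy : ‖w * y‖ ≤ 3 * ‖y‖ := by rw [norm_mul]; gcongr
  have b1 : ‖w * (L + y)‖ ≤ 3 * (5 / 4 * ‖y‖ ^ 2) := by rw [norm_mul]; gcongr
  have b2 : ‖(w * y) * (w * L)‖ ≤ (3 * ‖y‖) * (6 * ‖y‖) := by rw [norm_mul]; gcongr
  have b3 : ‖(w * y) * R‖ ≤ 2 * (36 * Real.exp 4 * ‖y‖ ^ 2) := by
    rw [norm_mul]
    have : ‖w * y‖ ≤ 2 := by linarith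
    gcongr
  have n1 := norm_add_le (w * (L + y) + R + (w * y) * (w * L)) ((w * y) * R)
  have n2 := norm_add_le (w * (L + y) + R) ((w * y) * (w * L))
  have n3 := norm_add_le (w * (L + y)) R
  unfold CE
  nlinarith [sq_nonneg ‖y‖]

/-- Generic product lemma. -/
lemma prod_facts {ι : Type*} {f : ι → ℂ → ℂ} {K : Set ℂ} (hK : IsOpen K) {u : ι → ℝ}
    (hu : Summable u) (hf : ∀ i, ∀ x ∈ K, ‖f i x - 1‖ ≤ u i)
    (hd : ∀ i, DifferentiableOn ℂ (f i) K) :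
    DifferentiableOn ℂ (fun x => ∏' i, f i x) K ∧
    ∀ x ∈ K, Multipliable (fun i => f i x) ∧ ‖∏' i, f i x‖ ≤ Real.exp (∑' i, u i) := by
  have key := Summable.hasProdLocallyUniformlyOn_one_add (f := fun i x => f i x - 1) hK hu
    (Filter.Eventually.of_forall fun i x hx => hf i x hx)
    (fun i => ((hd i).sub_const 1).continuousOn)
  simp only [add_sub_cancel] at key
  refine ⟨?_, fun x hx => ?_⟩
  · refine TendstoLocallyUniformlyOn.differentiableOn key (Filter.Eventually.of_forall fun s => ?_) hK
    exact DifferentiableOn.fun_finsetProd fun i _ => hd i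
  · have hp := key.hasProd hx
    refine ⟨hp.multipliable, ?_⟩
    refine le_of_tendsto hp.norm (Filter.Eventually.of_forall fun s => ?_)
    have h1 := Finset.norm_prod_one_add_sub_one_le s (fun i => f i x - 1)
    simp only [add_sub_cancel] at h1
    have h2 : ∑ i ∈ s, ‖f i x - 1‖ ≤ ∑' i, u i := by
      refine (Finset.sum_le_sum fun i _ => hf i x hx).trans (hu.sum_le_tsum s fun i _ => ?_)
      exact (norm_nonneg _).trans (hf i x hx)
    have h3 := norm_sub_norm_le (∏ i ∈ s, f i x) 1
    have h4 := Real.exp_le_exp.mpr h2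
    simp at h3 h1
    simp
    linarith

/-- `p^{-s}` -/
def yp (p : Nat.Primes) (s : ℂ) : ℂ := ((p : ℕ) : ℂ) ^ (-s)

lemma yp_norm (p : Nat.Primes) (s : ℂ) : ‖yp p s‖ = ((p : ℕ) : ℝ) ^ (-s.re) := by
  unfold yp
  rw [Complex.norm_natCast_cpow_of_pos p.2.pos]; simp

lemma yp_norm_le (p : Nat.Primes) {s : ℂ} (hs : 3 / 4 ≤ s.re) :
    ‖yp p s‖ ≤ ((p : ℕ) : ℝ) ^ (-(3 / 4) : ℝ) := by
  rw [yp_norm]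
  exact Real.rpow_le_rpow_of_exponent_le (by exact_mod_cast p.2.one_lt.le) (by linarith)

lemma yp_norm_le' (p : Nat.Primes) {s : ℂ} (hs : 3 / 4 ≤ s.re) : ‖yp p s‖ ≤ 3 / 5 := by
  refine (yp_norm_le p hs).trans ?_
  have h2 : ((2:ℕ) : ℝ) ≤ (p : ℕ) := by exact_mod_cast p.2.two_le
  have h1 : ((p : ℕ) : ℝ) ^ (-(3 / 4) : ℝ) ≤ (2 : ℝ) ^ (-(3 / 4) : ℝ) :=
    Real.rpow_le_rpow_of_nonpos (by norm_num) (by exact_mod_cast h2) (by norm_num)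
  refine h1.trans ?_
  have : ((2 : ℝ) ^ (-(3 / 4) : ℝ)) ^ 4 ≤ (3 / 5) ^ 4 := by
    rw [← Real.rpow_natCast, ← Real.rpow_mul (by norm_num)]
    norm_num
  exact le_of_pow_le_pow_left₀ (by norm_num) (by norm_num) this

def up (p : Nat.Primes) : ℝ := CE * ((p : ℕ) : ℝ) ^ (-(3 / 2) : ℝ)

lemma up_summable : Summable up := by
  unfold up
  exact (Nat.Primes.summable_rpow.mpr (by norm_num)).mul_left _

lemma Ef_up {w : ℂ} (hw : ‖w‖ ≤ 3) (p : Nat.Primes) {s : ℂ} (hs : 3 / 4 ≤ s.re) :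
    ‖Ef w (yp p s) - 1‖ ≤ up p := by
  refine (Ef_bound hw (yp_norm_le' p hs)).trans ?_
  unfold up
  have : ‖yp p s‖ ^ 2 ≤ ((p : ℕ) : ℝ) ^ (-(3 / 2) : ℝ) := by
    have h := yp_norm_le p hs
    calc ‖yp p s‖ ^ 2 ≤ (((p : ℕ) : ℝ) ^ (-(3 / 4) : ℝ)) ^ 2 := by gcongr
      _ = _ := by
        rw [← Real.rpow_natCast, ← Real.rpow_mul (by positivity)]; norm_num
  have := CE_pos
  gcongr

def Gw (w s : ℂ) : ℂ := ∏' p : Nat.Primes, Ef w (yp p s)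

def BG : ℝ := Real.exp (∑' p, up p)

lemma isOpen_re (a : ℝ) : IsOpen {s : ℂ | a < s.re} := isOpen_lt continuous_const Complex.continuous_re

lemma yp_diff (p : Nat.Primes) : Differentiable ℂ (yp p) := by
  intro s
  unfold yp
  refine DifferentiableAt.const_cpow differentiableAt_id.neg (Or.inl ?_)
  exact_mod_cast p.2.ne_zero

lemma one_sub_yp_mem {p : Nat.Primes} {s : ℂ} (hs : 3 / 4 ≤ s.re) : 1 - yp p s ∈ Complex.slitPlane := by
  left
  have := (Complex.re_le_norm (yp p s)).trans (yp_norm_le' p hs)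
  simp; linarith

lemma Gw_facts {w : ℂ} (hw : ‖w‖ ≤ 3) : DifferentiableOn ℂ (Gw w) {s | 3 / 4 < s.re} ∧
    ∀ s ∈ {s : ℂ | 3 / 4 < s.re}, Multipliable (fun p => Ef w (yp p s)) ∧ ‖Gw w s‖ ≤ BG := by
  refine prod_facts (isOpen_re _) up_summable (fun p s hs => Ef_up hw p (le_of_lt hs)) ?_
  intro p s hs
  apply DifferentiableAt.differentiableWithinAt
  unfold Ef
  have h := yp_diff p s
  have h2 : DifferentiableAt ℂ (fun s => Complex.log (1 - yp p s)) s :=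
    (h.const_sub 1).clog (one_sub_yp_mem (le_of_lt hs))
  exact (((h.const_mul w).const_add 1).mul ((h2.const_mul w).cexp))

lemma Gw_deriv_bound {w : ℂ} (hw : ‖w‖ ≤ 3) {s : ℂ} (hs : 1 ≤ s.re) : ‖deriv (Gw w) s‖ ≤ 8 * BG := by
  obtain ⟨h1, h2⟩ := Gw_facts hw
  have hsub : Metric.closedBall s (1 / 8) ⊆ {s : ℂ | 3 / 4 < s.re} := by
    intro x hx
    rw [Metric.mem_closedBall, Complex.dist_eq] at hx
    have := (Complex.abs_re_le_norm (x - s)).trans hx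
    rw [abs_le] at this
    simp at this ⊢
    linarith [this.1]
  have := Complex.norm_deriv_le_of_forall_mem_sphere_norm_le (c := s) (R := 1 / 8) (C := BG)
    (f := Gw w) (by norm_num) (DifferentiableOn.diffContOnCl (h1.mono (by
      rw [closure_ball _ (by norm_num)]; exact hsub)))
    (fun z hz => (h2 z (hsub (Metric.sphere_subset_closedBall hz))).2)
  linarith [this]

lemma Gw_lip {w : ℂ} (hw : ‖w‖ ≤ 3) {s : ℂ} (hs : 1 ≤ s.re) :
    ‖Gw w s - Gw w 1‖ ≤ 8 * BG * ‖s - 1‖ := by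
  refine Convex.norm_image_sub_le_of_norm_deriv_le (s := {s : ℂ | 1 ≤ s.re}) (𝕜 := ℂ)
    (fun x hx => ?_) (fun x hx => Gw_deriv_bound hw hx) (convex_halfSpace_re_ge 1) (by simp) hs
  exact ((Gw_facts hw).1.differentiableAt ((isOpen_re _).mem_nhds (by
    simp only [Set.mem_ofPred_eq] at hx ⊢; linarith)))

lemma Phi1_eq (w : ℂ) : Phi1 w = (1 / Complex.Gamma (1 + w)) * Gw w 1 := by
  unfold Phi1 Gw
  congr 1
  refine tprod_congr fun p => ?_
  have hy : yp p 1 = 1 / ((p : ℕ) : ℂ) := by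
    unfold yp; rw [Complex.cpow_neg, Complex.cpow_one, one_div]
  unfold Ef
  have : (1 - 1 / ((p : ℕ) : ℂ)) ≠ 0 := by
    rw [← hy]; exact Complex.slitPlane_ne_zero (one_sub_yp_mem (by norm_num))
  rw [hy, Complex.cpow_def_of_ne_zero this, mul_comm (Complex.log _), mul_one_div]

lemma Gw1_diff : DifferentiableOn ℂ (fun w => Gw w 1) (Metric.ball 0 3) := by
  refine (prod_facts Metric.isOpen_ball up_summable (f := fun p w => Ef w (yp p 1))
    (fun p w hw => Ef_up ?_ p (by norm_num)) ?_).1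
  · simpa using (Metric.mem_ball.mp hw).le
  · intro p w hw
    apply DifferentiableAt.differentiableWithinAt
    unfold Ef
    fun_prop

lemma Phi1_diff : DifferentiableOn ℂ Phi1 (Metric.ball 0 3) := by
  have : Phi1 = fun w => (Complex.Gamma (1 + w))⁻¹ * Gw w 1 := by
    funext w; rw [Phi1_eq, one_div]
  rw [this]
  refine DifferentiableOn.mul ?_ Gw1_diff
  exact (Complex.differentiable_one_div_Gamma.comp (differentiable_id.const_add 1)).differentiableOn

lemma Phi1_zero : Phi1 0 = 1 := by
  rw [Phi1_eq]
  simp [Gw, Ef]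

lemma Phi1_taylor (r : ℕ) : ∃ C : ℝ, 0 < C ∧ ∀ w : ℂ, ‖w‖ ≤ 2 →
    ‖Phi1 w - ∑ l ∈ Finset.range (r + 1), taylorCoeff Phi1 l * w ^ l‖ ≤ C * ‖w‖ ^ (r + 1) := by
  have hsub : Metric.closedBall (0 : ℂ) ((5 / 2 : NNReal) : ℝ) ⊆ Metric.ball 0 3 := by
    refine Metric.closedBall_subset_ball ?_
    norm_num
  have hp := (Phi1_diff.mono hsub).hasFPowerSeriesOnBall (by norm_num)
  have hq := hp.analyticAt.hasFPowerSeriesAt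
  have hpq := hp.hasFPowerSeriesAt.eq_formalMultilinearSeries hq
  have hlt : (((9 / 4 : NNReal) : NNReal) : ENNReal) < ((5 / 2 : NNReal) : ENNReal) := by
    rw [ENNReal.coe_lt_coe, ← NNReal.coe_lt_coe]; norm_num
  obtain ⟨a, ha, C, hC, h⟩ := hp.uniform_geometric_approx' hlt
  refine ⟨C, hC, fun w hw => ?_⟩
  have h1 := h w (by rw [Metric.mem_ball, dist_zero_right]; norm_num; linarith) (r + 1)
  rw [zero_add] at h1
  have e : (cauchyPowerSeries Phi1 0 ((5 / 2 : NNReal) : ℝ)).partialSum (r + 1) w =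
      ∑ l ∈ Finset.range (r + 1), taylorCoeff Phi1 l * w ^ l := by
    rw [hpq, FormalMultilinearSeries.partialSum]
    refine Finset.sum_congr rfl fun l _ => ?_
    simp [taylorCoeff, mul_comm]
  rw [e] at h1
  refine h1.trans ?_
  gcongr
  · have := ha.1.le
    positivity
  · have h4 : ‖w‖ / ((9 / 4 : NNReal) : ℝ) ≤ ‖w‖ := by
      apply div_le_self (norm_nonneg _); norm_num
    have h5 : 0 ≤ ‖w‖ / ((9 / 4 : NNReal) : ℝ) := by positivity
    nlinarith [ha.1, ha.2]

lemma taylorCoeff_zero' : taylorCoeff Phi1 0 = 1 := by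
  simp [taylorCoeff, Phi1_zero]

lemma Phi1_bound : ∃ C : ℝ, 0 < C ∧ ∀ w : ℂ, ‖w‖ ≤ 2 → ‖Phi1 w‖ ≤ C ∧ ‖Phi1 w - 1‖ ≤ C * ‖w‖ := by
  obtain ⟨C, hC, h⟩ := Phi1_taylor 0
  have h' : ∀ w : ℂ, ‖w‖ ≤ 2 → ‖Phi1 w - 1‖ ≤ C * ‖w‖ := by
    intro w hw
    have := h w hw
    simpa [taylorCoeff_zero'] using this
  refine ⟨2 * C + 1, by positivity, fun w hw => ⟨?_, ?_⟩⟩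
  · have h1 := h' w hw
    have h2 := norm_sub_norm_le (Phi1 w) 1
    rw [norm_one] at h2
    nlinarith
  · refine (h' w hw).trans ?_
    gcongr
    linarith

end EK

namespace EK
open MeasureTheory Set Filter Asymptotics

def gJ : ℝ → ℂ := Set.indicator (Ioi 1) (fun t => ((Int.fract t : ℝ) : ℂ))

def J (s : ℂ) : ℂ := mellin gJ (-s)

lemma gJ_meas : Measurable gJ := by
  unfold gJ
  exact (Complex.measurable_ofReal.comp measurable_fract).indicator measurableSet_Ioi

lemma gJ_norm (t : ℝ) : ‖gJ t‖ ≤ 1 := by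
  unfold gJ
  refine (norm_indicator_le_norm_self _ _).trans ?_
  rw [Complex.norm_real, Real.norm_eq_abs, abs_of_nonneg (Int.fract_nonneg t)]
  exact (Int.fract_lt_one t).le

lemma J_eq (s : ℂ) : J s = ∫ t in Ioi (1:ℝ), ((Int.fract t : ℝ) : ℂ) * (t:ℂ) ^ (-(s + 1)) := by
  unfold J mellin gJ
  rw [← integral_indicator measurableSet_Ioi, ← integral_indicator measurableSet_Ioi]
  congr 1
  funext t
  by_cases h1 : 1 < t
  · have h0 : 0 < t := by linarith
    simp only [indicator, mem_Ioi, h0, h1, if_true, smul_eq_mul]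
    rw [mul_comm]; congr 2; ring
  · by_cases h0 : 0 < t <;> simp [indicator, h0, h1]

lemma J_diffAt {s : ℂ} (hs : 0 < s.re) : DifferentiableAt ℂ J s := by
  have : DifferentiableAt ℂ (mellin gJ) (-s) := by
    refine mellin_differentiableAt_of_isBigO_rpow (a := 0) (b := -s.re - 1) ?_ ?_ ?_ ?_ ?_
    · refine LocallyIntegrable.locallyIntegrableOn ?_ _
      refine (locallyIntegrable_const (1 : ℝ)).mono gJ_meas.aestronglyMeasurable
        (Eventually.of_forall fun t => ?_)
      simpa using gJ_norm t
    · refine IsBigO.of_bound 1 (Eventually.of_forall fun t => ?_)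
      simpa using gJ_norm t
    · simpa using hs
    · refine IsBigO.of_bound 1 ?_
      have : ∀ᶠ t : ℝ in nhdsWithin 0 (Ioi 0), t < 1 :=
        nhdsWithin_le_nhds (Iio_mem_nhds (by norm_num))
      filter_upwards [this] with t ht
      have : gJ t = 0 := by
        unfold gJ; rw [indicator_of_notMem]; simp; linarith
      rw [this]; simp
    · simp
  exact DifferentiableAt.comp s this differentiableAt_id.neg

lemma J_bound {s : ℂ} (hs : 0 < s.re) : ‖J s‖ ≤ 1 / s.re := by
  rw [J_eq]
  have hIntg : IntegrableOn (fun t : ℝ => t ^ (-(s.re + 1))) (Ioi 1) :=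
    integrableOn_Ioi_rpow_of_lt (by linarith) (by norm_num)
  have h := norm_integral_le_of_norm_le (f := fun t : ℝ => ((Int.fract t : ℝ) : ℂ) * (t:ℂ) ^ (-(s + 1)))
    hIntg ?_
  · refine h.trans ?_
    rw [integral_Ioi_rpow_of_lt (by linarith) (by norm_num)]
    simp
  · refine (ae_restrict_mem measurableSet_Ioi).mono fun t ht => ?_
    have ht' : 0 < t := by have := mem_Ioi.mp ht; linarith
    rw [norm_mul, Complex.norm_real, Real.norm_eq_abs, abs_of_nonneg (Int.fract_nonneg t),
      Complex.norm_cpow_eq_rpow_re_of_pos ht']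
    have e : (-(s + 1)).re = -(s.re + 1) := by simp
    rw [e]
    exact mul_le_of_le_one_left (by positivity) (Int.fract_lt_one t).le

lemma J_deriv_bound {s : ℂ} (hs : 1 ≤ s.re) : ‖deriv J s‖ ≤ 4 := by
  have hsub : ∀ x ∈ Metric.closedBall s (1 / 2), 1 / 2 ≤ x.re := by
    intro x hx
    rw [Metric.mem_closedBall, Complex.dist_eq] at hx
    have := (Complex.abs_re_le_norm (x - s)).trans hx
    rw [abs_le] at this
    simp at this ⊢
    linarith [this.1]
  have := Complex.norm_deriv_le_of_forall_mem_sphere_norm_le (c := s) (R := 1 / 2) (C := 2)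
    (f := J) (by norm_num) (DifferentiableOn.diffContOnCl (fun x hx => by
      rw [closure_ball _ (by norm_num)] at hx
      exact (J_diffAt (by linarith [hsub x hx])).differentiableWithinAt))
    (fun z hz => by
      have hz' := hsub z (Metric.sphere_subset_closedBall hz)
      refine (J_bound (by linarith)).trans ?_
      rw [div_le_iff₀ (by linarith)]; linarith)
  linarith [this]

lemma zeta_eq {s : ℂ} (hs : 1 < s.re) : riemannZeta s = s / (s - 1) - s * J s := by
  have h := LSeries_eq_mul_integral' (fun _ => (1:ℂ)) zero_le_one hs (by
    refine IsBigO.of_bound 1 (Eventually.of_forall fun n => ?_)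
    simp)
  have hz : LSeries (fun _ => (1:ℂ)) s = riemannZeta s := LSeries_one_eq_riemannZeta hs
  rw [← hz, h, J_eq]
  have hs1 : s - 1 ≠ 0 := by
    intro h; rw [sub_eq_zero] at h; rw [h] at hs; simp at hs
  have i1 : IntegrableOn (fun t : ℝ => (t : ℂ) ^ (-s)) (Ioi 1) := by
    rw [integrableOn_Ioi_cpow_iff (by norm_num)]; simpa using hs
  have i2 : IntegrableOn (fun t : ℝ => ((Int.fract t : ℝ) : ℂ) * (t:ℂ) ^ (-(s + 1))) (Ioi 1) := by
    have hIntg : IntegrableOn (fun t : ℝ => (t:ℂ) ^ (-(s + 1))) (Ioi 1) := by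
      rw [integrableOn_Ioi_cpow_iff (by norm_num)]; simp; linarith
    refine Integrable.mono hIntg ?_ (Eventually.of_forall fun t => ?_)
    · exact (Complex.measurable_ofReal.comp measurable_fract).aestronglyMeasurable.mul
        hIntg.aestronglyMeasurable
    · rw [norm_mul, Complex.norm_real, Real.norm_eq_abs, abs_of_nonneg (Int.fract_nonneg t)]
      exact mul_le_of_le_one_left (by positivity) (Int.fract_lt_one t).le
  have i0 : ∫ t in Ioi (1:ℝ), (t : ℂ) ^ (-s) = 1 / (s - 1) := by
    rw [integral_Ioi_cpow_of_lt (by simpa using hs) (by norm_num)]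
    simp
    rw [div_eq_iff (by intro h; apply hs1; linear_combination -h)]
    field_simp
    ring
  have : ∫ t in Ioi (1:ℝ), (∑ k ∈ Finset.Icc 1 ⌊t⌋₊, (1:ℂ)) * (t:ℂ) ^ (-(s + 1)) =
      (∫ t in Ioi (1:ℝ), (t : ℂ) ^ (-s)) -
        ∫ t in Ioi (1:ℝ), ((Int.fract t : ℝ) : ℂ) * (t:ℂ) ^ (-(s + 1)) := by
    rw [← integral_sub i1 i2]
    refine setIntegral_congr_fun measurableSet_Ioi fun t ht => ?_
    have ht' : 0 < t := by have := mem_Ioi.mp ht; linarith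
    have e1 : (t : ℂ) ^ (-s) = t * (t : ℂ) ^ (-(s + 1)) := by
      rw [show -s = 1 + (-(s+1)) by ring, Complex.cpow_add _ _ (by exact_mod_cast ht'.ne'),
        Complex.cpow_one]
    have e2 : ((⌊t⌋₊ : ℕ) : ℂ) = (t : ℂ) - ((Int.fract t : ℝ) : ℂ) := by
      have : ((⌊t⌋₊ : ℕ) : ℝ) = t - Int.fract t := by
        rw [natCast_floor_eq_intCast_floor ht'.le]; exact (Int.self_sub_fract t).symm
      exact_mod_cast congrArg (fun x : ℝ => (x : ℂ)) this
    rw [e1]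
    simp only [Finset.sum_const, Nat.card_Icc, add_tsub_cancel_right, nsmul_eq_mul, mul_one]
    rw [e2]; ring
  rw [this, i0]
  ring

/-- `(s-1) ζ(s)`, continued. -/
def Zc (s : ℂ) : ℂ := s - s * (s - 1) * J s

lemma Zc_eq {s : ℂ} (hs : 1 < s.re) : Zc s = (s - 1) * riemannZeta s := by
  have hs1 : s - 1 ≠ 0 := by
    intro h; rw [sub_eq_zero] at h; rw [h] at hs; simp at hs
  rw [zeta_eq hs]; unfold Zc; field_simp

lemma Zc_diffAt {s : ℂ} (hs : 0 < s.re) : DifferentiableAt ℂ Zc s := by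
  have := J_diffAt hs
  unfold Zc
  fun_prop

lemma Zc_one : Zc 1 = 1 := by simp [Zc]

lemma Zc_ne_zero {s : ℂ} (hs : 1 ≤ s.re) : Zc s ≠ 0 := by
  by_cases h1 : s = 1
  · rw [h1, Zc_one]; exact one_ne_zero
  · have : Zc s = (s - 1) * riemannZeta s := by
      have hc1 : Tendsto (fun x : ℝ => Zc (s + x)) (nhdsWithin 0 (Ioi 0)) (nhds (Zc s)) := by
        have : ContinuousAt (fun x : ℝ => Zc (s + x)) 0 := by
          refine ContinuousAt.comp (g := Zc) ?_ (by fun_prop)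
          simp; exact (Zc_diffAt (by linarith)).continuousAt
        have h := this.tendsto.mono_left (nhdsWithin_le_nhds (s := Ioi 0))
        simpa using h
      have hc2 : Tendsto (fun x : ℝ => (s + x - 1) * riemannZeta (s + x)) (nhdsWithin 0 (Ioi 0))
          (nhds ((s - 1) * riemannZeta s)) := by
        have : ContinuousAt (fun x : ℝ => (s + x - 1) * riemannZeta (s + x)) 0 := by
          refine ContinuousAt.mul (by fun_prop) ?_
          refine ContinuousAt.comp (g := riemannZeta) ?_ (by fun_prop)
          simp; exact (differentiableAt_riemannZeta h1).continuousAt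
        have h := this.tendsto.mono_left (nhdsWithin_le_nhds (s := Ioi 0))
        simpa using h
      refine tendsto_nhds_unique hc1 (hc2.congr' ?_)
      filter_upwards [self_mem_nhdsWithin] with x hx
      rw [Zc_eq]
      simp; have := mem_Ioi.mp hx; linarith
    rw [this]
    exact mul_ne_zero (sub_ne_zero.mpr h1) (riemannZeta_ne_zero_of_one_le_re hs)

end EK

namespace EK
open MeasureTheory Set Filter Asymptotics

lemma norm_s_le {s : ℂ} (h1 : 1 < s.re) (h2 : s.re ≤ 2) (ht : 1 ≤ |s.im|) : ‖s‖ ≤ 3 * |s.im| := by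
  have := Complex.norm_le_abs_re_add_abs_im s
  rw [abs_of_pos (by linarith : 0 < s.re)] at this
  linarith

lemma norm_s_sub_ge {s : ℂ} : |s.im| ≤ ‖s - 1‖ := by
  have := Complex.abs_im_le_norm (s - 1)
  simpa using this

lemma zeta_upper {s : ℂ} (h1 : 1 < s.re) (h2 : s.re ≤ 2) (ht : 1 ≤ |s.im|) :
    ‖riemannZeta s‖ ≤ 6 * |s.im| := by
  rw [zeta_eq h1]
  have a := norm_s_le h1 h2 ht
  have b := norm_s_sub_ge (s := s)
  have c := J_bound (s := s) (by linarith)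
  have c' : ‖J s‖ ≤ 1 := c.trans (by rw [div_le_iff₀ (by linarith)]; linarith)
  refine (norm_sub_le _ _).trans ?_
  rw [norm_div, norm_mul]
  have d1 : ‖s‖ / ‖s - 1‖ ≤ ‖s‖ := div_le_self (norm_nonneg _) (by linarith)
  have d2 : ‖s‖ * ‖J s‖ ≤ ‖s‖ * 1 := by gcongr
  linarith

lemma zeta_deriv_upper {s : ℂ} (h1 : 1 < s.re) (h2 : s.re ≤ 2) (ht : 1 ≤ |s.im|) :
    ‖deriv riemannZeta s‖ ≤ 14 * |s.im| := by
  have b := norm_s_sub_ge (s := s)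
  have hs1 : s - 1 ≠ 0 := by
    rw [← norm_pos_iff]; linarith
  have hev : riemannZeta =ᶠ[nhds s] fun s => s / (s - 1) - s * J s := by
    filter_upwards [(isOpen_re 1).mem_nhds h1] with x hx using zeta_eq hx
  rw [hev.deriv_eq]
  have hJ := (J_diffAt (s := s) (by linarith)).hasDerivAt
  have hd : HasDerivAt (fun s => s / (s - 1) - s * J s)
      ((1 * (s - 1) - s * 1) / (s - 1) ^ 2 - (1 * J s + s * deriv J s)) s :=
    ((hasDerivAt_id s).div ((hasDerivAt_id s).sub_const 1) hs1).sub ((hasDerivAt_id s).mul hJ)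
  rw [hd.deriv]
  have a := norm_s_le h1 h2 ht
  have c := J_bound (s := s) (by linarith)
  have c' : ‖J s‖ ≤ 1 := c.trans (by rw [div_le_iff₀ (by linarith)]; linarith)
  have e := J_deriv_bound h1.le
  have n1 : ‖(1 * (s - 1) - s * 1) / (s - 1) ^ 2‖ ≤ 1 := by
    rw [show 1 * (s - 1) - s * 1 = -1 by ring, norm_div, norm_neg, norm_one, norm_pow]
    rw [div_le_one (by positivity)]
    nlinarith
  have n2 : ‖1 * J s + s * deriv J s‖ ≤ 1 + 3 * |s.im| * 4 := by
    refine (norm_add_le _ _).trans ?_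
    rw [one_mul, norm_mul]
    gcongr
  have := norm_sub_le ((1 * (s - 1) - s * 1) / (s - 1) ^ 2) (1 * J s + s * deriv J s)
  linarith

lemma zeta_real_upper {x : ℝ} (h0 : 0 < x) (h1 : x ≤ 1) : ‖riemannZeta (1 + x)‖ ≤ 4 / x := by
  have hre : ((1:ℂ) + x).re = 1 + x := by simp
  rw [zeta_eq (by rw [hre]; linarith)]
  have c := J_bound (s := 1 + x) (by rw [hre]; linarith)
  rw [hre] at c
  have c' : ‖J (1 + x)‖ ≤ 1 := c.trans (by rw [div_le_iff₀ (by linarith)]; linarith)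
  have hn : ‖(1:ℂ) + x‖ ≤ 2 := by
    refine (norm_add_le _ _).trans ?_
    rw [norm_one, Complex.norm_real, Real.norm_eq_abs, abs_of_pos h0]; linarith
  refine (norm_sub_le _ _).trans ?_
  rw [norm_div, norm_mul, add_sub_cancel_left, Complex.norm_real, Real.norm_eq_abs, abs_of_pos h0]
  have d1 : ‖(1:ℂ) + x‖ / x ≤ 2 / x := by gcongr
  have d2 : ‖(1:ℂ) + x‖ * ‖J (1 + x)‖ ≤ 2 * 1 := by gcongr
  have d3 : (2:ℝ) ≤ 2 / x := by rw [le_div_iff₀ h0]; linarith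
  have : 4 / x = 2 / x + 2 / x := by ring
  linarith

lemma zeta_341 {x : ℝ} (hx : 0 < x) (y : ℝ) :
    1 ≤ ‖riemannZeta (1 + x)‖ ^ 3 * ‖riemannZeta (1 + x + Complex.I * y)‖ ^ 4 *
      ‖riemannZeta (1 + x + 2 * Complex.I * y)‖ := by
  have h := DirichletCharacter.norm_LFunction_product_ge_one (N := 1) 1 hx y
  rw [DirichletCharacter.LFunctionTrivChar] at h
  simpa [DirichletCharacter.LFunction_modOne_eq] using h

def M0 : ℝ := 28 ^ 4 * 768

def eta0 (t : ℝ) : ℝ := 1 / (M0 * t ^ 5)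

lemma M0_pos : 0 < M0 := by unfold M0; norm_num

lemma eta0_pos {t : ℝ} (ht : 1 ≤ t) : 0 < eta0 t := by
  have := M0_pos
  unfold eta0; positivity

lemma eta0_le {t : ℝ} (ht : 1 ≤ t) : eta0 t ≤ 1 := by
  unfold eta0
  have h5 : 1 ≤ t ^ 5 := one_le_pow₀ ht
  have : (1:ℝ) ≤ M0 := by unfold M0; norm_num
  rw [div_le_one (by positivity)]
  nlinarith

lemma zeta_lower_far {s : ℂ} (h2 : s.re ≤ 2) (ht : 1 ≤ |s.im|)
    (hη : eta0 |s.im| ≤ s.re - 1) : 28 * eta0 |s.im| * |s.im| ≤ ‖riemannZeta s‖ := by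
  set t := |s.im| with htd
  have e0 := eta0_pos ht
  set x := s.re - 1 with hx
  have hx0 : 0 < x := by linarith
  have hx1 : x ≤ 1 := by linarith
  have h341 := zeta_341 hx0 s.im
  have es : (1 : ℂ) + x + Complex.I * s.im = s := by
    apply Complex.ext <;> simp [hx]
  rw [es] at h341
  have u1 := zeta_real_upper hx0 hx1
  have u2 : ‖riemannZeta (1 + x + 2 * Complex.I * s.im)‖ ≤ 6 * (2 * t) := by
    have hre : ((1 : ℂ) + x + 2 * Complex.I * s.im).re = 1 + x := by simp
    have him : ((1 : ℂ) + x + 2 * Complex.I * s.im).im = 2 * s.im := by simp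
    have := zeta_upper (s := 1 + x + 2 * Complex.I * s.im) (by rw [hre]; linarith)
      (by rw [hre]; linarith) (by rw [him, abs_mul, abs_two]; linarith)
    rwa [him, abs_mul, abs_two] at this
  have h3 : 1 ≤ (4 / x) ^ 3 * ‖riemannZeta s‖ ^ 4 * (6 * (2 * t)) := by
    refine h341.trans ?_
    gcongr
  have h4 : x ^ 3 ≤ 768 * t * ‖riemannZeta s‖ ^ 4 := by
    have : (4 / x) ^ 3 * ‖riemannZeta s‖ ^ 4 * (6 * (2 * t)) = (768 * t * ‖riemannZeta s‖ ^ 4) / x ^ 3 := by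
      field_simp; ring
    rw [this, le_div_iff₀ (by positivity)] at h3
    linarith
  have h5 : eta0 t ^ 3 ≤ x ^ 3 := by gcongr
  have h6 : 768 * t * (28 * eta0 t * t) ^ 4 = eta0 t ^ 3 := by
    have : eta0 t * (M0 * t ^ 5) = 1 := by
      have := M0_pos
      unfold eta0; field_simp
    calc 768 * t * (28 * eta0 t * t) ^ 4 = (eta0 t * (M0 * t ^ 5)) * eta0 t ^ 3 := by unfold M0; ring
      _ = _ := by rw [this, one_mul]
  have h7 : (28 * eta0 t * t) ^ 4 ≤ ‖riemannZeta s‖ ^ 4 := by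
    have : 768 * t * (28 * eta0 t * t) ^ 4 ≤ 768 * t * ‖riemannZeta s‖ ^ 4 := by linarith
    exact le_of_mul_le_mul_left this (by positivity)
  exact le_of_pow_le_pow_left₀ (by norm_num) (norm_nonneg _) h7

/-- the strip on a horizontal line -/
lemma horiz_lip {f : ℂ → ℂ} {s : ℂ} {a C : ℝ} (h1 : 1 < s.re) (ha : s.re ≤ 1 + a) (ha1 : a ≤ 1)
    (hd : ∀ z : ℂ, 1 < z.re → DifferentiableAt ℂ f z)
    (hb : ∀ z : ℂ, 1 < z.re → z.re ≤ 2 → z.im = s.im → ‖deriv f z‖ ≤ C) :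
    ‖f ((1 + a : ℝ) + Complex.I * s.im) - f s‖ ≤ C * (1 + a - s.re) := by
  set S : Set ℂ := {z : ℂ | 1 < z.re} ∩ {z | z.re ≤ 2} ∩ ({z | s.im ≤ z.im} ∩ {z | z.im ≤ s.im})
  have hconv : Convex ℝ S := ((convex_halfSpace_re_gt 1).inter (convex_halfSpace_re_le 2)).inter
    ((convex_halfSpace_im_ge _).inter (convex_halfSpace_im_le _))
  have hs2 : (((1 + a : ℝ) : ℂ) + Complex.I * s.im) ∈ S := by
    refine ⟨⟨?_, ?_⟩, ?_, ?_⟩ <;> simp <;> linarith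
  have hs1 : s ∈ S := by
    refine ⟨⟨h1, ?_⟩, le_refl s.im, le_refl s.im⟩
    show s.re ≤ 2
    linarith
  have := Convex.norm_image_sub_le_of_norm_deriv_le (𝕜 := ℂ) (f := f) (C := C) (s := S)
    (fun x hx => hd x hx.1.1) (fun x hx => hb x hx.1.1 hx.1.2 (le_antisymm hx.2.2 hx.2.1))
    hconv hs1 hs2
  refine this.trans_eq ?_
  congr 1
  have : ((1 + a : ℝ) : ℂ) + Complex.I * s.im - s = ((1 + a - s.re : ℝ) : ℂ) := by
    apply Complex.ext <;> simp
  rw [this, Complex.norm_real, Real.norm_eq_abs, abs_of_nonneg (by linarith)]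

lemma zeta_diffAt {s : ℂ} (h : 1 < s.re) : DifferentiableAt ℂ riemannZeta s := by
  apply differentiableAt_riemannZeta
  rintro rfl; simp at h

lemma zeta_lower {s : ℂ} (h1 : 1 < s.re) (h2 : s.re ≤ 2) (ht : 1 ≤ |s.im|) :
    14 * eta0 |s.im| * |s.im| ≤ ‖riemannZeta s‖ := by
  have e0 := eta0_pos ht
  have e1 := eta0_le ht
  rcases le_total (eta0 |s.im|) (s.re - 1) with h | h
  · have := zeta_lower_far h2 ht h
    have : 0 ≤ eta0 |s.im| * |s.im| := by positivity
    linarith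
  · have hl := horiz_lip (f := riemannZeta) (a := eta0 |s.im|) (C := 14 * |s.im|) h1 (by linarith) e1
      (fun z hz => zeta_diffAt hz)
      (fun z hz hz2 hz3 => by rw [← hz3]; exact zeta_deriv_upper hz hz2 (by rw [hz3]; exact ht))
    set s' : ℂ := ((1 + eta0 |s.im| : ℝ) : ℂ) + Complex.I * s.im with hs'
    have hre : s'.re = 1 + eta0 |s.im| := by simp [hs']
    have him : s'.im = s.im := by simp [hs']
    have hf := zeta_lower_far (s := s') (by rw [hre]; linarith) (by rw [him]; exact ht)
      (by rw [hre, him]; linarith)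
    rw [him] at hf
    have h3 := norm_sub_norm_le (riemannZeta s') (riemannZeta s)
    have h4 : 14 * |s.im| * (1 + eta0 |s.im| - s.re) ≤ 14 * |s.im| * eta0 |s.im| := by
      gcongr; linarith
    linarith

lemma zeta_logderiv {s : ℂ} (h1 : 1 < s.re) (h2 : s.re ≤ 2) (ht : 1 ≤ |s.im|) :
    ‖deriv riemannZeta s / riemannZeta s‖ ≤ 1 / eta0 |s.im| := by
  have e0 := eta0_pos ht
  have h := zeta_lower h1 h2 ht
  have h' := zeta_deriv_upper h1 h2 ht
  have hp : 0 < 14 * eta0 |s.im| * |s.im| := by positivity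
  rw [norm_div, div_le_div_iff₀ (by linarith) e0]
  calc ‖deriv riemannZeta s‖ * eta0 |s.im| ≤ 14 * |s.im| * eta0 |s.im| := by gcongr
    _ ≤ _ := by linarith

end EK

namespace EK
open MeasureTheory Set Filter Asymptotics

/-- the logarithm of zeta on `Re s > 1` -/
def Lz (s : ℂ) : ℂ := ∑' p : Nat.Primes, -Complex.log (1 - yp p s)

lemma Lz_term_bound (p : Nat.Primes) {s : ℂ} (hs : 1 ≤ s.re) :
    ‖-Complex.log (1 - yp p s)‖ ≤ 2 * (p:ℝ) ^ (-s.re) := by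
  rw [norm_neg, ← yp_norm]
  exact log_one_sub_bound' (yp_norm_le' p (by linarith))

lemma Lz_exp {s : ℂ} (hs : 1 < s.re) : Complex.exp (Lz s) = riemannZeta s :=
  riemannZeta_eulerProduct_exp_log hs

lemma primes_summable {x : ℝ} (hx : 1 < x) : Summable (fun p : Nat.Primes => (p:ℝ) ^ (-x)) :=
  Nat.Primes.summable_rpow.2 (by linarith)

lemma Lz_summable {s : ℂ} (hs : 1 < s.re) :
    Summable (fun p : Nat.Primes => -Complex.log (1 - yp p s)) :=
  Summable.of_norm_bounded ((primes_summable hs).mul_left 2) (fun p => Lz_term_bound p hs.le)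

lemma Lz_diffAt {s : ℂ} (hs : 1 < s.re) : DifferentiableAt ℂ Lz s := by
  set a := (1 + s.re) / 2 with ha
  have ha1 : 1 < a := by rw [ha]; linarith
  have hsa : a < s.re := by rw [ha]; linarith
  have : DifferentiableOn ℂ Lz {z | a < z.re} := by
    apply Complex.differentiableOn_tsum_of_summable_norm ((primes_summable ha1).mul_left 2)
      (F := fun p z => -Complex.log (1 - yp p z))
    · intro p z hz
      have hz' : a < z.re := hz
      apply DifferentiableAt.differentiableWithinAt
      apply DifferentiableAt.neg
      exact ((differentiableAt_const _).sub (yp_diff p z)).clog (one_sub_yp_mem (p := p) (s := z) (by linarith))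
    · exact isOpen_re a
    · intro p z hz
      have hz' : a < z.re := hz
      refine (Lz_term_bound p (by linarith)).trans ?_
      gcongr
      exact_mod_cast p.2.one_lt.le
  exact (this s hsa).differentiableAt ((isOpen_re a).mem_nhds hsa)

lemma Lz_deriv {s : ℂ} (hs : 1 < s.re) : deriv Lz s = deriv riemannZeta s / riemannZeta s := by
  have h1 : HasDerivAt (fun z => Complex.exp (Lz z)) (Complex.exp (Lz s) * deriv Lz s) s :=
    (Lz_diffAt hs).hasDerivAt.cexp
  have h2 : (fun z => Complex.exp (Lz z)) =ᶠ[nhds s] riemannZeta := by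
    filter_upwards [(isOpen_re 1).mem_nhds hs] with z hz
    exact Lz_exp hz
  have h3 := (h1.congr_of_eventuallyEq h2.symm).deriv
  rw [h3, Lz_exp hs]
  have : riemannZeta s ≠ 0 := by rw [← Lz_exp hs]; exact Complex.exp_ne_zero _
  field_simp

lemma primes_sum_le {x : ℝ} (hx : 1 < x) :
    ∑' p : Nat.Primes, (p:ℝ) ^ (-x) ≤ Real.log ‖riemannZeta (x:ℂ)‖ := by
  have hx' : 1 < (x:ℂ).re := by simpa
  rw [← Lz_exp hx', Complex.norm_exp, Real.log_exp]
  unfold Lz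
  rw [Complex.re_tsum (Lz_summable hx')]
  apply Summable.tsum_le_tsum _ (primes_summable hx)
    (Complex.reCLM.summable (Lz_summable hx'))
  intro p
  have hp : (0:ℝ) ≤ (p:ℝ) := by positivity
  have e : yp p (x:ℂ) = (((p:ℝ) ^ (-x) : ℝ) : ℂ) := by
    rw [Complex.ofReal_cpow hp]; simp [yp]
  have h1 := yp_norm_le' p (s := (x:ℂ)) (by simp; linarith)
  rw [yp_norm] at h1
  simp only [Complex.ofReal_re] at h1
  show (p:ℝ) ^ (-x) ≤ (-Complex.log (1 - yp p (x:ℂ))).re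
  rw [e, Complex.neg_re, Complex.log_re, ← Complex.ofReal_one, ← Complex.ofReal_sub,
    Complex.norm_real, Real.norm_eq_abs, abs_of_pos (by linarith)]
  have := Real.log_le_sub_one_of_pos (x := 1 - (p:ℝ) ^ (-x)) (by linarith)
  linarith

lemma Lz_bound_far {s : ℂ} {x : ℝ} (hx : 0 < x) (hx1 : x ≤ 1) (hs : 1 + x ≤ s.re) :
    ‖Lz s‖ ≤ 2 * Real.log (4 / x) := by
  have h1 : 1 < s.re := by linarith
  have h2 : ‖Lz s‖ ≤ ∑' p : Nat.Primes, 2 * (p:ℝ) ^ (-(1 + x)) := by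
    apply tsum_of_norm_bounded ((primes_summable (by linarith : 1 < 1 + x)).mul_left 2).hasSum
    intro p
    refine (Lz_term_bound p h1.le).trans ?_
    gcongr
    exact_mod_cast p.2.one_lt.le
  rw [tsum_mul_left] at h2
  have h3 := primes_sum_le (by linarith : 1 < 1 + x)
  have h4 := zeta_real_upper hx hx1
  push_cast at h3
  have h5 : 0 < ‖riemannZeta (1 + (x:ℂ))‖ := by
    rw [norm_pos_iff]
    apply riemannZeta_ne_zero_of_one_le_re; simp [hx.le]
  have h6 := Real.log_le_log h5 h4
  linarith

lemma Lz_bound {s : ℂ} (h1 : 1 < s.re) (h2 : s.re ≤ 2) (ht : 1 ≤ |s.im|) :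
    ‖Lz s‖ ≤ 1 + 2 * Real.log (4 / eta0 |s.im|) := by
  have e0 := eta0_pos ht
  have e1 := eta0_le ht
  rcases le_total (eta0 |s.im|) (s.re - 1) with h | h
  · have := Lz_bound_far e0 e1 (s := s) (by linarith)
    linarith
  · have hl := horiz_lip (f := Lz) (a := eta0 |s.im|) (C := 1 / eta0 |s.im|) h1 (by linarith) e1
      (fun z hz => Lz_diffAt hz)
      (fun z hz hz2 hz3 => by
        rw [Lz_deriv hz, ← hz3]; exact zeta_logderiv hz hz2 (by rw [hz3]; exact ht))
    set s' : ℂ := ((1 + eta0 |s.im| : ℝ) : ℂ) + Complex.I * s.im with hs'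
    have hre : s'.re = 1 + eta0 |s.im| := by simp [hs']
    have hf := Lz_bound_far e0 e1 (s := s') hre.ge
    have h3 := norm_sub_norm_le (Lz s) (Lz s')
    rw [norm_sub_rev] at h3
    have h4 : 1 / eta0 |s.im| * (1 + eta0 |s.im| - s.re) ≤ 1 / eta0 |s.im| * eta0 |s.im| := by
      gcongr; linarith
    rw [one_div, inv_mul_cancel₀ e0.ne'] at h4
    rw [one_div] at hl
    linarith

def M1 : ℝ := Real.exp 1 * (4 * M0) ^ 2

lemma M1_pos : 0 < M1 := by
  have := M0_pos
  unfold M1; positivity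

lemma exp_Lz_bound {s : ℂ} (h1 : 1 < s.re) (h2 : s.re ≤ 2) (ht : 1 ≤ |s.im|) :
    Real.exp ‖Lz s‖ ≤ M1 * |s.im| ^ 10 := by
  have hM := M0_pos
  refine (Real.exp_le_exp.2 (Lz_bound h1 h2 ht)).trans_eq ?_
  have e : 4 / eta0 |s.im| = 4 * M0 * |s.im| ^ 5 := by unfold eta0; field_simp
  have hp : 0 < 4 * M0 * |s.im| ^ 5 := by positivity
  rw [e, Real.exp_add, two_mul, Real.exp_add, Real.exp_log hp]
  unfold M1; ring

lemma Lz_deriv_bound {s : ℂ} (h1 : 1 < s.re) (h2 : s.re ≤ 2) (ht : 1 ≤ |s.im|) :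
    ‖deriv Lz s‖ ≤ M0 * |s.im| ^ 5 := by
  rw [Lz_deriv h1]
  refine (zeta_logderiv h1 h2 ht).trans_eq ?_
  unfold eta0; simp

/-! near one -/

def ell (s : ℂ) : ℂ := Lz s + Complex.log (s - 1)

lemma sub_one_slit {s : ℂ} (h : 1 < s.re) : s - 1 ∈ Complex.slitPlane := by
  left; simp; linarith

lemma ell_exp {s : ℂ} (h : 1 < s.re) : Complex.exp (ell s) = Zc s := by
  have : s - 1 ≠ 0 := Complex.slitPlane_ne_zero (sub_one_slit h)
  rw [ell, Complex.exp_add, Lz_exp h, Complex.exp_log this, Zc_eq h, mul_comm]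

lemma ell_diffAt {s : ℂ} (h : 1 < s.re) : DifferentiableAt ℂ ell s :=
  (Lz_diffAt h).add ((differentiableAt_id.sub_const 1).clog (sub_one_slit h))

lemma ell_deriv {s : ℂ} (hs : 1 < s.re) : deriv ell s = deriv Zc s / Zc s := by
  have h1 : HasDerivAt (fun z => Complex.exp (ell z)) (Complex.exp (ell s) * deriv ell s) s :=
    (ell_diffAt hs).hasDerivAt.cexp
  have h2 : (fun z => Complex.exp (ell z)) =ᶠ[nhds s] Zc := by
    filter_upwards [(isOpen_re 1).mem_nhds hs] with z hz
    exact ell_exp hz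
  have h3 := (h1.congr_of_eventuallyEq h2.symm).deriv
  rw [h3, ell_exp hs]
  have : Zc s ≠ 0 := by rw [← ell_exp hs]; exact Complex.exp_ne_zero _
  field_simp

lemma ell_deriv_bound : ∃ C > 0, ∀ s : ℂ, 1 < s.re → s.re ≤ 2 → |s.im| ≤ 1 → ‖deriv ell s‖ ≤ C := by
  have hK : IsCompact (Icc (1:ℝ) 2 ×ℂ Icc (-1:ℝ) 1) := isCompact_Icc.reProdIm isCompact_Icc
  have hZd : DifferentiableOn ℂ Zc {s | 0 < s.re} :=
    fun s hs => (Zc_diffAt hs).differentiableWithinAt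
  have hZ' : DifferentiableOn ℂ (deriv Zc) {s | 0 < s.re} := hZd.deriv (isOpen_re 0)
  have hsub : (Icc (1:ℝ) 2 ×ℂ Icc (-1:ℝ) 1) ⊆ {s : ℂ | 0 < s.re} := by
    intro s hs
    have : (1:ℝ) ≤ s.re := (Complex.mem_reProdIm.1 hs).1.1
    show 0 < s.re
    linarith
  have hc : ContinuousOn (fun s => deriv Zc s / Zc s) (Icc (1:ℝ) 2 ×ℂ Icc (-1:ℝ) 1) := by
    apply ContinuousOn.div (hZ'.continuousOn.mono hsub) (hZd.continuousOn.mono hsub)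
    intro s hs
    exact Zc_ne_zero (Complex.mem_reProdIm.1 hs).1.1
  obtain ⟨C, hC⟩ := hK.exists_bound_of_continuousOn hc
  refine ⟨max C 1, by positivity, fun s h1 h2 h3 => ?_⟩
  rw [ell_deriv h1]
  refine (hC s (Complex.mem_reProdIm.2 ⟨⟨h1.le, h2⟩, abs_le.1 h3⟩)).trans (le_max_left _ _)

lemma ell_real {x : ℝ} (hx : 0 < x) : ell (1 + x) = ((Real.log ‖Zc (1 + x)‖ : ℝ) : ℂ) := by
  have hx' : 1 < ((1:ℂ) + x).re := by simpa
  have h1 : ∃ r : ℝ, ell (1 + x) = (r : ℂ) := by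
    refine ⟨(∑' p : Nat.Primes, -Real.log (1 - (p:ℝ) ^ (-(1 + x)))) + Real.log x, ?_⟩
    rw [ell, Complex.ofReal_add, Complex.ofReal_tsum, Lz]
    congr 1
    · apply tsum_congr
      intro p
      have hp : (0:ℝ) ≤ (p:ℝ) := by positivity
      have e : yp p (1 + x) = (((p:ℝ) ^ (-(1 + x)) : ℝ) : ℂ) := by
        rw [Complex.ofReal_cpow hp]; simp [yp]
      have h1 := yp_norm_le' p (s := (1 + x : ℂ)) (by simp; linarith)
      rw [yp_norm] at h1
      simp only [Complex.add_re, Complex.one_re, Complex.ofReal_re] at h1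
      rw [e, ← Complex.ofReal_one, ← Complex.ofReal_sub, ← Complex.ofReal_log (by linarith),
        Complex.ofReal_neg]
    · rw [add_sub_cancel_left, Complex.ofReal_log hx.le]
  obtain ⟨r, hr⟩ := h1
  have h2 := ell_exp hx'
  rw [hr] at h2 ⊢
  rw [← h2, Complex.norm_exp, Real.log_exp, Complex.ofReal_re]

lemma ell_bound : ∃ C > 0, ∀ s : ℂ, 1 < s.re → s.re ≤ 2 → |s.im| ≤ 1 →
    ‖deriv ell s‖ ≤ C ∧ ‖ell s‖ ≤ C * ‖s - 1‖ := by
  obtain ⟨C, hC, hb⟩ := ell_deriv_bound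
  refine ⟨C, hC, fun s h1 h2 h3 => ⟨hb s h1 h2 h3, ?_⟩⟩
  have hlim : Tendsto (fun x : ℝ => ell (1 + x)) (nhdsWithin 0 (Ioi 0)) (nhds 0) := by
    have h0 : Tendsto (fun x : ℝ => ((Real.log ‖Zc (1 + x)‖ : ℝ) : ℂ)) (nhdsWithin 0 (Ioi 0))
        (nhds ((Real.log ‖Zc (1 + (0:ℝ))‖ : ℝ) : ℂ)) := by
      refine Tendsto.mono_left ?_ nhdsWithin_le_nhds
      have hz : ContinuousAt Zc (1 + (0:ℝ)) := (Zc_diffAt (by simp)).continuousAt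
      have hz2 : ContinuousAt (fun x : ℝ => Zc (1 + x)) 0 :=
        ContinuousAt.comp (g := Zc) (f := fun x : ℝ => (1 + x : ℂ)) hz (by fun_prop)
      have hz3 : ContinuousAt (fun x : ℝ => Real.log ‖Zc (1 + x)‖) 0 := by
        apply hz2.norm.log
        simp [Zc_one]
      exact (Complex.continuous_ofReal.continuousAt.comp hz3).tendsto
    simp only [Complex.ofReal_zero, add_zero, Zc_one, norm_one, Real.log_one] at h0
    refine h0.congr' ?_
    filter_upwards [self_mem_nhdsWithin] with x hx
    rw [ell_real hx]
  have hlim2 : Tendsto (fun x : ℝ => ‖ell s - ell (1 + x)‖) (nhdsWithin 0 (Ioi 0))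
      (nhds ‖ell s - 0‖) := (tendsto_const_nhds.sub hlim).norm
  have hlim3 : Tendsto (fun x : ℝ => C * ‖s - (1 + x)‖) (nhdsWithin 0 (Ioi 0))
      (nhds (C * ‖s - 1‖)) := by
    refine Tendsto.mono_left ?_ nhdsWithin_le_nhds
    have : Continuous (fun x : ℝ => C * ‖s - (1 + x)‖) := by fun_prop
    have h := this.tendsto 0
    simpa using h
  rw [sub_zero] at hlim2
  refine le_of_tendsto_of_tendsto hlim2 hlim3 ?_
  have hlt : ∀ᶠ x : ℝ in nhdsWithin 0 (Ioi 0), x < 1 :=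
    nhdsWithin_le_nhds (Iio_mem_nhds (by norm_num))
  filter_upwards [self_mem_nhdsWithin, hlt] with x hx hx1
  have hx0 : 0 < x := hx
  set S : Set ℂ := {z : ℂ | 1 < z.re} ∩ {z | z.re ≤ 2} ∩ ({z | -1 ≤ z.im} ∩ {z | z.im ≤ 1})
  have hconv : Convex ℝ S := ((convex_halfSpace_re_gt 1).inter (convex_halfSpace_re_le 2)).inter
    ((convex_halfSpace_im_ge _).inter (convex_halfSpace_im_le _))
  have hs2 : (1 + x : ℂ) ∈ S := by
    refine ⟨⟨?_, ?_⟩, ?_, ?_⟩ <;> simp <;> linarith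
  have hs1 : s ∈ S := ⟨⟨h1, h2⟩, (abs_le.1 h3).1, (abs_le.1 h3).2⟩
  exact Convex.norm_image_sub_le_of_norm_deriv_le (𝕜 := ℂ) (f := ell) (C := C) (s := S)
    (fun y hy => ell_diffAt hy.1.1) (fun y hy => hb y hy.1.1 hy.1.2 (abs_le.2 ⟨hy.2.1, hy.2.2⟩))
    hconv hs2 hs1

end EK

namespace EK
open MeasureTheory Set Filter Asymptotics

def fz (z : ℂ) (n : ℕ) : ℂ := z ^ smallOmega n

def Fz (z : ℂ) (s : ℂ) : ℂ := LSeries (fz z) s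

lemma fz_norm {z : ℂ} (hz : ‖z‖ = 1) (n : ℕ) : ‖fz z n‖ = 1 := by
  rw [fz, norm_pow, hz, one_pow]

lemma fz_summable {z : ℂ} (hz : ‖z‖ = 1) {s : ℂ} (hs : 1 < s.re) : LSeriesSummable (fz z) s :=
  LSeriesSummable_of_bounded_of_one_lt_re (m := 1) (fun n _ => (fz_norm hz n).le) hs

lemma smallOmega_mul {m n : ℕ} (h : m.Coprime n) :
    smallOmega (m * n) = smallOmega m + smallOmega n := by
  unfold smallOmega
  rw [h.primeFactors_mul, Finset.card_union_of_disjoint h.disjoint_primeFactors]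

lemma fz_term_mul (z s : ℂ) {m n : ℕ} (h : m.Coprime n) :
    LSeries.term (fz z) s (m * n) = LSeries.term (fz z) s m * LSeries.term (fz z) s n := by
  rcases eq_or_ne m 0 with rfl | hm
  · simp
  rcases eq_or_ne n 0 with rfl | hn
  · simp
  rw [LSeries.term_of_ne_zero (mul_ne_zero hm hn), LSeries.term_of_ne_zero hm,
    LSeries.term_of_ne_zero hn, fz, smallOmega_mul h, fz, fz, pow_add, Nat.cast_mul,
    Complex.natCast_mul_natCast_cpow]
  field_simp

lemma fz_term_pow (z s : ℂ) (p : Nat.Primes) (e : ℕ) :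
    LSeries.term (fz z) s ((p:ℕ) ^ e) = z * (yp p s) ^ e + if e = 0 then 1 - z else 0 := by
  rcases eq_or_ne e 0 with rfl | he
  · simp [LSeries.term_def, fz, smallOmega]
  · rw [LSeries.term_of_ne_zero (pow_ne_zero _ p.2.ne_zero), fz, smallOmega,
      Nat.primeFactors_prime_pow he p.2]
    simp only [Finset.card_singleton, pow_one, he, if_false, add_zero, yp]
    rw [div_eq_mul_inv, Nat.cast_pow, Complex.cpow_neg, inv_pow]
    congr 2
    rw [← Complex.natCast_cpow_natCast_mul, mul_comm, Complex.cpow_mul_nat]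

lemma euler_factor (z s : ℂ) (hs : 1 < s.re) (p : Nat.Primes) :
    ∑' e : ℕ, LSeries.term (fz z) s ((p:ℕ) ^ e) =
      Ef (z - 1) (yp p s) * Complex.exp (z * -Complex.log (1 - yp p s)) := by
  have hy : ‖yp p s‖ ≤ 3 / 5 := yp_norm_le' p (by linarith)
  have h1 : HasSum (fun e : ℕ => LSeries.term (fz z) s ((p:ℕ) ^ e))
      (z * (1 - yp p s)⁻¹ + (1 - z)) := by
    simp_rw [fz_term_pow]
    exact ((hasSum_geometric_of_norm_lt_one (by linarith)).mul_left z).add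
      (hasSum_ite_eq 0 (1 - z))
  rw [h1.tsum_eq]
  have hne : 1 - yp p s ≠ 0 := by
    intro h
    have : yp p s = 1 := by linear_combination -h
    rw [this] at hy; norm_num at hy
  unfold Ef
  rw [mul_assoc, ← Complex.exp_add]
  have : (z - 1) * Complex.log (1 - yp p s) + z * -Complex.log (1 - yp p s)
    = -Complex.log (1 - yp p s) := by ring
  rw [this, Complex.exp_neg, Complex.exp_log hne]
  field_simp
  ring

lemma w_norm_le {z : ℂ} (hz : ‖z‖ = 1) : ‖z - 1‖ ≤ 3 := by
  have := norm_sub_le z 1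
  rw [hz, norm_one] at this
  linarith

lemma Fz_eq {z : ℂ} (hz : ‖z‖ = 1) {s : ℂ} (hs : 1 < s.re) :
    Fz z s = Complex.exp (z * Lz s) * Gw (z - 1) s := by
  have h1 : HasProd (fun p : Nat.Primes => ∑' e : ℕ, LSeries.term (fz z) s ((p:ℕ) ^ e)) (Fz z s) := by
    apply EulerProduct.eulerProduct_hasProd
    · simp [LSeries.term_def, fz, smallOmega]
    · intro m n h; exact fz_term_mul z s h
    · exact (fz_summable hz hs).norm
    · simp
  simp_rw [euler_factor z s hs] at h1
  have h2 : HasProd (fun p : Nat.Primes => Complex.exp (z * -Complex.log (1 - yp p s)))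
      (Complex.exp (z * Lz s)) := ((Lz_summable hs).hasSum.mul_left z).cexp
  have h3 : HasProd (fun p : Nat.Primes => Ef (z - 1) (yp p s)) (Gw (z - 1) s) :=
    (((Gw_facts (w_norm_le hz)).2 s (by show 3 / 4 < s.re; linarith)).1).hasProd
  rw [mul_comm]
  exact h1.unique (h3.mul h2)

lemma Gw_diffAt {z : ℂ} (hz : ‖z‖ = 1) {s : ℂ} (hs : 1 < s.re) : DifferentiableAt ℂ (Gw (z - 1)) s := by
  have h : 3 / 4 < s.re := by linarith
  exact ((Gw_facts (w_norm_le hz)).1 s h).differentiableAt ((isOpen_re (3/4)).mem_nhds h)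

lemma Fz_deriv {z : ℂ} (hz : ‖z‖ = 1) {s : ℂ} (hs : 1 < s.re) :
    deriv (Fz z) s = z * deriv Lz s * (Complex.exp (z * Lz s) * Gw (z - 1) s) +
      Complex.exp (z * Lz s) * deriv (Gw (z - 1)) s := by
  have h1 : HasDerivAt (fun s => Complex.exp (z * Lz s) * Gw (z - 1) s)
      (Complex.exp (z * Lz s) * (z * deriv Lz s) * Gw (z - 1) s
        + Complex.exp (z * Lz s) * deriv (Gw (z - 1)) s) s :=
    (((Lz_diffAt hs).hasDerivAt.const_mul z).cexp).mul (Gw_diffAt hz hs).hasDerivAt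
  have h2 : Fz z =ᶠ[nhds s] (fun s => Complex.exp (z * Lz s) * Gw (z - 1) s) := by
    filter_upwards [(isOpen_re 1).mem_nhds hs] with z' hz'
    exact Fz_eq hz hz'
  rw [(h1.congr_of_eventuallyEq h2).deriv]
  ring

lemma Fz_deriv_eq {z : ℂ} (hz : ‖z‖ = 1) {s : ℂ} (hs : 1 < s.re) :
    deriv (Fz z) s = -LSeries (LSeries.logMul (fz z)) s := by
  apply LSeries_deriv
  refine lt_of_le_of_lt (LSeries.abscissaOfAbsConv_le_of_le_const ⟨1, fun n _ => (fz_norm hz n).le⟩) ?_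
  exact_mod_cast hs

lemma BG_pos : 0 < BG := by unfold BG; positivity

def M2 : ℝ := M0 * M1 * BG + M1 * (8 * BG)

lemma M2_pos : 0 < M2 := by
  have := M0_pos; have := M1_pos; have := BG_pos
  unfold M2; positivity

lemma Gw_bound {z : ℂ} (hz : ‖z‖ = 1) {s : ℂ} (hs : 1 ≤ s.re) : ‖Gw (z - 1) s‖ ≤ BG :=
  ((Gw_facts (w_norm_le hz)).2 s (by show 3 / 4 < s.re; linarith)).2

lemma Fz_deriv_bound {z : ℂ} (hz : ‖z‖ = 1) {s : ℂ} (h1 : 1 < s.re) (h2 : s.re ≤ 2)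
    (ht : 1 ≤ |s.im|) : ‖deriv (Fz z) s‖ ≤ M2 * |s.im| ^ 15 := by
  have h0 := M0_pos; have h0' := M1_pos; have h0'' := BG_pos
  have hE : ‖Complex.exp (z * Lz s)‖ ≤ M1 * |s.im| ^ 10 := by
    refine (Complex.norm_exp_le_exp_norm _).trans ?_
    rw [norm_mul, hz, one_mul]
    exact exp_Lz_bound h1 h2 ht
  have hL := Lz_deriv_bound h1 h2 ht
  have hG := Gw_bound hz h1.le
  have hG' := Gw_deriv_bound (w_norm_le hz) h1.le
  rw [Fz_deriv hz h1]
  have a1 : ‖z * deriv Lz s * (Complex.exp (z * Lz s) * Gw (z - 1) s)‖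
      ≤ (M0 * |s.im| ^ 5) * ((M1 * |s.im| ^ 10) * BG) := by
    rw [norm_mul, norm_mul, norm_mul, hz, one_mul]
    gcongr
  have a2 : ‖Complex.exp (z * Lz s) * deriv (Gw (z - 1)) s‖ ≤ (M1 * |s.im| ^ 10) * (8 * BG) := by
    rw [norm_mul]; gcongr
  have a3 : |s.im| ^ 10 ≤ |s.im| ^ 15 := pow_le_pow_right₀ ht (by norm_num)
  refine (norm_add_le _ _).trans ?_
  calc _ ≤ (M0 * |s.im| ^ 5) * ((M1 * |s.im| ^ 10) * BG) + (M1 * |s.im| ^ 10) * (8 * BG) := add_le_add a1 a2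
    _ ≤ (M0 * |s.im| ^ 5) * ((M1 * |s.im| ^ 10) * BG) + (M1 * |s.im| ^ 15) * (8 * BG) := by gcongr
    _ = _ := by unfold M2; ring

lemma norm_sub_one_le {s : ℂ} (h1 : 1 < s.re) (h2 : s.re ≤ 2) (ht : |s.im| ≤ 1) : ‖s - 1‖ ≤ 2 := by
  have := Complex.norm_le_abs_re_add_abs_im (s - 1)
  simp only [Complex.sub_re, Complex.one_re, Complex.sub_im, Complex.one_im, sub_zero] at this
  rw [abs_of_pos (by linarith)] at this
  linarith

lemma Fz_near : ∃ C > 0, ∀ z : ℂ, ‖z‖ = 1 → ∀ s : ℂ, 1 < s.re → s.re ≤ 2 → |s.im| ≤ 1 →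
    ‖-deriv (Fz z) s / s - z * Gw (z - 1) 1 * (s - 1) ^ (-z - 1)‖ ≤ C * ‖(s - 1) ^ (-z)‖ := by
  obtain ⟨C, hC, hb⟩ := ell_bound
  have hB := BG_pos
  refine ⟨C * Real.exp (C * 2) * BG + 8 * BG + BG + (C * Real.exp (C * 2) * BG + Real.exp (C * 2) * (8 * BG)),
    by positivity, fun z hz s h1 h2 h3 => ?_⟩
  obtain ⟨hb1, hb2⟩ := hb s h1 h2 h3
  have hw := Complex.slitPlane_ne_zero (sub_one_slit h1)
  have hwn := norm_sub_one_le h1 h2 h3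
  have hs0 : s ≠ 0 := by rintro rfl; simp at h1; linarith
  have hs1 : 1 ≤ ‖s‖ := by
    have := Complex.re_le_norm s; linarith
  have hG := Gw_bound hz h1.le
  have hG1 := Gw_bound hz (s := 1) (by simp)
  have hG' := Gw_deriv_bound (w_norm_le hz) h1.le
  have hGl := Gw_lip (w_norm_le hz) h1.le
  set E := Complex.exp (z * ell s) with hE
  set P := (s - 1) ^ (-z) with hP
  set G := Gw (z - 1) s
  set G1 := Gw (z - 1) 1
  set G' := deriv (Gw (z - 1)) s
  have hP' : P = Complex.exp (-z * Complex.log (s - 1)) := by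
    rw [hP, Complex.cpow_def_of_ne_zero hw, mul_comm]
  have hLz : Complex.exp (z * Lz s) = E * P := by
    rw [hP', hE, ← Complex.exp_add]; congr 1; unfold ell; ring
  have hL' : deriv Lz s = deriv ell s - 1 / (s - 1) := by
    have : HasDerivAt ell (deriv Lz s + 1 / (s - 1)) s := by
      have h := ((hasDerivAt_id s).sub_const 1).clog (sub_one_slit h1)
      exact (Lz_diffAt h1).hasDerivAt.add h
    rw [this.deriv]; ring
  have hP1 : (s - 1) ^ (-z - 1) = P / (s - 1) := by
    rw [Complex.cpow_sub _ _ hw, Complex.cpow_one]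
  have hEn : ‖E‖ ≤ Real.exp (C * 2) := by
    refine (Complex.norm_exp_le_exp_norm _).trans ?_
    rw [norm_mul, hz, one_mul]
    gcongr
    exact hb2.trans (by gcongr)
  have hE1 : ‖E - 1‖ ≤ C * ‖s - 1‖ * Real.exp (C * 2) := by
    have := Complex.norm_exp_sub_sum_le_norm_mul_exp (z * ell s) 1
    simp only [Finset.range_one, Finset.sum_singleton, pow_zero, Nat.factorial_zero, Nat.cast_one,
      div_one, pow_one, norm_mul, hz, one_mul] at this
    refine this.trans ?_
    gcongr
    exact hb2.trans (by gcongr)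
  have key : -deriv (Fz z) s / s - z * G1 * (s - 1) ^ (-z - 1) =
      P * (z / (s - 1) * ((E - 1) * G / s + (G - G1) / s - G1 * (s - 1) / s)
        - (z * deriv ell s * E * G + E * G') / s) := by
    rw [Fz_deriv hz h1, hLz, hL', hP1]
    field_simp
    ring
  rw [key, norm_mul, mul_comm]
  gcongr
  refine (norm_sub_le _ _).trans ?_
  have hdiv : ∀ x : ℂ, ‖x / s‖ ≤ ‖x‖ := fun x => by
    rw [norm_div]; exact div_le_self (norm_nonneg _) hs1
  have hwp : 0 < ‖s - 1‖ := norm_pos_iff.2 hw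
  apply add_le_add
  · rw [norm_mul, norm_div, hz, one_div, inv_mul_le_iff₀ hwp]
    have b1 : ‖(E - 1) * G / s‖ ≤ C * ‖s - 1‖ * Real.exp (C * 2) * BG :=
      (hdiv _).trans (by rw [norm_mul]; gcongr)
    have b2 : ‖(G - G1) / s‖ ≤ 8 * BG * ‖s - 1‖ := (hdiv _).trans hGl
    have b3 : ‖G1 * (s - 1) / s‖ ≤ BG * ‖s - 1‖ := (hdiv _).trans (by rw [norm_mul]; gcongr)
    refine (norm_sub_le _ _).trans ?_
    have := norm_add_le ((E - 1) * G / s) ((G - G1) / s)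
    linarith
  · refine (hdiv _).trans ((norm_add_le _ _).trans ?_)
    apply add_le_add
    · rw [norm_mul, norm_mul, norm_mul, hz, one_mul]; gcongr
    · rw [norm_mul]; gcongr

/-- bound of a complex power in the right half plane -/
lemma cpow_norm_bound {s w : ℂ} (hw : |w.im| ≤ 1) :
    ‖s ^ w‖ ≤ Real.exp π * ‖s‖ ^ w.re := by
  refine (Complex.norm_cpow_le s w).trans ?_
  rw [div_eq_mul_inv, ← Real.exp_neg, mul_comm]
  gcongr
  have h1 := Complex.abs_arg_le_pi s
  have : |s.arg * w.im| ≤ π * 1 := by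
    rw [abs_mul]; gcongr
  have := (abs_le.1 this).1
  linarith

/-- the main constant -/
def cz (z : ℂ) : ℂ := if 0 ≤ z.re then Phi1 (z - 1) else 0

lemma cz_Gamma {z : ℂ} (hz : ‖z‖ = 1) (h : 0 ≤ z.re) :
    cz z * Complex.Gamma (z + 1) = z * Gw (z - 1) 1 := by
  have hz0 : z ≠ 0 := by rintro rfl; simp at hz
  have hg : Complex.Gamma z ≠ 0 := by
    apply Complex.Gamma_ne_zero
    intro m hm
    have hre : z.re = -(m:ℝ) := by rw [hm]; simp
    have : (m:ℝ) = 0 := le_antisymm (by linarith) (by positivity)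
    rw [hm] at hz
    simp [this] at hz
  rw [cz, if_pos h, Phi1_eq, Complex.Gamma_add_one _ hz0]
  have : 1 + (z - 1) = z := by ring
  rw [this]
  field_simp

lemma cz_bound : ∃ C > 0, ∀ z : ℂ, ‖z‖ = 1 → ‖cz z‖ ≤ C := by
  obtain ⟨C, hC, h⟩ := Phi1_bound
  refine ⟨C, hC, fun z hz => ?_⟩
  unfold cz
  split_ifs
  · refine (h _ ?_).1
    have := norm_sub_le z 1
    rw [hz, norm_one] at this
    linarith
  · simp [hC.le]

lemma rpow_aux {x a : ℝ} (hx : 0 < x) (hx2 : x ≤ 2) (ha : -1 ≤ a) (ha1 : a ≤ 0) :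
    x ^ a ≤ 2 / x := by
  have h1 : x ^ a = x ^ (a + 1) / x := by
    rw [Real.rpow_add_one hx.ne']; field_simp
  rw [h1]
  gcongr
  calc x ^ (a + 1) ≤ 2 ^ (a + 1) := by gcongr; linarith
    _ ≤ 2 ^ (1:ℝ) := by gcongr; norm_num; linarith
    _ = 2 := by norm_num

lemma z_im_le {z : ℂ} (hz : ‖z‖ = 1) : |z.im| ≤ 1 := hz ▸ Complex.abs_im_le_norm z
lemma z_re_le {z : ℂ} (hz : ‖z‖ = 1) : |z.re| ≤ 1 := hz ▸ Complex.abs_re_le_norm z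

lemma L_near : ∃ C > 0, ∀ z : ℂ, ‖z‖ = 1 → ∀ s : ℂ, 1 < s.re → s.re ≤ 2 → |s.im| ≤ 1 →
    ‖-deriv (Fz z) s / s - cz z * Complex.Gamma (z + 1) * (s - 1) ^ (-z - 1)‖ ≤ C / ‖s - 1‖ := by
  obtain ⟨C, hC, hb⟩ := Fz_near
  have hB := BG_pos
  refine ⟨(4 * C + 2 * BG) * Real.exp π, by positivity, fun z hz s h1 h2 h3 => ?_⟩
  have hw := Complex.slitPlane_ne_zero (sub_one_slit h1)
  have hwp : 0 < ‖s - 1‖ := norm_pos_iff.2 hw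
  have hwn := norm_sub_one_le h1 h2 h3
  have hzi := z_im_le hz
  have hzr := abs_le.1 (z_re_le hz)
  have hm := hb z hz s h1 h2 h3
  have hp := cpow_norm_bound (s := s - 1) (w := -z) (by simpa using hzi)
  rw [Complex.neg_re] at hp
  have he := Real.exp_pos π
  by_cases h : 0 ≤ z.re
  · rw [cz_Gamma hz h]
    refine hm.trans ?_
    have := rpow_aux hwp hwn (a := -z.re) (by linarith) (by linarith)
    calc C * ‖(s - 1) ^ (-z)‖ ≤ C * (Real.exp π * (2 / ‖s - 1‖)) := by
          gcongr; exact hp.trans (by gcongr)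
      _ = 2 * C * Real.exp π / ‖s - 1‖ := by ring
      _ ≤ _ := by gcongr; linarith
  · push Not at h
    rw [cz, if_neg (by linarith), zero_mul, zero_mul, sub_zero]
    have hp2 := cpow_norm_bound (s := s - 1) (w := -z - 1) (by simpa using hzi)
    have e2 := rpow_aux hwp hwn (a := -z.re - 1) (by linarith) (by linarith)
    have e1 : ‖s - 1‖ ^ (-z.re) ≤ 4 / ‖s - 1‖ := by
      have : ‖s - 1‖ ^ (-z.re) = ‖s - 1‖ ^ (-z.re - 1) * ‖s - 1‖ := by
        rw [← Real.rpow_add_one hwp.ne']; congr 1; ring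
      rw [this]
      calc _ ≤ 2 / ‖s - 1‖ * 2 := by gcongr
        _ = _ := by ring
    have hG1 := Gw_bound hz (s := 1) (by simp)
    have t : ‖z * Gw (z - 1) 1 * (s - 1) ^ (-z - 1)‖ ≤ BG * (Real.exp π * (2 / ‖s - 1‖)) := by
      rw [norm_mul, norm_mul, hz, one_mul]
      gcongr
      refine hp2.trans ?_
      simp only [Complex.sub_re, Complex.neg_re, Complex.one_re]
      gcongr
    have t2 : C * ‖(s - 1) ^ (-z)‖ ≤ C * (Real.exp π * (4 / ‖s - 1‖)) := by
      gcongr; exact hp.trans (by gcongr)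
    have tri := norm_add_le (-deriv (Fz z) s / s - z * Gw (z - 1) 1 * (s - 1) ^ (-z - 1))
      (z * Gw (z - 1) 1 * (s - 1) ^ (-z - 1))
    rw [sub_add_cancel] at tri
    calc _ ≤ C * (Real.exp π * (4 / ‖s - 1‖)) + BG * (Real.exp π * (2 / ‖s - 1‖)) := by linarith
      _ = _ := by ring

lemma L_far : ∃ C > 0, ∀ z : ℂ, ‖z‖ = 1 → ∀ s : ℂ, 1 < s.re → s.re ≤ 2 → 1 ≤ |s.im| →
    ‖-deriv (Fz z) s / s - cz z * Complex.Gamma (z + 1) * (s - 1) ^ (-z - 1)‖ ≤ C * |s.im| ^ 15 := by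
  have hB := BG_pos
  have hM := M2_pos
  have he := Real.exp_pos π
  refine ⟨M2 + BG * Real.exp π, by positivity, fun z hz s h1 h2 h3 => ?_⟩
  have hwn : 1 ≤ ‖s - 1‖ := h3.trans norm_s_sub_ge
  have hs1 : 1 ≤ ‖s‖ := by
    have := Complex.re_le_norm s; linarith
  have hd := Fz_deriv_bound hz h1 h2 h3
  have ht : 1 ≤ |s.im| ^ 15 := one_le_pow₀ h3
  refine (norm_sub_le _ _).trans ?_
  rw [add_mul]
  apply add_le_add
  · rw [norm_div, norm_neg]
    exact (div_le_self (norm_nonneg _) hs1).trans hd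
  · by_cases h : 0 ≤ z.re
    · rw [cz_Gamma hz h, norm_mul, norm_mul, hz, one_mul]
      have hp2 := cpow_norm_bound (s := s - 1) (w := -z - 1) (by simpa using z_im_le hz)
      have : ‖s - 1‖ ^ (-z - 1).re ≤ 1 := by
        apply Real.rpow_le_one_of_one_le_of_nonpos hwn
        simp; linarith
      have hG1 := Gw_bound hz (s := 1) (by simp)
      calc _ ≤ BG * (Real.exp π * 1) := by
            gcongr; exact hp2.trans (by gcongr)
        _ ≤ BG * Real.exp π * |s.im| ^ 15 := by
            rw [mul_one]; exact le_mul_of_one_le_right (by positivity) ht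
    · rw [cz, if_neg h, zero_mul, zero_mul, norm_zero]; positivity

end EK

namespace EK
open MeasureTheory Set Filter Asymptotics

/-- Laplace transform -/
def Lap (a : ℝ → ℂ) (s : ℂ) : ℂ := ∫ v in Ioi (0:ℝ), a v * Complex.exp (-s * v)

lemma smooth_eq {a : ℝ → ℂ} {σ u b : ℝ} (hb : 0 < b)
    (hIntg : IntegrableOn (fun v => a v * Complex.exp (-σ * v)) (Ioi 0)) :
    ((π:ℂ) / b) ^ (1 / 2 : ℂ) * ∫ v in Ioi (0:ℝ), a v * Complex.exp (-σ * v) *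
        Complex.exp (-(u - v) ^ 2 / (4 * b)) =
    ∫ t : ℝ, Complex.exp (Complex.I * u * t) * Complex.exp (-b * t ^ 2) *
      Lap a (σ + t * Complex.I) := by
  have hb' : 0 < (b:ℂ).re := by simpa
  have hg : Integrable (fun t : ℝ => Complex.exp (-(b:ℂ) * t ^ 2)) :=
    integrable_cexp_neg_mul_sq hb'
  have h1 : ∀ v : ℝ, ((π:ℂ) / b) ^ (1 / 2 : ℂ) * (a v * Complex.exp (-σ * v) *
        Complex.exp (-(u - v) ^ 2 / (4 * b))) = ∫ t : ℝ, Complex.exp (Complex.I * (u - v) * t) *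
          ((a v * Complex.exp (-σ * v)) * Complex.exp (-b * t ^ 2)) := by
    intro v
    have := fourierIntegral_gaussian hb' ((u:ℂ) - v)
    have h2 : ∀ t : ℝ, Complex.exp (Complex.I * (u - v) * t) *
          ((a v * Complex.exp (-σ * v)) * Complex.exp (-b * t ^ 2)) = (a v * Complex.exp (-σ * v)) *
          (Complex.exp (Complex.I * (u - v) * t) * Complex.exp (-b * t ^ 2)) := fun t => by ring
    simp_rw [h2]
    rw [integral_const_mul, this]
    ring
  rw [← integral_const_mul]
  simp_rw [h1]
  rw [integral_integral_swap]
  · congr 1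
    ext t
    unfold Lap
    rw [← integral_const_mul]
    congr 1
    ext v
    have : Complex.exp (-(σ + t * Complex.I) * v) =
      Complex.exp (-σ * v) * Complex.exp (-t * Complex.I * v) := by
      rw [← Complex.exp_add]; congr 1; ring
    rw [this]
    have : Complex.exp (Complex.I * (u - v) * t) =
      Complex.exp (Complex.I * u * t) * Complex.exp (-t * Complex.I * v) := by
      rw [← Complex.exp_add]; congr 1; ring
    rw [this]
    ring
  · refine Integrable.bdd_mul (c := 1) (hIntg.mul_prod hg) ?_ ?_
    · apply Continuous.aestronglyMeasurable
      fun_prop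
    · refine Filter.Eventually.of_forall fun x => ?_
      rw [Complex.norm_exp]
      simp

lemma smooth_bound {a : ℝ → ℂ} {σ u h D : ℝ} (hh : 0 < h)
    (hIntg : IntegrableOn (fun v => a v * Complex.exp (-σ * v)) (Ioi 0))
    (hD : ∫ t : ℝ, Real.exp (-(h ^ 2 / 2) * t ^ 2) * ‖Lap a (σ + t * Complex.I)‖ ≤ D) :
    ‖∫ v in Ioi (0:ℝ), a v * Complex.exp (-σ * v) * Complex.exp (-(u - v) ^ 2 / (2 * h ^ 2))‖
      ≤ h * D := by
  have hb : 0 < h ^ 2 / 2 := by positivity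
  have h1 := smooth_eq (u := u) hb hIntg
  have h2 := norm_integral_le_integral_norm (μ := volume) (fun t : ℝ => Complex.exp (Complex.I * u * t) *
    Complex.exp (-((h ^ 2 / 2 : ℝ):ℂ) * t ^ 2) * Lap a (σ + t * Complex.I))
  rw [← h1] at h2
  have h3 : ∀ t : ℝ, ‖Complex.exp (Complex.I * u * t) *
    Complex.exp (-((h ^ 2 / 2 : ℝ):ℂ) * t ^ 2) * Lap a (σ + t * Complex.I)‖ =
      Real.exp (-(h ^ 2 / 2) * t ^ 2) * ‖Lap a (σ + t * Complex.I)‖ := by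
    intro t
    rw [norm_mul, norm_mul, Complex.norm_exp, Complex.norm_exp]
    have e1 : (Complex.I * u * t).re = 0 := by simp
    have e2 : (-((h ^ 2 / 2 : ℝ):ℂ) * t ^ 2).re = -(h ^ 2 / 2) * t ^ 2 := by
      rw [← Complex.ofReal_neg, ← Complex.ofReal_pow, ← Complex.ofReal_mul, Complex.ofReal_re]
    rw [e1, e2]; simp
  simp_rw [h3] at h2
  rw [norm_mul] at h2
  have h4 : ‖((π:ℂ) / ((h ^ 2 / 2 : ℝ):ℂ)) ^ (1 / 2 : ℂ)‖ = Real.sqrt (2 * π) / h := by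
    rw [← Complex.ofReal_div, Complex.norm_cpow_eq_rpow_re_of_pos (by positivity)]
    have : (1 / 2 : ℂ).re = 1 / 2 := by norm_num
    rw [this, ← Real.sqrt_eq_rpow]
    have : π / (h ^ 2 / 2) = 2 * π / h ^ 2 := by field_simp
    rw [this, Real.sqrt_div (by positivity), Real.sqrt_sq hh.le]
  rw [h4] at h2
  have e4 : ∀ v : ℝ, Complex.exp (-(u - v) ^ 2 / (4 * ((h ^ 2 / 2 : ℝ):ℂ))) =
    Complex.exp (-(u - v) ^ 2 / (2 * h ^ 2)) := by
    intro v; congr 2; push_cast; ring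
  simp_rw [e4] at h2
  have h5 : 1 ≤ Real.sqrt (2 * π) := by
    rw [Real.one_le_sqrt]; linarith [Real.pi_gt_three]
  set X := ‖∫ v in Ioi (0:ℝ), a v * Complex.exp (-σ * v) * Complex.exp (-(u - v) ^ 2 / (2 * h ^ 2))‖
  have hX : 0 ≤ X := norm_nonneg _
  have h6 : 1 / h * X ≤ D := by
    refine le_trans ?_ (h2.trans hD)
    gcongr
  rw [one_div, inv_mul_le_iff₀ hh] at h6
  exact h6

def KT : ℝ := 4 ^ 8 * (Nat.factorial 8)

lemma pow16 {h : ℝ} (hh : 0 < h) (t : ℝ) :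
    t ^ 16 * Real.exp (-(h ^ 2 / 2) * t ^ 2) ≤ KT * (h ^ 16)⁻¹ * Real.exp (-(h ^ 2 / 4) * t ^ 2) := by
  have h1 := Real.pow_div_factorial_le_exp (h ^ 2 / 4 * t ^ 2) (by positivity) 8
  have h2 : Real.exp (-(h ^ 2 / 2) * t ^ 2) =
      Real.exp (-(h ^ 2 / 4) * t ^ 2) * Real.exp (-(h ^ 2 / 4 * t ^ 2)) := by
    rw [← Real.exp_add]; congr 1; ring
  have h3 : t ^ 16 = KT * (h ^ 16)⁻¹ * ((h ^ 2 / 4 * t ^ 2) ^ 8 / (Nat.factorial 8 : ℝ)) := by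
    unfold KT; have : (Nat.factorial 8 : ℝ) ≠ 0 := by positivity
    field_simp
  have h0 : 0 ≤ KT := by unfold KT; positivity
  calc t ^ 16 * Real.exp (-(h ^ 2 / 2) * t ^ 2)
      ≤ KT * (h ^ 16)⁻¹ * Real.exp (h ^ 2 / 4 * t ^ 2) * Real.exp (-(h ^ 2 / 2) * t ^ 2) := by
        gcongr
        rw [h3]
        gcongr
    _ = _ := by
      rw [h2, Real.exp_neg]
      field_simp

lemma D_bound {a : ℝ → ℂ} {B : ℝ} (hB : 0 < B)
    (hn : ∀ s : ℂ, 0 < s.re → s.re ≤ 1 → |s.im| ≤ 1 → ‖Lap a s‖ ≤ B / ‖s‖)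
    (hf : ∀ s : ℂ, 0 < s.re → s.re ≤ 1 → 1 ≤ |s.im| → ‖Lap a s‖ ≤ B * |s.im| ^ 15)
    {u h : ℝ} (hu : 1 ≤ u) (hh : 0 < h) :
    ∫ t : ℝ, Real.exp (-(h ^ 2 / 2) * t ^ 2) * ‖Lap a ((1 / u : ℝ) + t * Complex.I)‖ ≤
      B * (2 * π * Real.sqrt u) + B * KT * (h ^ 16)⁻¹ * (4 / h) := by
  have hu0 : 0 < u := by linarith
  have hKT : 0 ≤ KT := by unfold KT; positivity
  set q := Real.sqrt u with hq
  have hq0 : 0 < q := Real.sqrt_pos.2 hu0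
  have hqq : q ^ 2 = u := Real.sq_sqrt hu0.le
  set g1 : ℝ → ℝ := fun t => B / 2 * (q ^ 3 * (1 + (u * t) ^ 2)⁻¹ + 2 * q * (1 + t ^ 2)⁻¹) with hg1
  set g2 : ℝ → ℝ := fun t => B * KT * (h ^ 16)⁻¹ * Real.exp (-(h ^ 2 / 4) * t ^ 2) with hg2
  have hb4 : 0 < h ^ 2 / 4 := by positivity
  have i1 : Integrable (fun t : ℝ => (1 + (u * t) ^ 2)⁻¹) :=
    integrable_inv_one_add_sq.comp_mul_left' hu0.ne'
  have ig1 : Integrable g1 := ((i1.const_mul _).add (integrable_inv_one_add_sq.const_mul _)).const_mul _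
  have ig2 : Integrable g2 := (integrable_exp_neg_mul_sq hb4).const_mul _
  have hI : ∫ t, (g1 t + g2 t) = B / 2 * (q ^ 3 * (u⁻¹ * π) + 2 * q * π) +
      B * KT * (h ^ 16)⁻¹ * Real.sqrt (π / (h ^ 2 / 4)) := by
    rw [integral_add ig1 ig2, hg1, hg2, integral_const_mul, integral_const_mul, integral_gaussian,
      integral_add (i1.const_mul _) (integrable_inv_one_add_sq.const_mul _), integral_const_mul,
      integral_const_mul, integral_univ_inv_one_add_sq]
    have := Measure.integral_comp_mul_left (fun x : ℝ => (1 + x ^ 2)⁻¹) u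
    rw [this, integral_univ_inv_one_add_sq, abs_of_pos (by positivity), smul_eq_mul]
  refine le_trans (b := ∫ t, (g1 t + g2 t)) ?_ ?_
  · apply integral_mono_of_nonneg
    · exact Filter.Eventually.of_forall fun t => by positivity
    · exact ig1.add ig2
    · refine Filter.Eventually.of_forall fun t => ?_
      set s : ℂ := ((1 / u : ℝ) : ℂ) + t * Complex.I with hs
      have hre : s.re = 1 / u := by rw [hs]; simp
      have him : s.im = t := by rw [hs]; simp
      have hre0 : 0 < s.re := by rw [hre]; positivity
      have hre1 : s.re ≤ 1 := by rw [hre, div_le_one hu0]; exact hu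
      have hg1p : 0 ≤ g1 t := by rw [hg1]; positivity
      have hg2p : 0 ≤ g2 t := by rw [hg2]; positivity
      rcases le_total |t| 1 with ht | ht
      · have h1 := hn s hre0 hre1 (by rw [him]; exact ht)
        have h2 : Real.exp (-(h ^ 2 / 2) * t ^ 2) ≤ 1 := by
          rw [Real.exp_le_one_iff]; have := mul_nonneg hb4.le (sq_nonneg t); linarith
        have h3 : Real.exp (-(h ^ 2 / 2) * t ^ 2) * ‖Lap a s‖ ≤ B / ‖s‖ := by
          calc _ ≤ 1 * (B / ‖s‖) := by gcongr
            _ = _ := one_mul _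
        have hs0 : 0 < ‖s‖ := by
          rw [norm_pos_iff]; intro h0; rw [h0] at hre0; simp at hre0
        have hsn : ‖s‖ ^ 2 = (1 + (u * t) ^ 2) / u ^ 2 := by
          rw [Complex.sq_norm, Complex.normSq_apply, hre, him]; field_simp
        have h4 : 1 / ‖s‖ ≤ 1 / 2 * (q ^ 3 * (1 + (u * t) ^ 2)⁻¹ + q) := by
          have e : (1 + (u * t) ^ 2)⁻¹ = (q ^ 4)⁻¹ * (1 / ‖s‖) ^ 2 := by
            have : q ^ 4 = u ^ 2 := by rw [← hqq]; ring
            rw [one_div, inv_pow, hsn, this]; field_simp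
          rw [e]
          have : q ^ 3 * ((q ^ 4)⁻¹ * (1 / ‖s‖) ^ 2) = (1 / ‖s‖) ^ 2 / q := by field_simp
          rw [this]
          have h5 : (1 / ‖s‖) ^ 2 / q + q - 2 * (1 / ‖s‖) = (1 / ‖s‖ - q) ^ 2 / q := by
            field_simp; ring
          have h6 : 0 ≤ (1 / ‖s‖ - q) ^ 2 / q := by positivity
          linarith
        have h7 : q ≤ 2 * q * (1 + t ^ 2)⁻¹ := by
          rw [mul_comm 2 q, mul_assoc]
          apply le_mul_of_one_le_right hq0.le
          rw [← div_eq_mul_inv, le_div_iff₀ (by positivity)]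
          have : t ^ 2 ≤ 1 := by rw [← sq_abs]; exact pow_le_one₀ (abs_nonneg _) ht
          linarith
        have h8 : B / ‖s‖ ≤ g1 t := by
          rw [hg1]
          calc B / ‖s‖ = B * (1 / ‖s‖) := by ring
            _ ≤ B * (1 / 2 * (q ^ 3 * (1 + (u * t) ^ 2)⁻¹ + 2 * q * (1 + t ^ 2)⁻¹)) := by
              gcongr; linarith
            _ = _ := by ring
        show Real.exp (-(h ^ 2 / 2) * t ^ 2) * ‖Lap a s‖ ≤ g1 t + g2 t
        linarith
      · have h1 := hf s hre0 hre1 (by rw [him]; exact ht)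
        rw [him] at h1
        have h2 : |t| ^ 15 ≤ t ^ 16 := by
          have : t ^ 16 = |t| ^ 16 := by rw [← abs_pow, abs_of_nonneg (by positivity)]
          rw [this]
          exact pow_le_pow_right₀ ht (by norm_num)
        have h3 := pow16 hh t
        have h4 : Real.exp (-(h ^ 2 / 2) * t ^ 2) * ‖Lap a s‖ ≤ g2 t := by
          calc _ ≤ Real.exp (-(h ^ 2 / 2) * t ^ 2) * (B * t ^ 16) := by
                gcongr; exact h1.trans (by gcongr)
            _ = B * (t ^ 16 * Real.exp (-(h ^ 2 / 2) * t ^ 2)) := by ring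
            _ ≤ B * (KT * (h ^ 16)⁻¹ * Real.exp (-(h ^ 2 / 4) * t ^ 2)) := by gcongr
            _ = g2 t := by rw [hg2]; ring
        show Real.exp (-(h ^ 2 / 2) * t ^ 2) * ‖Lap a s‖ ≤ g1 t + g2 t
        linarith
  · rw [hI]
    have e1 : q ^ 3 * (u⁻¹ * π) = q * π := by rw [← hqq]; field_simp
    have e2 : Real.sqrt (π / (h ^ 2 / 4)) ≤ 4 / h := by
      rw [Real.sqrt_le_left (by positivity)]
      have := Real.pi_lt_four
      rw [div_pow, div_div_eq_mul_div]
      gcongr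
      linarith
    rw [e1]
    apply add_le_add
    · have : 0 ≤ B * q * π := by positivity
      linarith
    · gcongr

lemma gauss_shift {u h : ℝ} (hh : 0 < h) :
    Integrable (fun v : ℝ => Real.exp (-(u - v) ^ 2 / (4 * h ^ 2))) ∧
    ∫ v : ℝ, Real.exp (-(u - v) ^ 2 / (4 * h ^ 2)) ≤ 4 * h := by
  have hb : 0 < 1 / (4 * h ^ 2) := by positivity
  have e : ∀ v : ℝ, Real.exp (-(u - v) ^ 2 / (4 * h ^ 2)) =
      Real.exp (-(1 / (4 * h ^ 2)) * (u - v) ^ 2) := fun v => by congr 1; ring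
  simp_rw [e]
  refine ⟨(integrable_exp_neg_mul_sq hb).comp_sub_left u, ?_⟩
  rw [integral_sub_left_eq_self (fun v => Real.exp (-(1 / (4 * h ^ 2)) * v ^ 2)) volume u,
    integral_gaussian, Real.sqrt_le_left (by positivity)]
  have := Real.pi_lt_four
  rw [div_div_eq_mul_div, div_one]
  have : 0 < h ^ 2 := by positivity
  nlinarith

lemma gauss_absorb {x u h : ℝ} (hu : 0 ≤ u) (hh : 0 < h) :
    (u * |x| + x ^ 2 + 1) * Real.exp (-x ^ 2 / (2 * h ^ 2)) ≤
      (2 * u * h + 4 * h ^ 2 + 1) * Real.exp (-x ^ 2 / (4 * h ^ 2)) := by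
  set y := x ^ 2 / (4 * h ^ 2) with hy
  have hy0 : 0 ≤ y := by positivity
  have e1 : Real.exp (-x ^ 2 / (2 * h ^ 2)) = Real.exp (-y) * Real.exp (-y) := by
    rw [← Real.exp_add]; congr 1; rw [hy]; field_simp; ring
  have e2 : Real.exp (-x ^ 2 / (4 * h ^ 2)) = Real.exp (-y) := by
    congr 1; rw [hy]; ring
  have e3 : x ^ 2 = 4 * h ^ 2 * y := by rw [hy]; field_simp
  have h1 := Real.add_one_le_exp y
  have h2 : x ^ 2 ≤ 4 * h ^ 2 * Real.exp y := by rw [e3]; gcongr; linarith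
  have h3 : |x| ≤ 2 * h * Real.exp y := by
    apply abs_le_of_sq_le_sq _ (by positivity)
    calc x ^ 2 ≤ 4 * h ^ 2 * (Real.exp y * 1) := by rw [mul_one]; exact h2
      _ ≤ 4 * h ^ 2 * (Real.exp y * Real.exp y) := by gcongr; linarith
      _ = (2 * h * Real.exp y) ^ 2 := by ring
  have h4 : u * |x| + x ^ 2 + 1 ≤ (2 * u * h + 4 * h ^ 2 + 1) * Real.exp y := by
    have : u * |x| ≤ u * (2 * h * Real.exp y) := by gcongr
    linarith
  rw [e1, e2]
  calc _ ≤ (2 * u * h + 4 * h ^ 2 + 1) * Real.exp y * (Real.exp (-y) * Real.exp (-y)) := by gcongr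
    _ = _ := by
      rw [Real.exp_neg]; field_simp

lemma tauber_core {a : ℝ → ℂ} {B M : ℝ} (hB : 0 < B) (hM : 0 < M)
    (hIntg : ∀ σ : ℝ, 0 < σ → IntegrableOn (fun v => a v * Complex.exp (-σ * v)) (Ioi 0))
    (hlip : ∀ u v : ℝ, 2 ≤ u → 0 < v → ‖a v - a u‖ ≤ M * (u * |v - u| + (v - u) ^ 2 + 1))
    (hn : ∀ s : ℂ, 0 < s.re → s.re ≤ 1 → |s.im| ≤ 1 → ‖Lap a s‖ ≤ B / ‖s‖)
    (hf : ∀ s : ℂ, 0 < s.re → s.re ≤ 1 → 1 ≤ |s.im| → ‖Lap a s‖ ≤ B * |s.im| ^ 15)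
    {u h : ℝ} (hu : 2 ≤ u) (hh : 0 < h) (hh1 : h ≤ 1) :
    ‖a u‖ ≤ Real.exp (5 / 2) * ((B * (2 * π * Real.sqrt u) + B * KT * (h ^ 16)⁻¹ * (4 / h)) +
      M * (2 * u * h + 4 * h ^ 2 + 1) * 4) := by
  have hu0 : 0 < u := by linarith
  set D := B * (2 * π * Real.sqrt u) + B * KT * (h ^ 16)⁻¹ * (4 / h) with hD
  have hs := smooth_bound (u := u) hh (hIntg (1 / u) (by positivity)) (D_bound hB hn hf (by linarith) hh)
  rw [← hD] at hs
  set W : ℝ → ℝ := fun v => Real.exp (-(1 / u) * v) * Real.exp (-(u - v) ^ 2 / (2 * h ^ 2)) with hW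
  have hWc : ∀ v : ℝ, Complex.exp (-((1 / u : ℝ) : ℂ) * v) * Complex.exp (-(u - v) ^ 2 / (2 * h ^ 2))
      = (W v : ℂ) := by
    intro v; rw [hW]; push_cast; rfl
  simp_rw [mul_assoc, hWc] at hs
  obtain ⟨gi, gb⟩ := gauss_shift (u := u) hh
  have hWpos : ∀ v, 0 < W v := fun v => by rw [hW]; positivity
  have hWcont : Continuous W := by rw [hW]; fun_prop
  have hWle : ∀ v, 0 < v → W v ≤ Real.exp (-(u - v) ^ 2 / (2 * h ^ 2)) := by
    intro v hv
    rw [hW]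
    apply mul_le_of_le_one_left (Real.exp_pos _).le
    rw [Real.exp_le_one_iff]
    have : 0 ≤ 1 / u * v := by positivity
    linarith
  have hWle2 : ∀ v, 0 < v → W v ≤ Real.exp (-(u - v) ^ 2 / (4 * h ^ 2)) := by
    intro v hv
    refine (hWle v hv).trans ?_
    rw [Real.exp_le_exp, neg_div, neg_div, neg_le_neg_iff]
    gcongr
    norm_num
  have hWi : IntegrableOn W (Ioi 0) := by
    refine Integrable.mono' gi.integrableOn hWcont.aestronglyMeasurable ?_
    filter_upwards [ae_restrict_mem measurableSet_Ioi] with v hv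
    rw [Real.norm_eq_abs, abs_of_pos (hWpos v)]
    exact hWle2 v hv
  have haW : IntegrableOn (fun v => a v * (W v : ℂ)) (Ioi 0) := by
    have h1 := hIntg (1 / u) (by positivity)
    have h2 : IntegrableOn (fun v : ℝ => (((Real.exp (-(u - v) ^ 2 / (2 * h ^ 2)) : ℝ)) : ℂ) *
        (a v * Complex.exp (-((1 / u : ℝ) : ℂ) * v))) (Ioi 0) := by
      refine Integrable.bdd_mul (c := 1) h1 ?_ ?_
      · apply Continuous.aestronglyMeasurable; fun_prop
      · refine Filter.Eventually.of_forall fun v => ?_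
        rw [Complex.norm_real, Real.norm_eq_abs, Real.abs_exp, Real.exp_le_one_iff, neg_div]
        have : 0 ≤ (u - v) ^ 2 / (2 * h ^ 2) := by positivity
        linarith
    refine h2.congr (Filter.Eventually.of_forall fun v => ?_)
    simp only
    rw [← hWc]; push_cast; ring
  have hWic : IntegrableOn (fun v => (W v : ℂ)) (Ioi 0) := hWi.ofReal
  have hlow : h * Real.exp (-(5 / 2)) ≤ ∫ v in Ioi (0:ℝ), W v := by
    have h1 : ∫ v in Ioc u (u + h), W v ≤ ∫ v in Ioi (0:ℝ), W v := by
      apply setIntegral_mono_set hWi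
      · exact Filter.Eventually.of_forall fun v => (hWpos v).le
      · refine Filter.Eventually.of_forall ?_
        intro v hv
        exact lt_trans hu0 hv.1
    refine le_trans ?_ h1
    have h2 : ∫ v in Ioc u (u + h), Real.exp (-(5 / 2)) ≤ ∫ v in Ioc u (u + h), W v := by
      apply setIntegral_mono_on
      · exact integrableOn_const (by simp) (by simp)
      · exact hWi.mono_set (fun v hv => lt_trans hu0 hv.1)
      · exact measurableSet_Ioc
      · intro v hv
        rw [hW]
        simp only
        rw [← Real.exp_add, Real.exp_le_exp]
        have a1 : 1 / u * v ≤ 2 := by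
          rw [one_div, inv_mul_le_iff₀ hu0]; linarith [hv.2]
        have a2 : (u - v) ^ 2 / (2 * h ^ 2) ≤ 1 / 2 := by
          rw [div_le_iff₀ (by positivity)]
          have : (u - v) ^ 2 ≤ h ^ 2 := by
            apply sq_le_sq'
            · linarith [hv.2]
            · linarith [hv.1]
          linarith
        rw [neg_div]
        linarith
    rw [setIntegral_const] at h2
    simpa [Measure.real, hh.le] using h2
  have hdiff : ‖∫ v in Ioi (0:ℝ), (a v - a u) * (W v : ℂ)‖ ≤ M * (2 * u * h + 4 * h ^ 2 + 1) * (4 * h) := by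
    have gi2 : Integrable (fun v : ℝ => M * (2 * u * h + 4 * h ^ 2 + 1) *
      Real.exp (-(u - v) ^ 2 / (4 * h ^ 2))) := gi.const_mul _
    refine (norm_integral_le_of_norm_le gi2.integrableOn ?_).trans
      ((setIntegral_le_integral gi2 (Filter.Eventually.of_forall fun v => by positivity)).trans ?_)
    · filter_upwards [ae_restrict_mem measurableSet_Ioi] with v hv
      have hv0 : 0 < v := hv
      rw [norm_mul, Complex.norm_real, Real.norm_eq_abs, abs_of_pos (hWpos v)]
      have h1 := hlip u v hu hv0
      have h2 := gauss_absorb (x := u - v) hu0.le hh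
      have e1 : |v - u| = |u - v| := abs_sub_comm _ _
      have e2 : (v - u) ^ 2 = (u - v) ^ 2 := by ring
      rw [e1, e2] at h1
      calc ‖a v - a u‖ * W v ≤ (M * (u * |u - v| + (u - v) ^ 2 + 1)) *
            Real.exp (-(u - v) ^ 2 / (2 * h ^ 2)) := by
              gcongr
              exact hWle v hv0
        _ = M * ((u * |u - v| + (u - v) ^ 2 + 1) * Real.exp (-(u - v) ^ 2 / (2 * h ^ 2))) := by ring
        _ ≤ M * ((2 * u * h + 4 * h ^ 2 + 1) * Real.exp (-(u - v) ^ 2 / (4 * h ^ 2))) := by gcongr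
        _ = _ := by ring
    · rw [integral_const_mul]; gcongr
  have hsplit : a u * ((∫ v in Ioi (0:ℝ), W v : ℝ) : ℂ) = (∫ v in Ioi (0:ℝ), a v * (W v : ℂ)) -
      ∫ v in Ioi (0:ℝ), (a v - a u) * (W v : ℂ) := by
    simp_rw [sub_mul]
    rw [integral_sub haW (hWic.const_mul _), integral_const_mul, ← integral_complex_ofReal]
    ring
  have h1 : ‖a u‖ * ∫ v in Ioi (0:ℝ), W v ≤ h * D + M * (2 * u * h + 4 * h ^ 2 + 1) * (4 * h) := by
    have hWn : 0 ≤ ∫ v in Ioi (0:ℝ), W v := le_trans (by positivity) hlow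
    calc ‖a u‖ * ∫ v in Ioi (0:ℝ), W v = ‖a u * ((∫ v in Ioi (0:ℝ), W v : ℝ) : ℂ)‖ := by
          rw [norm_mul, Complex.norm_real, Real.norm_eq_abs, abs_of_nonneg hWn]
      _ ≤ _ := by
        rw [hsplit]
        exact (norm_sub_le _ _).trans (add_le_add hs hdiff)
  have h2 : ‖a u‖ * (h * Real.exp (-(5 / 2))) ≤ h * (D + M * (2 * u * h + 4 * h ^ 2 + 1) * 4) := by
    calc _ ≤ ‖a u‖ * ∫ v in Ioi (0:ℝ), W v := by gcongr
      _ ≤ _ := h1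
      _ = _ := by ring
  have h3 : h * (‖a u‖ * Real.exp (-(5 / 2))) ≤ h * (D + M * (2 * u * h + 4 * h ^ 2 + 1) * 4) := by
    linarith
  have h4 := le_of_mul_le_mul_left h3 hh
  rw [Real.exp_neg, ← div_eq_mul_inv, div_le_iff₀ (Real.exp_pos _)] at h4
  linarith

theorem tauber {B M : ℝ} (hB : 0 < B) (hM : 0 < M) : ∃ C > 0, ∀ a : ℝ → ℂ,
    (∀ σ : ℝ, 0 < σ → IntegrableOn (fun v => a v * Complex.exp (-σ * v)) (Ioi 0)) →
    (∀ u v : ℝ, 2 ≤ u → 0 < v → ‖a v - a u‖ ≤ M * (u * |v - u| + (v - u) ^ 2 + 1)) →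
    (∀ s : ℂ, 0 < s.re → s.re ≤ 1 → |s.im| ≤ 1 → ‖Lap a s‖ ≤ B / ‖s‖) →
    (∀ s : ℂ, 0 < s.re → s.re ≤ 1 → 1 ≤ |s.im| → ‖Lap a s‖ ≤ B * |s.im| ^ 15) →
    ∀ u : ℝ, 2 ≤ u → ‖a u‖ ≤ C * u ^ (33 / 34 : ℝ) := by
  have hKT : 0 ≤ KT := by unfold KT; positivity
  refine ⟨Real.exp (5 / 2) * (B * (2 * π) + B * KT * 4 + M * 7 * 4), by positivity, ?_⟩
  intro a hIntg hlip hn hf u hu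
  have hu0 : 0 < u := by linarith
  have hu1 : 1 ≤ u := by linarith
  set h := u ^ (-(1 / 34) : ℝ) with hh
  have hh0 : 0 < h := by positivity
  have hh1 : h ≤ 1 := Real.rpow_le_one_of_one_le_of_nonpos hu1 (by norm_num)
  refine (tauber_core hB hM hIntg hlip hn hf hu hh0 hh1).trans ?_
  rw [mul_assoc (Real.exp (5 / 2)) _ (u ^ (33 / 34 : ℝ))]
  refine mul_le_mul_of_nonneg_left ?_ (Real.exp_pos _).le
  set X := u ^ (33 / 34 : ℝ) with hX
  have hX1 : 1 ≤ X := Real.one_le_rpow hu1 (by norm_num)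
  have hsq : Real.sqrt u ≤ X := by
    rw [Real.sqrt_eq_rpow]; exact Real.rpow_le_rpow_of_exponent_le hu1 (by norm_num)
  have huh : u * h = X := by
    rw [hh, hX]
    nth_rewrite 1 [← Real.rpow_one u]
    rw [← Real.rpow_add hu0]; norm_num
  have h17 : (h ^ 16)⁻¹ * (4 / h) = 4 * Real.sqrt u := by
    have : (h ^ 17)⁻¹ = Real.sqrt u := by
      rw [hh, ← Real.rpow_natCast, ← Real.rpow_mul hu0.le, ← Real.rpow_neg hu0.le, Real.sqrt_eq_rpow]
      norm_num
    rw [← this]; field_simp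
  have hhh : h ^ 2 ≤ 1 := pow_le_one₀ hh0.le hh1
  calc _ = B * (2 * π) * Real.sqrt u + B * KT * ((h ^ 16)⁻¹ * (4 / h)) + M * (2 * (u * h) + 4 * h ^ 2 + 1) * 4 := by
        ring
    _ = B * (2 * π) * Real.sqrt u + B * KT * 4 * Real.sqrt u + M * (2 * X + 4 * h ^ 2 + 1) * 4 := by
        rw [h17, huh]; ring
    _ ≤ B * (2 * π) * X + B * KT * 4 * X + M * (2 * X + 4 * X + X) * 4 := by
        gcongr
        linarith
    _ = _ := by ring

end EK

namespace EK
open MeasureTheory Set Filter Asymptotics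

lemma quad_exp_int {c : ℝ} (hc : 0 < c) :
    IntegrableOn (fun v : ℝ => (1 + v) ^ 2 * Real.exp (-c * v)) (Ioi 0) := by
  have h1 : IntegrableOn (fun v : ℝ => 8 / c ^ 2 * Real.exp (c / 2) * Real.exp (-(c / 2) * v)) (Ioi 0) :=
    (exp_neg_integrableOn_Ioi 0 (by positivity)).const_mul _
  refine Integrable.mono' h1 (Continuous.aestronglyMeasurable (by fun_prop)) ?_
  filter_upwards [ae_restrict_mem measurableSet_Ioi] with v hv
  have hv0 : 0 < v := hv
  rw [Real.norm_eq_abs, abs_of_nonneg (by positivity)]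
  have h2 := Real.pow_div_factorial_le_exp (c / 2 * (1 + v)) (by positivity) 2
  have h3 : (1 + v) ^ 2 = 8 / c ^ 2 * ((c / 2 * (1 + v)) ^ 2 / (Nat.factorial 2 : ℝ)) := by
    simp only [Nat.factorial]; field_simp; norm_num
  rw [h3]
  calc _ ≤ 8 / c ^ 2 * Real.exp (c / 2 * (1 + v)) * Real.exp (-c * v) := by gcongr
    _ = 8 / c ^ 2 * (Real.exp (c / 2 * (1 + v)) * Real.exp (-c * v)) := by ring
    _ = 8 / c ^ 2 * (Real.exp (c / 2) * Real.exp (-(c / 2) * v)) := by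
      rw [← Real.exp_add, ← Real.exp_add]; congr 2; ring
    _ = _ := by ring

lemma norm_cexp_neg (s : ℂ) (v : ℝ) : ‖Complex.exp (-s * v)‖ = Real.exp (-s.re * v) := by
  rw [Complex.norm_exp]; simp

lemma lap_integrable {a : ℝ → ℂ} {K : ℝ} (hm : AEStronglyMeasurable a (volume.restrict (Ioi 0)))
    (hK : ∀ v, 0 < v → ‖a v‖ ≤ K * (1 + v)) {s : ℂ} (hs : 0 < s.re) :
    IntegrableOn (fun v => a v * Complex.exp (-s * v)) (Ioi 0) := by
  have hK0 : 0 ≤ K := by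
    have h := (norm_nonneg _).trans (hK 1 one_pos)
    linarith
  refine Integrable.mono' ((quad_exp_int hs).const_mul K) (hm.mul (Continuous.aestronglyMeasurable (by fun_prop))) ?_
  filter_upwards [ae_restrict_mem measurableSet_Ioi] with v hv
  have hv0 : 0 < v := hv
  rw [norm_mul, norm_cexp_neg]
  calc _ ≤ K * (1 + v) * Real.exp (-s.re * v) := by gcongr; exact hK v hv0
    _ ≤ K * (1 + v) ^ 2 * Real.exp (-s.re * v) := by
      gcongr; nlinarith
    _ = _ := by ring

lemma lap_diffAt {a : ℝ → ℂ} {K : ℝ} (hm : AEStronglyMeasurable a (volume.restrict (Ioi 0)))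
    (hK : ∀ v, 0 < v → ‖a v‖ ≤ K * (1 + v)) {s : ℂ} (hs : 0 < s.re) :
    DifferentiableAt ℂ (Lap a) s := by
  have hK0 : 0 ≤ K := by
    have h := (norm_nonneg _).trans (hK 1 one_pos)
    linarith
  have hs2 : 0 < s.re / 2 := by positivity
  have := hasDerivAt_integral_of_dominated_loc_of_deriv_le (μ := volume.restrict (Ioi 0))
    (F := fun s v => a v * Complex.exp (-s * v)) (x₀ := s) (s := {z : ℂ | s.re / 2 < z.re})
    (F' := fun s v => a v * (Complex.exp (-s * v) * (-1 * v)))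
    (bound := fun v => K * ((1 + v) ^ 2 * Real.exp (-(s.re / 2) * v)))
    ((isOpen_re _).mem_nhds (by show s.re / 2 < s.re; linarith))
    (Filter.Eventually.of_forall fun z => hm.mul (Continuous.aestronglyMeasurable (by fun_prop)))
    (lap_integrable hm hK hs)
    (hm.mul (Continuous.aestronglyMeasurable (by fun_prop)))
    (by
      filter_upwards [ae_restrict_mem measurableSet_Ioi] with v hv z hz
      have hv0 : 0 < v := hv
      have hz0 : s.re / 2 < z.re := hz
      rw [norm_mul, norm_mul, norm_cexp_neg, norm_mul, norm_neg, norm_one, one_mul,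
        Complex.norm_real, Real.norm_eq_abs, abs_of_pos hv0]
      calc _ ≤ K * (1 + v) * (Real.exp (-(s.re / 2) * v) * (1 + v)) := by
            gcongr
            · exact hK v hv0
            · linarith
        _ = _ := by ring)
    ((quad_exp_int hs2).const_mul K)
    (by
      refine Filter.Eventually.of_forall fun v z hz => ?_
      have := (((hasDerivAt_id z).neg.mul_const (v:ℂ)).cexp).const_mul (a v)
      simpa using this)
  exact this.2.differentiableAt

lemma cpow_norm_le {z : ℂ} (hz : ‖z‖ = 1) (hr : 0 ≤ z.re) {v : ℝ} (hv : 0 < v) :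
    ‖(v:ℂ) ^ z‖ ≤ 1 + v := by
  rw [Complex.norm_cpow_eq_rpow_re_of_pos hv]
  have hzr := (abs_le.1 (z_re_le hz)).2
  rcases le_total v 1 with h | h
  · have := Real.rpow_le_one hv.le h hr
    linarith
  · have := Real.rpow_le_rpow_of_exponent_le h hzr
    rw [Real.rpow_one] at this
    linarith

lemma cpow_meas (z : ℂ) : AEStronglyMeasurable (fun v : ℝ => (v:ℂ) ^ z) (volume.restrict (Ioi 0)) := by
  apply ContinuousOn.aestronglyMeasurable _ measurableSet_Ioi
  intro v hv
  apply ContinuousAt.continuousWithinAt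
  exact (Complex.continuous_ofReal.continuousAt).cpow continuousAt_const
    (Or.inl (by simpa using hv))

lemma lap_cpow {z : ℂ} (hz : ‖z‖ = 1) (hr : 0 ≤ z.re) {s : ℂ} (hs : 0 < s.re) :
    Lap (fun v => (v:ℂ) ^ z) s = Complex.Gamma (z + 1) * s ^ (-z - 1) := by
  have hU : IsOpen {s : ℂ | 0 < s.re} := isOpen_re 0
  have hd1 : DifferentiableOn ℂ (Lap (fun v => (v:ℂ) ^ z)) {s : ℂ | 0 < s.re} := fun s hs =>
    (lap_diffAt (K := 1) (cpow_meas z) (fun v hv => by rw [one_mul]; exact cpow_norm_le hz hr hv)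
      hs).differentiableWithinAt
  have hd2 : DifferentiableOn ℂ (fun s : ℂ => Complex.Gamma (z + 1) * s ^ (-z - 1))
      {s : ℂ | 0 < s.re} := fun s hs => by
    apply DifferentiableAt.differentiableWithinAt
    exact (differentiableAt_id.cpow_const (Or.inl hs)).const_mul _
  refine (hd1.analyticOnNhd hU).eqOn_of_preconnected_of_frequently_eq (hd2.analyticOnNhd hU)
    (convex_halfSpace_re_gt 0).isPreconnected (z₀ := 1) (by simp) ?_ hs
  have ht : Tendsto (fun x : ℝ => (x:ℂ)) (nhdsWithin 1 {1}ᶜ) (nhdsWithin 1 {1}ᶜ) := by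
    apply tendsto_nhdsWithin_of_tendsto_nhds_of_eventually_within
    · have := Complex.continuous_ofReal.tendsto 1
      rw [Complex.ofReal_one] at this
      exact this.mono_left nhdsWithin_le_nhds
    · filter_upwards [self_mem_nhdsWithin] with x hx
      simpa using hx
  apply ht.frequently
  apply Filter.Eventually.frequently
  have h0 : ∀ᶠ x : ℝ in nhdsWithin 1 {1}ᶜ, 0 < x :=
    nhdsWithin_le_nhds (Ioi_mem_nhds (by norm_num))
  filter_upwards [h0] with x hx
  have h := Complex.integral_cpow_mul_exp_neg_mul_Ioi (a := z + 1) (r := x) (by simp; linarith) hx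
  rw [add_sub_cancel_right] at h
  unfold Lap
  simp_rw [neg_mul]
  rw [h, one_div, Complex.inv_cpow, ← Complex.cpow_neg, mul_comm]
  · congr 2; ring
  · rw [Complex.arg_ofReal_of_nonneg hx.le]; exact Real.pi_pos.ne

/-! The summatory function -/

def S1 (z : ℂ) (n : ℕ) : ℂ := ∑ k ∈ Finset.Icc 1 n, LSeries.logMul (fz z) k

def Az (z : ℂ) (v : ℝ) : ℂ := Complex.exp (-v) * S1 z ⌊Real.exp v⌋₊

lemma logMul_norm {z : ℂ} (hz : ‖z‖ = 1) (k : ℕ) : ‖LSeries.logMul (fz z) k‖ = Real.log k := by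
  rw [LSeries.logMul, norm_mul, fz_norm hz, mul_one, ← Complex.natCast_log, Complex.norm_real,
    Real.norm_eq_abs, abs_of_nonneg (Real.log_natCast_nonneg k)]

lemma S1_norm_sub {z : ℂ} (hz : ‖z‖ = 1) {m n : ℕ} (h : m ≤ n) :
    ‖S1 z n - S1 z m‖ ≤ ((n:ℝ) - m) * Real.log n := by
  have : S1 z n - S1 z m = ∑ k ∈ Finset.Ioc m n, LSeries.logMul (fz z) k := by
    unfold S1
    rw [sub_eq_iff_eq_add, add_comm]
    have e : ∀ j : ℕ, Finset.Icc 1 j = Finset.Ioc 0 j := fun j => by ext; simp; omega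
    rw [e, e]
    exact (Finset.sum_Ioc_consecutive _ (Nat.zero_le m) h).symm
  rw [this]
  refine (norm_sum_le _ _).trans ?_
  have h2 : ∀ k ∈ Finset.Ioc m n, ‖LSeries.logMul (fz z) k‖ ≤ Real.log n := by
    intro k hk
    rw [Finset.mem_Ioc] at hk
    rw [logMul_norm hz]
    apply Real.log_le_log
    · exact_mod_cast (by omega : 0 < k)
    · exact_mod_cast hk.2
  refine (Finset.sum_le_card_nsmul _ _ _ h2).trans ?_
  rw [Nat.card_Ioc, nsmul_eq_mul, Nat.cast_sub h]

lemma floor_exp_log_le {v : ℝ} (hv : 0 ≤ v) : Real.log (⌊Real.exp v⌋₊ : ℝ) ≤ v := by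
  have h1 : 1 ≤ ⌊Real.exp v⌋₊ := by
    rw [Nat.one_le_floor_iff]; exact Real.one_le_exp hv
  rw [Real.log_le_iff_le_exp (by exact_mod_cast h1)]
  exact Nat.floor_le (Real.exp_pos v).le

lemma S1_norm {z : ℂ} (hz : ‖z‖ = 1) {v : ℝ} (hv : 0 ≤ v) :
    ‖S1 z ⌊Real.exp v⌋₊‖ ≤ Real.exp v * v := by
  have := S1_norm_sub hz (Nat.zero_le ⌊Real.exp v⌋₊)
  have h0 : S1 z 0 = 0 := by simp [S1]
  rw [h0, sub_zero, Nat.cast_zero, sub_zero] at this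
  refine this.trans ?_
  gcongr
  · exact Nat.floor_le (Real.exp_pos v).le
  · exact floor_exp_log_le hv

lemma norm_cexp_neg' (v : ℝ) : ‖Complex.exp (-(v:ℂ))‖ = Real.exp (-v) := by
  rw [Complex.norm_exp]; simp

lemma Az_norm {z : ℂ} (hz : ‖z‖ = 1) {v : ℝ} (hv : 0 ≤ v) : ‖Az z v‖ ≤ v := by
  unfold Az
  rw [norm_mul, norm_cexp_neg', Real.exp_neg, inv_mul_le_iff₀ (Real.exp_pos v)]
  exact S1_norm hz hv

lemma Az_lip {z : ℂ} (hz : ‖z‖ = 1) {u v : ℝ} (hu : 0 ≤ u) (huv : u ≤ v) :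
    ‖Az z v - Az z u‖ ≤ 2 * v * (v - u) + 1 := by
  have hv : 0 ≤ v := hu.trans huv
  have e : Az z v - Az z u = (Complex.exp (-(v:ℂ)) - Complex.exp (-(u:ℂ))) * S1 z ⌊Real.exp u⌋₊ +
      Complex.exp (-(v:ℂ)) * (S1 z ⌊Real.exp v⌋₊ - S1 z ⌊Real.exp u⌋₊) := by unfold Az; ring
  rw [e]
  have hev := Real.exp_pos v
  have heu := Real.exp_pos u
  have hexp : 1 - Real.exp (-(v - u)) ≤ v - u := by
    have := Real.add_one_le_exp (-(v - u)); linarith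
  have hmono : Real.exp u ≤ Real.exp v := Real.exp_le_exp.2 huv
  have e1 : Real.exp (-v) * Real.exp u = Real.exp (-(v - u)) := by
    rw [← Real.exp_add]; congr 1; ring
  have h1 : ‖(Complex.exp (-(v:ℂ)) - Complex.exp (-(u:ℂ))) * S1 z ⌊Real.exp u⌋₊‖ ≤ v * (v - u) := by
    rw [norm_mul]
    have : ‖Complex.exp (-(v:ℂ)) - Complex.exp (-(u:ℂ))‖ = Real.exp (-u) - Real.exp (-v) := by
      rw [← Complex.ofReal_neg, ← Complex.ofReal_neg, ← Complex.ofReal_exp, ← Complex.ofReal_exp,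
        ← Complex.ofReal_sub, Complex.norm_real, Real.norm_eq_abs, abs_sub_comm, abs_of_nonneg]
      have : Real.exp (-v) ≤ Real.exp (-u) := Real.exp_le_exp.2 (by linarith)
      linarith
    rw [this]
    have h2 : 0 ≤ Real.exp (-u) - Real.exp (-v) := by
      have : Real.exp (-v) ≤ Real.exp (-u) := Real.exp_le_exp.2 (by linarith)
      linarith
    calc _ ≤ (Real.exp (-u) - Real.exp (-v)) * (Real.exp u * u) := by gcongr; exact S1_norm hz hu
      _ = (1 - Real.exp (-(v - u))) * u := by
        rw [← e1]
        have : Real.exp (-u) * Real.exp u = 1 := by rw [← Real.exp_add]; simp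
        linear_combination u * this
      _ ≤ (v - u) * v := by
        apply mul_le_mul hexp huv hu (by linarith)
      _ = _ := by ring
  have h2 : ‖Complex.exp (-(v:ℂ)) * (S1 z ⌊Real.exp v⌋₊ - S1 z ⌊Real.exp u⌋₊)‖ ≤ v * (v - u) + 1 := by
    rw [norm_mul, norm_cexp_neg']
    have h3 := S1_norm_sub hz (Nat.floor_mono hmono)
    have h4 : (⌊Real.exp v⌋₊ : ℝ) - ⌊Real.exp u⌋₊ ≤ Real.exp v - Real.exp u + 1 := by
      have := Nat.floor_le hev.le
      have := Nat.lt_floor_add_one (Real.exp u)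
      linarith
    have h5 := floor_exp_log_le hv
    calc _ ≤ Real.exp (-v) * ((Real.exp v - Real.exp u + 1) * v) := by
          gcongr
          refine h3.trans ?_
          gcongr
      _ = (1 - Real.exp (-(v - u))) * v + v * Real.exp (-v) := by
        rw [← e1]
        have : Real.exp (-v) * Real.exp v = 1 := by rw [← Real.exp_add]; simp
        linear_combination v * this
      _ ≤ (v - u) * v + 1 := by
        gcongr
        have := Real.add_one_le_exp v
        rw [Real.exp_neg, ← div_eq_mul_inv, div_le_one hev]
        linarith
      _ = _ := by ring
  refine (norm_add_le _ _).trans ?_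
  linarith

lemma Az_lip' {z : ℂ} (hz : ‖z‖ = 1) {u v : ℝ} (hu : 2 ≤ u) (hv : 0 < v) :
    ‖Az z v - Az z u‖ ≤ 2 * (u * |v - u| + (v - u) ^ 2 + 1) := by
  rcases le_total u v with h | h
  · have := Az_lip hz (by linarith) h
    rw [abs_of_nonneg (by linarith)]
    nlinarith
  · have := Az_lip hz hv.le h
    rw [norm_sub_rev, abs_of_nonpos (by linarith)]
    nlinarith [sq_nonneg (v - u)]

lemma cpow_lip {z : ℂ} (hz : ‖z‖ = 1) (hr : 0 ≤ z.re) {u v : ℝ} (hu : 2 ≤ u) (hv : 0 < v) :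
    ‖(v:ℂ) ^ z - (u:ℂ) ^ z‖ ≤ 2 * (u * |v - u| + (v - u) ^ 2 + 1) := by
  have hzr := (abs_le.1 (z_re_le hz)).2
  have hz0 : z ≠ 0 := by rintro rfl; simp at hz
  rcases le_total 1 v with h | h
  · have h1 := Convex.norm_image_sub_le_of_norm_hasDerivWithin_le (𝕜 := ℝ) (s := Ici 1) (x := u) (y := v)
      (f := fun t : ℝ => (t:ℂ) ^ z) (f' := fun t : ℝ => z * (t:ℂ) ^ (z - 1)) (C := 1)
      (fun t ht => by
        have ht0 : (0:ℝ) < t := lt_of_lt_of_le one_pos ht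
        exact (hasDerivAt_ofReal_cpow_const ht0.ne' hz0).hasDerivWithinAt)
      (fun t ht => by
        have ht0 : (0:ℝ) < t := lt_of_lt_of_le one_pos ht
        rw [norm_mul, hz, one_mul, Complex.norm_cpow_eq_rpow_re_of_pos ht0]
        apply Real.rpow_le_one_of_one_le_of_nonpos ht
        simp; linarith)
      (convex_Ici 1) (by show (1:ℝ) ≤ u; linarith) h
    rw [one_mul, Real.norm_eq_abs] at h1
    have := abs_nonneg (v - u)
    nlinarith [sq_nonneg (v - u)]
  · have h1 : ‖(v:ℂ) ^ z‖ ≤ 1 := by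
      rw [Complex.norm_cpow_eq_rpow_re_of_pos hv]; exact Real.rpow_le_one hv.le h hr
    have h2 := cpow_norm_le hz hr (v := u) (by linarith)
    have h3 : 1 ≤ |v - u| := by rw [abs_of_nonpos (by linarith)]; linarith
    refine (norm_sub_le _ _).trans ?_
    nlinarith [sq_nonneg (v - u)]

lemma Az_meas (z : ℂ) : Measurable (Az z) := by
  unfold Az
  apply Measurable.mul
  · fun_prop
  · exact (measurable_from_nat (f := S1 z)).comp (Nat.measurable_floor.comp Real.measurable_exp)

lemma lap_Az {z : ℂ} (hz : ‖z‖ = 1) {s : ℂ} (hs : 0 < s.re) :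
    Lap (Az z) s = -deriv (Fz z) (s + 1) / (s + 1) := by
  have hs1 : 1 < (s + 1).re := by simp [hs]
  have hne : s + 1 ≠ 0 := by intro h; rw [h] at hs1; simp at hs1; linarith
  rw [Fz_deriv_eq hz hs1, neg_neg]
  have hO : (fun n : ℕ => ∑ k ∈ Finset.Icc 1 n, ‖LSeries.logMul (fz z) k‖) =O[atTop]
      fun n : ℕ => (n:ℝ) ^ (1 + s.re / 2) := by
    refine IsBigO.of_bound (2 / s.re) ?_
    filter_upwards [eventually_ge_atTop 1] with n hn
    have hn0 : (0:ℝ) < n := by exact_mod_cast hn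
    rw [Real.norm_eq_abs, abs_of_nonneg (Finset.sum_nonneg fun _ _ => norm_nonneg _),
      Real.norm_eq_abs, abs_of_nonneg (by positivity)]
    have h2 : ∀ k ∈ Finset.Icc 1 n, ‖LSeries.logMul (fz z) k‖ ≤ Real.log n := by
      intro k hk
      rw [Finset.mem_Icc] at hk
      rw [logMul_norm hz]
      apply Real.log_le_log
      · exact_mod_cast (by omega : 0 < k)
      · exact_mod_cast hk.2
    refine (Finset.sum_le_card_nsmul _ _ _ h2).trans ?_
    rw [Nat.card_Icc, nsmul_eq_mul, Nat.add_sub_cancel]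
    have h3 := Real.log_le_rpow_div hn0.le (ε := s.re / 2) (by positivity)
    rw [Real.rpow_add hn0, Real.rpow_one]
    calc (n:ℝ) * Real.log n ≤ n * ((n:ℝ) ^ (s.re / 2) / (s.re / 2)) := by gcongr
      _ = _ := by field_simp
  rw [LSeries_eq_mul_integral' _ (by positivity : 0 ≤ 1 + s.re / 2)
    (by simp; linarith) hO, mul_div_cancel_left₀ _ hne]
  have himg : Ioi (1:ℝ) = Real.exp '' Ioi 0 := by rw [Real.image_exp_Ioi, Real.exp_zero]
  rw [himg, integral_image_eq_integral_abs_deriv_smul measurableSet_Ioi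
    (fun x _ => (Real.hasDerivAt_exp x).hasDerivWithinAt) Real.exp_injective.injOn]
  unfold Lap
  congr 1
  ext v
  rw [Real.abs_exp, Complex.real_smul, Az, S1]
  have e : ((Real.exp v : ℝ) : ℂ) ^ (-(s + 1 + 1)) = Complex.exp (-(s + 1 + 1) * v) := by
    rw [Complex.cpow_def_of_ne_zero (by exact_mod_cast (Real.exp_pos v).ne'),
      ← Complex.ofReal_log (Real.exp_pos v).le, Real.log_exp, mul_comm]
  rw [e]
  have e2 : Complex.exp (-(v:ℂ)) * Complex.exp (-s * v) =
      ((Real.exp v : ℝ) : ℂ) * Complex.exp (-(s + 1 + 1) * v) := by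
    rw [Complex.ofReal_exp, ← Complex.exp_add, ← Complex.exp_add]; congr 1; ring
  linear_combination (∑ k ∈ Finset.Icc 1 ⌊Real.exp v⌋₊, LSeries.logMul (fz z) k) * e2

def az (z : ℂ) (v : ℝ) : ℂ := Az z v - cz z * (v:ℂ) ^ z

lemma lap_az {z : ℂ} (hz : ‖z‖ = 1) {s : ℂ} (hs : 0 < s.re) :
    Lap (az z) s = -deriv (Fz z) (s + 1) / (s + 1) - cz z * Complex.Gamma (z + 1) * s ^ (-z - 1) := by
  have i1 : IntegrableOn (fun v => Az z v * Complex.exp (-s * v)) (Ioi 0) :=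
    lap_integrable (K := 1) (Az_meas z).aestronglyMeasurable (fun v hv => by
      have := Az_norm hz hv.le
      linarith) hs
  by_cases h : 0 ≤ z.re
  · have i2 : IntegrableOn (fun v : ℝ => (v:ℂ) ^ z * Complex.exp (-s * v)) (Ioi 0) :=
      lap_integrable (K := 1) (cpow_meas z) (fun v hv => by
        rw [one_mul]; exact cpow_norm_le hz h hv) hs
    rw [← lap_Az hz hs, mul_assoc, ← lap_cpow hz h hs]
    unfold Lap az
    simp_rw [sub_mul, mul_assoc]
    rw [integral_sub i1 (i2.const_mul _), integral_const_mul]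
  · have : cz z = 0 := by rw [cz, if_neg h]
    rw [← lap_Az hz hs]
    unfold Lap az
    simp [this]

theorem az_bound : ∃ C > 0, ∀ z : ℂ, ‖z‖ = 1 → ∀ u : ℝ, 2 ≤ u → ‖az z u‖ ≤ C * u ^ (33 / 34 : ℝ) := by
  obtain ⟨Cc, hCc, hcz⟩ := cz_bound
  obtain ⟨C1, hC1, hL1⟩ := L_near
  obtain ⟨C2, hC2, hL2⟩ := L_far
  obtain ⟨C, hC, hT⟩ := tauber (B := C1 + C2) (M := 2 + Cc * 2) (by positivity) (by positivity)
  refine ⟨C, hC, fun z hz => hT (az z) ?_ ?_ ?_ ?_⟩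
  · intro σ hσ
    have hσ' : 0 < (σ:ℂ).re := by simpa
    by_cases h : 0 ≤ z.re
    · refine lap_integrable (K := 1 + Cc) ((Az_meas z).aestronglyMeasurable.sub
        ((cpow_meas z).const_mul _)) (fun v hv => ?_) hσ'
      have h1 := Az_norm hz hv.le
      have h2 := cpow_norm_le hz h hv
      refine (norm_sub_le _ _).trans ?_
      rw [norm_mul]
      have : ‖cz z‖ * ‖(v:ℂ) ^ z‖ ≤ Cc * (1 + v) := by gcongr; exact hcz z hz
      linarith
    · have h0 : cz z = 0 := by rw [cz, if_neg h]
      unfold az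
      simp only [h0, zero_mul, sub_zero]
      exact lap_integrable (K := 1) (Az_meas z).aestronglyMeasurable (fun v hv => by
        have := Az_norm hz hv.le
        linarith) hσ'
  · intro u v hu hv
    have h1 := Az_lip' hz hu hv
    by_cases h : 0 ≤ z.re
    · have h2 := cpow_lip hz h hu hv
      have e : az z v - az z u = (Az z v - Az z u) - cz z * ((v:ℂ) ^ z - (u:ℂ) ^ z) := by
        unfold az; ring
      rw [e]
      refine (norm_sub_le _ _).trans ?_
      rw [norm_mul]
      have : ‖cz z‖ * ‖(v:ℂ) ^ z - (u:ℂ) ^ z‖ ≤ Cc * (2 * (u * |v - u| + (v - u) ^ 2 + 1)) := by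
        gcongr; exact hcz z hz
      linarith
    · have h0 : cz z = 0 := by rw [cz, if_neg h]
      unfold az
      simp only [h0, zero_mul, sub_zero]
      refine h1.trans ?_
      gcongr
      linarith
  · intro s h1 h2 h3
    rw [lap_az hz h1]
    have := hL1 z hz (s + 1) (by simp [h1]) (by simp; linarith) (by simpa using h3)
    rw [add_sub_cancel_right] at this
    refine this.trans ?_
    gcongr; linarith
  · intro s h1 h2 h3
    rw [lap_az hz h1]
    have := hL2 z hz (s + 1) (by simp [h1]) (by simp; linarith) (by simpa using h3)
    rw [add_sub_cancel_right] at this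
    simp only [Complex.add_im, Complex.one_im, add_zero] at this
    refine this.trans ?_
    gcongr; linarith

end EK

namespace EK
open MeasureTheory Set Filter Asymptotics

def mz (n : ℕ) (z : ℂ) : ℂ := (∑ k ∈ Finset.Icc 1 n, z ^ smallOmega k) / n

lemma log_two_le {n : ℕ} (hn : 16 ≤ n) : 2 ≤ Real.log n := by
  have h : Real.log 16 ≤ Real.log n := Real.log_le_log (by norm_num) (by exact_mod_cast hn)
  have : Real.log 16 = 4 * Real.log 2 := by
    rw [show (16:ℝ) = 2 ^ 4 by norm_num, Real.log_pow]; norm_num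
  have := Real.log_two_gt_d9
  linarith

lemma sum_log_diff {n : ℕ} (hn : 1 ≤ n) :
    ∑ k ∈ Finset.Icc 1 n, (Real.log n - Real.log k) ≤ n := by
  have hn0 : (0:ℝ) < n := by exact_mod_cast hn
  have h1 : ∑ k ∈ Finset.Icc 1 n, Real.log k = Real.log (n.factorial) := by
    have hI : Finset.Icc 1 n = Finset.Ico 1 (n + 1) := by ext; simp [Nat.lt_succ_iff]
    rw [hI, ← Finset.prod_Ico_id_eq_factorial, Nat.cast_prod, Real.log_prod]
    intro k hk
    rw [Finset.mem_Ico] at hk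
    exact_mod_cast (by omega : k ≠ 0)
  rw [Finset.sum_sub_distrib, h1, Finset.sum_const, Nat.card_Icc, Nat.add_sub_cancel, nsmul_eq_mul]
  have h2 := Real.pow_div_factorial_le_exp (n:ℝ) hn0.le n
  have h3 := Real.log_le_log (by positivity) h2
  rw [Real.log_exp, Real.log_div (by positivity) (by positivity), Real.log_pow] at h3
  exact h3

lemma mz_Az {z : ℂ} (hz : ‖z‖ = 1) {n : ℕ} (hn : 1 ≤ n) :
    ‖(Real.log n : ℂ) * mz n z - Az z (Real.log n)‖ ≤ 1 := by
  have hn0 : (0:ℝ) < n := by exact_mod_cast hn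
  have hn0' : (n:ℂ) ≠ 0 := by exact_mod_cast hn0.ne'
  have e : (Real.log n : ℂ) * mz n z - Az z (Real.log n) =
      (∑ k ∈ Finset.Icc 1 n, ((Real.log n - Real.log k : ℝ) : ℂ) * z ^ smallOmega k) / n := by
    unfold mz Az S1
    rw [Real.exp_log hn0, Nat.floor_natCast, ← Complex.ofReal_neg, ← Complex.ofReal_exp,
      Real.exp_neg, Real.exp_log hn0]
    push_cast
    simp only [sub_mul, Finset.sum_sub_distrib, LSeries.logMul, fz, ← Finset.mul_sum]
    field_simp
  rw [e, norm_div, Complex.norm_natCast, div_le_one hn0]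
  refine (norm_sum_le _ _).trans ((Finset.sum_le_sum ?_).trans (sum_log_diff hn))
  intro k hk
  rw [Finset.mem_Icc] at hk
  rw [norm_mul, norm_pow, hz, one_pow, mul_one, Complex.norm_real, Real.norm_eq_abs, abs_of_nonneg]
  have : Real.log k ≤ Real.log n :=
    Real.log_le_log (by exact_mod_cast (by omega : 0 < k)) (by exact_mod_cast hk.2)
  linarith

theorem mean_bound : ∃ C > 0, ∀ z : ℂ, ‖z‖ = 1 → ∀ n : ℕ, 16 ≤ n →
    ‖mz n z - Complex.exp ((z - 1) * (Real.log (Real.log n) : ℝ)) * Phi1 (z - 1)‖ ≤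
      C * (Real.log n) ^ (-1 / 34 : ℝ) := by
  obtain ⟨C1, hC1, h1⟩ := az_bound
  obtain ⟨C2, hC2, h2⟩ := Phi1_bound
  refine ⟨1 + C1 + C2, by positivity, fun z hz n hn => ?_⟩
  have hu2 := log_two_le hn
  set u := Real.log n with hu
  have hu0 : 0 < u := by linarith
  have hu0' : (u:ℂ) ≠ 0 := by exact_mod_cast hu0.ne'
  have hw2 : ‖z - 1‖ ≤ 2 := by
    refine (norm_sub_le _ _).trans ?_
    rw [hz]; norm_num
  have ex : Complex.exp ((z - 1) * (Real.log u : ℝ)) = (u:ℂ) ^ z / u := by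
    have : (u:ℂ) ^ z / u = (u:ℂ) ^ (z - 1) := by
      rw [Complex.cpow_sub _ _ hu0', Complex.cpow_one]
    rw [this, Complex.cpow_def_of_ne_zero hu0', Complex.ofReal_log hu0.le, mul_comm]
  have a1 : ‖mz n z - cz z * ((u:ℂ) ^ z / u)‖ ≤ (1 + C1) * u ^ (-1/34 : ℝ) := by
    have e : mz n z - cz z * ((u:ℂ) ^ z / u) =
        ((u * mz n z - Az z u) + az z u) / u := by
      unfold az; field_simp; ring
    rw [e, norm_div, Complex.norm_real, Real.norm_eq_abs, abs_of_pos hu0, div_le_iff₀ hu0]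
    have e2 : u ^ (-1/34 : ℝ) * u = u ^ (33/34:ℝ) := by
      rw [← Real.rpow_add_one hu0.ne']; norm_num
    rw [mul_assoc, e2]
    have h3 := h1 z hz u hu2
    have h4 := mz_Az hz (by omega : 1 ≤ n)
    have h5 : 1 ≤ u ^ (33/34:ℝ) := Real.one_le_rpow (by linarith) (by norm_num)
    refine (norm_add_le _ _).trans ?_
    rw [← hu] at h4
    nlinarith
  have a2 : ‖cz z * ((u:ℂ) ^ z / u) - (u:ℂ) ^ z / u * Phi1 (z - 1)‖ ≤ C2 * u ^ (-1/34 : ℝ) := by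
    unfold cz
    split_ifs with h
    · rw [mul_comm, sub_self, norm_zero]; positivity
    · rw [zero_mul, zero_sub, norm_neg, norm_mul, mul_comm]
      gcongr
      · exact (h2 _ hw2).1
      · rw [← ex, Complex.norm_exp, Complex.re_mul_ofReal, mul_comm, Real.exp_mul,
          Real.exp_log hu0]
        apply Real.rpow_le_rpow_of_exponent_le (by linarith)
        rw [Complex.sub_re, Complex.one_re]
        linarith
  rw [ex]
  calc _ = ‖(mz n z - cz z * ((u:ℂ) ^ z / u)) + (cz z * ((u:ℂ) ^ z / u) - (u:ℂ) ^ z / u * Phi1 (z - 1))‖ := by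
        congr 1; ring
    _ ≤ _ := norm_add_le _ _
    _ ≤ _ := by linarith

end EK

namespace EK
open MeasureTheory Set Filter Asymptotics

def ez (t : ℝ) : ℂ := Complex.exp (Complex.I * t)

lemma ez_ne (t : ℝ) : ez t ≠ 0 := Complex.exp_ne_zero _

lemma ez_norm (t : ℝ) : ‖ez t‖ = 1 := by
  unfold ez; rw [Complex.norm_exp_I_mul_ofReal]

lemma ez_cont : Continuous ez := by unfold ez; fun_prop

lemma ez_zpow_cont (m : ℤ) : Continuous fun t => ez t ^ m :=
  ez_cont.zpow₀ m fun t => Or.inl (ez_ne t)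

lemma int_zpow (m : ℤ) : ∫ t in (-π)..π, ez t ^ m = if m = 0 then 2 * (π:ℂ) else 0 := by
  split_ifs with h
  · subst h; simp; ring
  · have hm : (m:ℂ) * Complex.I ≠ 0 := mul_ne_zero (by exact_mod_cast h) Complex.I_ne_zero
    have e : ∀ t : ℝ, ez t ^ m = Complex.exp ((m * Complex.I) * t) := by
      intro t; unfold ez; rw [← Complex.exp_int_mul, mul_assoc]
    simp only [e]
    rw [integral_exp_mul_complex hm, div_eq_zero_iff]
    left
    rw [sub_eq_zero, Complex.exp_eq_exp_iff_exists_int]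
    exact ⟨m, by push_cast; ring⟩

lemma int_pois (lam : ℂ) (m : ℤ) :
    ∫ t in (-π)..π, ez t ^ (-m) * Complex.exp (lam * ez t) =
      2 * (π:ℂ) * (if 0 ≤ m then lam ^ m.toNat / (m.toNat.factorial : ℂ) else 0) := by
  have key : HasSum (fun i : ℕ => ∫ t in (-π)..π, ez t ^ (-m) * ((lam * ez t) ^ i / (i.factorial : ℂ)))
      (∫ t in (-π)..π, ez t ^ (-m) * Complex.exp (lam * ez t)) := by
    apply intervalIntegral.hasSum_integral_of_dominated_convergence
      (fun i _ => ‖lam‖ ^ i / (i.factorial : ℝ))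
    · intro i
      apply Continuous.aestronglyMeasurable
      have h1 := ez_zpow_cont (-m)
      have h2 := ez_cont
      fun_prop
    · intro i
      refine Eventually.of_forall fun t _ => ?_
      simp [ez_norm]
    · exact Eventually.of_forall fun t _ => Real.summable_pow_div_factorial _
    · simp
    · refine Eventually.of_forall fun t _ => ?_
      apply HasSum.mul_left
      rw [Complex.exp_eq_exp_ℂ]
      exact NormedSpace.expSeries_div_hasSum_exp (lam * ez t)
  have e : ∀ i : ℕ, (∫ t in (-π)..π, ez t ^ (-m) * ((lam * ez t) ^ i / (i.factorial : ℂ))) =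
      if (i:ℤ) = m then 2 * (π:ℂ) * (lam ^ i / (i.factorial : ℂ)) else 0 := by
    intro i
    have : ∀ t : ℝ, ez t ^ (-m) * ((lam * ez t) ^ i / (i.factorial : ℂ)) =
        (lam ^ i / (i.factorial : ℂ)) * ez t ^ ((i:ℤ) - m) := by
      intro t
      rw [zpow_sub₀ (ez_ne t), zpow_neg, zpow_natCast, mul_pow]
      field_simp
    simp only [this]
    rw [intervalIntegral.integral_const_mul, int_zpow]
    by_cases h : (i:ℤ) = m
    · rw [if_pos (by omega), if_pos h]; ring
    · rw [if_neg (by omega), if_neg h]; ring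
  simp only [e] at key
  rw [← key.tsum_eq]
  split_ifs with h
  · rw [tsum_eq_single m.toNat]
    · rw [if_pos (Int.toNat_of_nonneg h)]
    · intro i hi
      rw [if_neg]; omega
  · rw [mul_zero]
    convert tsum_zero with i
    rw [if_neg]; omega

/-- Fourier integral at `j`. -/
def fcoef (f : ℂ → ℂ) (j : ℕ) : ℂ := ∫ t in (-π)..π, ez t ^ (-(j:ℤ)) * f (ez t)

lemma fcoef_mz (n j : ℕ) : fcoef (mz n) j =
    2 * (π:ℂ) * ((((Finset.Icc 1 n).filter fun k => smallOmega k = j).card : ℂ) / n) := by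
  unfold fcoef mz
  have : ∀ t : ℝ, ez t ^ (-(j:ℤ)) * ((∑ k ∈ Finset.Icc 1 n, ez t ^ smallOmega k) / n) =
      (∑ k ∈ Finset.Icc 1 n, ez t ^ ((smallOmega k : ℤ) - j)) * (n:ℂ)⁻¹ := by
    intro t
    rw [div_eq_mul_inv, ← mul_assoc, Finset.mul_sum]
    congr 1
    refine Finset.sum_congr rfl fun k _ => ?_
    rw [sub_eq_add_neg, add_comm, zpow_add₀ (ez_ne t), zpow_natCast]
  simp only [this]
  rw [intervalIntegral.integral_mul_const, intervalIntegral.integral_finsetSum]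
  · simp only [int_zpow, sub_eq_zero, Nat.cast_inj]
    rw [← Finset.sum_filter, Finset.sum_const, nsmul_eq_mul]
    ring
  · intro k _
    exact (ez_zpow_cont _).intervalIntegrable _ _

lemma fcoef_pow {lam : ℝ} (hl : 0 < lam) (l j : ℕ) :
    fcoef (fun z => Complex.exp ((z - 1) * lam) * (z - 1) ^ l) j =
      2 * (π:ℂ) * ((poissonPmf lam j * ((-1) ^ l * charlier l lam j) : ℝ) : ℂ) := by
  unfold fcoef
  have : ∀ t : ℝ, ez t ^ (-(j:ℤ)) * (Complex.exp ((ez t - 1) * lam) * (ez t - 1) ^ l) =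
      ∑ k ∈ Finset.range (l + 1), (Complex.exp (-lam) * ((-1) ^ (l - k) * l.choose k)) *
        (ez t ^ (-((j:ℤ) - k)) * Complex.exp (lam * ez t)) := by
    intro t
    have h1 : Complex.exp ((ez t - 1) * lam) = Complex.exp (-lam) * Complex.exp (lam * ez t) := by
      rw [← Complex.exp_add]; congr 1; ring
    rw [h1, sub_eq_add_neg, add_pow, Finset.mul_sum, Finset.mul_sum]
    refine Finset.sum_congr rfl fun k _ => ?_
    rw [show -((j:ℤ) - k) = -(j:ℤ) + k by ring, zpow_add₀ (ez_ne t), zpow_natCast]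
    ring
  simp only [this]
  rw [intervalIntegral.integral_finsetSum]
  · simp only [intervalIntegral.integral_const_mul, int_pois]
    unfold charlier poissonPmf
    push_cast
    rw [Finset.mul_sum, Finset.mul_sum, Finset.mul_sum]
    refine Finset.sum_congr rfl fun k hk => ?_
    have hk : k ≤ l := by simpa [Nat.lt_succ_iff] using hk
    have hs : (-1:ℂ) ^ (l - k) = (-1) ^ l * (-1) ^ k := by
      have h2 : ((-1:ℂ) ^ k) * (-1) ^ k = 1 := by rw [← mul_pow]; simp
      have h1 : (-1:ℂ) ^ (l - k) * (-1) ^ k = (-1) ^ l := by rw [← pow_add, Nat.sub_add_cancel hk]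
      rw [← h1, mul_assoc, h2, mul_one]
    rw [hs]
    have hl' : (lam:ℂ) ≠ 0 := by exact_mod_cast hl.ne'
    simp only [Int.toNat_natCast, Nat.cast_nonneg, if_true]
    by_cases hkj : k ≤ j
    · rw [if_pos (by omega), show ((j:ℤ) - k).toNat = j - k by omega]
      have hf : ((j.choose k : ℂ)) * k.factorial * (j - k).factorial = j.factorial := by
        exact_mod_cast Nat.choose_mul_factorial_mul_factorial hkj
      have hp : (lam:ℂ) ^ (j - k) * lam ^ k = lam ^ j := by rw [← pow_add, Nat.sub_add_cancel hkj]
      have f1 : ((j - k).factorial : ℂ) ≠ 0 := by exact_mod_cast Nat.factorial_ne_zero _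
      have f2 : (j.factorial : ℂ) ≠ 0 := by exact_mod_cast Nat.factorial_ne_zero _
      have hq : (lam:ℂ) ^ (j - k) / ((j - k).factorial : ℂ) =
          lam ^ j / (j.factorial : ℂ) * ((j.choose k : ℂ) * k.factorial * lam ^ (-(k:ℤ))) := by
        rw [zpow_neg, zpow_natCast, ← hf, ← hp]
        have f3 : (j.choose k : ℂ) ≠ 0 := by exact_mod_cast (Nat.choose_pos hkj).ne'
        have f4 : (k.factorial : ℂ) ≠ 0 := by exact_mod_cast Nat.factorial_ne_zero _
        field_simp
      rw [hq]
      push_cast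
      ring
    · rw [if_neg (by omega), Nat.choose_eq_zero_of_lt (by omega : j < k)]
      simp
  · intro k _
    apply Continuous.intervalIntegrable
    have h1 := ez_zpow_cont (-((j:ℤ) - k))
    have h2 := ez_cont
    fun_prop

/-- Truncated approximating characteristic function. -/
def Eq0 (r : ℕ) (lam : ℝ) (z : ℂ) : ℂ :=
  Complex.exp ((z - 1) * lam) * ∑ l ∈ Finset.range (r + 1), taylorCoeff Phi1 l * (z - 1) ^ l

lemma fcoef_Eq0 {lam : ℝ} (hl : 0 < lam) (r j : ℕ) :
    (fcoef (Eq0 r lam) j).re =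
      2 * π * pcMeasure lam r (fun i => (taylorCoeff Phi1 i).re) (j : ℤ) := by
  have h : fcoef (Eq0 r lam) j = ∑ l ∈ Finset.range (r + 1), taylorCoeff Phi1 l *
      fcoef (fun z => Complex.exp ((z - 1) * lam) * (z - 1) ^ l) j := by
    unfold fcoef Eq0
    simp only [← intervalIntegral.integral_const_mul]
    rw [← intervalIntegral.integral_finsetSum]
    · congr 1; ext t
      rw [Finset.mul_sum, Finset.mul_sum]
      refine Finset.sum_congr rfl fun k _ => ?_
      ring
    · intro k _
      apply Continuous.intervalIntegrable
      have h1 := ez_zpow_cont (-(j:ℤ))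
      have h2 := ez_cont
      fun_prop
  rw [h]
  simp only [fcoef_pow hl]
  rw [Finset.sum_range_succ', taylorCoeff_zero']
  unfold pcMeasure
  have e : ∀ (a : ℂ) (x : ℝ), (a * (2 * (π:ℂ) * (x:ℂ))).re = a.re * (2 * π * x) := by
    intro a x
    rw [show (2 * (π:ℂ) * (x:ℂ)) = ((2 * π * x : ℝ) : ℂ) by push_cast; rfl, Complex.re_mul_ofReal]
  rw [Complex.add_re, Complex.re_sum]
  simp only [e]
  have hI : Finset.Icc 1 r = Finset.Ico 1 (r + 1) := by ext; simp
  rw [hI, Finset.sum_Ico_eq_sum_range]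
  simp only [Nat.add_sub_cancel, Int.toNat_natCast, Complex.one_re]
  rw [mul_add, mul_add, Finset.mul_sum, Finset.mul_sum, add_comm]
  congr 1
  · simp [charlier]
  · refine Finset.sum_congr rfl fun k _ => ?_
    rw [add_comm 1 k]
    ring

end EK

namespace EK
open MeasureTheory Set Filter Asymptotics

lemma loglog_one_le {n : ℕ} (hn : 16 ≤ n) : 1 ≤ Real.log (Real.log n) := by
  have h : Real.log 16 ≤ Real.log n := Real.log_le_log (by norm_num) (by exact_mod_cast hn)
  have h16 : Real.log 16 = 4 * Real.log 2 := by
    rw [show (16:ℝ) = 2 ^ 4 by norm_num, Real.log_pow]; norm_num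
  have h2 := Real.log_two_gt_d9
  have h3 := Real.exp_one_lt_d9
  rw [Real.le_log_iff_exp_le (by linarith)]
  linarith

lemma omega_le_log {k : ℕ} (hk : 1 ≤ k) : (smallOmega k : ℝ) ≤ 2 * Real.log k := by
  have h1 : 2 ^ smallOmega k ≤ k := by
    calc 2 ^ smallOmega k = ∏ p ∈ k.primeFactors, 2 := by rw [Finset.prod_const]; rfl
      _ ≤ ∏ p ∈ k.primeFactors, p :=
        Finset.prod_le_prod' fun p hp => (Nat.prime_of_mem_primeFactors hp).two_le
      _ ≤ k := Nat.le_of_dvd hk (Nat.prod_primeFactors_dvd k)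
  have h2 : Real.log ((2:ℝ) ^ smallOmega k) ≤ Real.log k :=
    Real.log_le_log (by positivity) (by exact_mod_cast h1)
  rw [Real.log_pow] at h2
  have h3 := Real.log_two_gt_d9
  have : (0:ℝ) ≤ smallOmega k := Nat.cast_nonneg _
  nlinarith

lemma pow_sub_one_norm {z : ℂ} (hz : ‖z‖ = 1) (m : ℕ) : ‖z ^ m - 1‖ ≤ m * ‖z - 1‖ := by
  induction m with
  | zero => simp
  | succ m ih =>
    have : z ^ (m + 1) - 1 = z ^ m * (z - 1) + (z ^ m - 1) := by ring
    rw [this]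
    refine (norm_add_le _ _).trans ?_
    rw [norm_mul, norm_pow, hz, one_pow]
    push_cast; linarith

lemma mz_sub_one {z : ℂ} (hz : ‖z‖ = 1) {n : ℕ} (hn : 1 ≤ n) :
    ‖mz n z - 1‖ ≤ 2 * Real.log n * ‖z - 1‖ := by
  have hn0 : (0:ℝ) < n := by exact_mod_cast hn
  have hn0' : (n:ℂ) ≠ 0 := by exact_mod_cast hn0.ne'
  have e : mz n z - 1 = (∑ k ∈ Finset.Icc 1 n, (z ^ smallOmega k - 1)) / n := by
    unfold mz
    rw [Finset.sum_sub_distrib]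
    simp only [Finset.sum_const, Nat.card_Icc, Nat.add_sub_cancel, nsmul_eq_mul, mul_one]
    field_simp
  rw [e, norm_div, Complex.norm_natCast, div_le_iff₀ hn0]
  refine (norm_sum_le _ _).trans ?_
  have : ∀ k ∈ Finset.Icc 1 n, ‖z ^ smallOmega k - 1‖ ≤ 2 * Real.log n * ‖z - 1‖ := by
    intro k hk
    rw [Finset.mem_Icc] at hk
    refine (pow_sub_one_norm hz _).trans ?_
    gcongr
    refine (omega_le_log hk.1).trans ?_
    have : Real.log k ≤ Real.log n :=
      Real.log_le_log (by exact_mod_cast (by omega : 0 < k)) (by exact_mod_cast hk.2)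
    linarith
  refine (Finset.sum_le_card_nsmul _ _ _ this).trans ?_
  rw [Nat.card_Icc, nsmul_eq_mul, Nat.add_sub_cancel]
  linarith

lemma exp_sub_one_norm {x : ℂ} (hx : x.re ≤ 0) : ‖Complex.exp x - 1‖ ≤ 2 * ‖x‖ := by
  by_cases h : ‖x‖ ≤ 1
  · exact Complex.norm_exp_sub_one_le h
  · push Not at h
    refine (norm_sub_le _ _).trans ?_
    rw [Complex.norm_exp, norm_one]
    have := Real.exp_le_one_iff.2 hx
    linarith

lemma sub_one_le_two {z : ℂ} (hz : ‖z‖ = 1) : ‖z - 1‖ ≤ 2 := by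
  refine (norm_sub_le _ _).trans ?_
  rw [hz]; norm_num

lemma psi_lin : ∃ C > 0, ∀ z : ℂ, ‖z‖ = 1 → ∀ n : ℕ, 16 ≤ n →
    ‖mz n z - Complex.exp ((z - 1) * (Real.log (Real.log n) : ℝ)) * Phi1 (z - 1)‖ ≤
      C * (Real.log n * ‖z - 1‖) := by
  obtain ⟨C2, hC2, h2⟩ := Phi1_bound
  refine ⟨2 + 2 * C2 + C2, by positivity, fun z hz n hn => ?_⟩
  have hu2 := log_two_le hn
  have hl := loglog_one_le hn
  have h1 := mz_sub_one hz (by omega : 1 ≤ n)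
  obtain ⟨p1, p2⟩ := h2 (z - 1) (sub_one_le_two hz)
  set u := Real.log n with hu
  have hlu : Real.log u ≤ u := (Real.log_le_sub_one_of_pos (by linarith)).trans (by linarith)
  have hre : (z - 1).re ≤ 0 := by
    have := (abs_le.1 (z_re_le hz)).2
    simp; linarith
  have h3 : ‖Complex.exp ((z - 1) * (Real.log u : ℝ)) - 1‖ ≤ 2 * (u * ‖z - 1‖) := by
    refine (exp_sub_one_norm ?_).trans ?_
    · rw [Complex.re_mul_ofReal]
      exact mul_nonpos_of_nonpos_of_nonneg hre (by linarith)
    · rw [norm_mul, Complex.norm_real, Real.norm_eq_abs, abs_of_pos (by linarith), mul_comm u]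
      gcongr
  have e : mz n z - Complex.exp ((z - 1) * (Real.log u : ℝ)) * Phi1 (z - 1) =
      (mz n z - 1) - (Complex.exp ((z - 1) * (Real.log u : ℝ)) - 1) * Phi1 (z - 1) -
        (Phi1 (z - 1) - 1) := by ring
  rw [e]
  refine (norm_sub_le _ _).trans ((add_le_add_left (norm_sub_le _ _) _).trans ?_)
  rw [norm_mul]
  have h4 : ‖Complex.exp ((z - 1) * (Real.log u : ℝ)) - 1‖ * ‖Phi1 (z - 1)‖ ≤ 2 * (u * ‖z - 1‖) * C2 := by
    gcongr
  have h5 : C2 * ‖z - 1‖ ≤ C2 * (u * ‖z - 1‖) := by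
    gcongr
    have := norm_nonneg (z - 1)
    nlinarith
  linarith

lemma psi_interp : ∃ C > 0, ∀ z : ℂ, ‖z‖ = 1 → ∀ n : ℕ, 16 ≤ n →
    ‖mz n z - Complex.exp ((z - 1) * (Real.log (Real.log n) : ℝ)) * Phi1 (z - 1)‖ ≤
      C * (Real.log n ^ (-1 / 68 : ℝ) * ‖z - 1‖ ^ (1 / 70 : ℝ)) := by
  obtain ⟨C1, hC1, h1⟩ := mean_bound
  obtain ⟨C2, hC2, h2⟩ := psi_lin
  refine ⟨C1 ^ (69 / 70 : ℝ) * C2 ^ (1 / 70 : ℝ), by positivity, fun z hz n hn => ?_⟩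
  have a := h1 z hz n hn
  have b := h2 z hz n hn
  have hu2 := log_two_le hn
  set u := Real.log n with hu
  set p := ‖mz n z - Complex.exp ((z - 1) * (Real.log u : ℝ)) * Phi1 (z - 1)‖
  have hp : 0 ≤ p := norm_nonneg _
  have hu0 : 0 < u := by linarith
  have hw := norm_nonneg (z - 1)
  calc p = p ^ (69 / 70 : ℝ) * p ^ (1 / 70 : ℝ) := by
        rw [← Real.rpow_add_of_nonneg hp (by norm_num) (by norm_num)]; norm_num
    _ ≤ (C1 * u ^ (-1 / 34 : ℝ)) ^ (69 / 70 : ℝ) * (C2 * (u * ‖z - 1‖)) ^ (1 / 70 : ℝ) := by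
        gcongr
    _ = C1 ^ (69 / 70 : ℝ) * C2 ^ (1 / 70 : ℝ) *
        ((u ^ (-1 / 34 * (69 / 70) : ℝ) * u ^ (1 / 70 : ℝ)) * ‖z - 1‖ ^ (1 / 70 : ℝ)) := by
        rw [Real.mul_rpow hC1.le (by positivity), Real.mul_rpow hC2.le (by positivity),
          Real.mul_rpow hu0.le hw, Real.rpow_mul hu0.le]
        ring
    _ = _ := by
        rw [← Real.rpow_add hu0]; norm_num

lemma ez_sub_le (t : ℝ) : ‖ez t - 1‖ ≤ |t| := Real.norm_exp_I_mul_ofReal_sub_one_le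

lemma ez_re (t : ℝ) : (ez t).re = Real.cos t := by
  unfold ez; rw [mul_comm, Complex.exp_ofReal_mul_I_re]

theorem dz_bound (r : ℕ) : ∃ C > 0, ∀ n : ℕ, 16 ≤ n → ∀ t : ℝ, |t| ≤ π →
    ‖mz n (ez t) - Eq0 r (Real.log (Real.log n)) (ez t)‖ ≤
      C * (Real.log n ^ (-1 / 68 : ℝ) * |t| ^ (1 / 70 : ℝ) +
        |t| ^ ((r : ℝ) + 1) * Real.exp (-(2 / π ^ 2 * Real.log (Real.log n)) * |t| ^ (2:ℝ))) := by
  obtain ⟨C1, hC1, h1⟩ := psi_interp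
  obtain ⟨C2, hC2, h2⟩ := Phi1_taylor r
  refine ⟨C1 + C2, by positivity, fun n hn t ht => ?_⟩
  have a := h1 (ez t) (ez_norm t) n hn
  have b := h2 (ez t - 1) (sub_one_le_two (ez_norm t))
  have hu2 := log_two_le hn
  have hl := loglog_one_le hn
  have hw := ez_sub_le t
  set u := Real.log n with hu
  have hu0 : 0 < u := by linarith
  set lam := Real.log u with hlam
  have e : mz n (ez t) - Eq0 r lam (ez t) =
      (mz n (ez t) - Complex.exp ((ez t - 1) * (lam : ℝ)) * Phi1 (ez t - 1)) +
      Complex.exp ((ez t - 1) * (lam : ℝ)) * (Phi1 (ez t - 1) -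
        ∑ l ∈ Finset.range (r + 1), taylorCoeff Phi1 l * (ez t - 1) ^ l) := by
    unfold Eq0; ring
  rw [e]
  have hE : ‖Complex.exp ((ez t - 1) * (lam : ℝ))‖ ≤ Real.exp (-(2 / π ^ 2 * lam) * |t| ^ (2:ℝ)) := by
    rw [Complex.norm_exp, Complex.re_mul_ofReal, Complex.sub_re, ez_re, Complex.one_re,
      Real.exp_le_exp, Real.rpow_two, sq_abs]
    have := Real.cos_le_one_sub_mul_cos_sq ht
    nlinarith
  have hT : C2 * ‖ez t - 1‖ ^ (r + 1) ≤ C2 * |t| ^ ((r:ℝ) + 1) := by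
    rw [← Nat.cast_add_one, Real.rpow_natCast]
    gcongr
  have hP : C1 * (u ^ (-1 / 68 : ℝ) * ‖ez t - 1‖ ^ (1 / 70 : ℝ)) ≤
      C1 * (u ^ (-1 / 68 : ℝ) * |t| ^ (1 / 70 : ℝ)) := by
    gcongr
  refine (norm_add_le _ _).trans ?_
  rw [norm_mul]
  have hM : ‖Complex.exp ((ez t - 1) * (lam : ℝ))‖ * ‖Phi1 (ez t - 1) -
        ∑ l ∈ Finset.range (r + 1), taylorCoeff Phi1 l * (ez t - 1) ^ l‖ ≤
      Real.exp (-(2 / π ^ 2 * lam) * |t| ^ (2:ℝ)) * (C2 * |t| ^ ((r:ℝ) + 1)) :=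
    mul_le_mul hE (b.trans hT) (norm_nonneg _) (Real.exp_pos _).le
  have n1 : 0 ≤ u ^ (-1 / 68 : ℝ) * |t| ^ (1 / 70 : ℝ) := by positivity
  have n2 : 0 ≤ |t| ^ ((r : ℝ) + 1) * Real.exp (-(2 / π ^ 2 * lam) * |t| ^ (2:ℝ)) := by positivity
  nlinarith

lemma int_bound {F : ℝ → ℂ} (hF : Continuous F) {A B s q b : ℝ} (hs : -1 < s)
    (hq : -1 < q) (hb : 0 < b) (hB : 0 ≤ B)
    (h : ∀ t : ℝ, 0 < |t| → |t| ≤ π → ‖F t‖ ≤ A * |t| ^ s + B * (|t| ^ q * Real.exp (-b * |t| ^ (2:ℝ)))) :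
    ‖∫ t in (-π)..π, F t‖ ≤ 2 * (A * (π ^ (s + 1) / (s + 1)) +
      B * (b ^ (-(q + 1) / 2) * (1 / 2) * Real.Gamma ((q + 1) / 2))) := by
  set g : ℝ → ℝ := fun t => A * t ^ s + B * (t ^ q * Real.exp (-b * t ^ (2:ℝ))) with hg
  have i1 : IntervalIntegrable (fun t : ℝ => A * t ^ s) volume 0 π :=
    (intervalIntegral.intervalIntegrable_rpow' hs).const_mul A
  have j2 := integrableOn_rpow_mul_exp_neg_mul_rpow hq (by norm_num : (0:ℝ) < 2) hb
  have i2 : IntervalIntegrable (fun t : ℝ => B * (t ^ q * Real.exp (-b * t ^ (2:ℝ)))) volume 0 π := by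
    rw [intervalIntegrable_iff_integrableOn_Ioc_of_le Real.pi_pos.le]
    exact (j2.mono_set Ioc_subset_Ioi_self).const_mul B
  have ig : IntervalIntegrable g volume 0 π := i1.add i2
  have hgi : ∫ t in (0:ℝ)..π, g t ≤ A * (π ^ (s + 1) / (s + 1)) +
      B * (b ^ (-(q + 1) / 2) * (1 / 2) * Real.Gamma ((q + 1) / 2)) := by
    rw [hg, intervalIntegral.integral_add i1 i2, intervalIntegral.integral_const_mul,
      intervalIntegral.integral_const_mul, integral_rpow (Or.inl hs), Real.zero_rpow (by linarith),
      sub_zero, ← integral_rpow_mul_exp_neg_mul_rpow (by norm_num) hq hb,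
      intervalIntegral.integral_of_le Real.pi_pos.le]
    gcongr
    · filter_upwards [self_mem_ae_restrict measurableSet_Ioi] with t ht
      have : (0:ℝ) < t := ht
      positivity
    · exact Ioc_subset_Ioi_self
  have hp : ‖∫ t in (0:ℝ)..π, F t‖ ≤ ∫ t in (0:ℝ)..π, g t := by
    apply intervalIntegral.norm_integral_le_of_norm_le Real.pi_pos.le _ ig
    refine Eventually.of_forall fun t ht => ?_
    have h0 := abs_of_pos ht.1
    have := h t (by rw [h0]; exact ht.1) (by rw [h0]; exact ht.2)
    rwa [h0] at this
  have hm : ‖∫ t in (0:ℝ)..π, F (-t)‖ ≤ ∫ t in (0:ℝ)..π, g t := by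
    apply intervalIntegral.norm_integral_le_of_norm_le Real.pi_pos.le _ ig
    refine Eventually.of_forall fun t ht => ?_
    have h0 := abs_of_pos ht.1
    have := h (-t) (by rw [abs_neg, h0]; exact ht.1) (by rw [abs_neg, h0]; exact ht.2)
    rwa [abs_neg, h0] at this
  have e : ∫ t in (-π)..π, F t = (∫ t in (0:ℝ)..π, F (-t)) + ∫ t in (0:ℝ)..π, F t := by
    rw [intervalIntegral.integral_comp_neg, neg_zero, intervalIntegral.integral_add_adjacent_intervals
      (hF.intervalIntegrable _ _) (hF.intervalIntegrable _ _)]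
  rw [e]
  refine (norm_add_le _ _).trans ?_
  linarith

end EK

namespace EK
open MeasureTheory Set Filter Asymptotics

lemma decay (r : ℕ) : ∃ D > 0, ∀ n : ℕ, 16 ≤ n → ∀ e : ℝ, -((r:ℝ) + 2) ≤ e →
    Real.log n ^ (-1 / 68 : ℝ) ≤ D * Real.log (Real.log n) ^ e := by
  refine ⟨68 ^ (r + 2) * (r + 2).factorial, by positivity, fun n hn e he => ?_⟩
  have hu2 := log_two_le hn
  have hl := loglog_one_le hn
  set u := Real.log n with hu
  have hu0 : 0 < u := by linarith
  set lam := Real.log u with hlam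
  have hl0 : 0 < lam := by linarith
  have h1 : u ^ (-1 / 68 : ℝ) = (Real.exp (lam / 68))⁻¹ := by
    rw [Real.rpow_def_of_pos hu0, ← Real.exp_neg]; congr 1; ring
  have h2 := Real.pow_div_factorial_le_exp (lam / 68) (by positivity) (r + 2)
  have h3 : lam ^ (-((r:ℝ) + 2)) ≤ lam ^ e := Real.rpow_le_rpow_of_exponent_le hl he
  calc u ^ (-1 / 68 : ℝ) ≤ ((lam / 68) ^ (r + 2) / ((r + 2).factorial : ℝ))⁻¹ := by
        rw [h1]; gcongr
    _ = 68 ^ (r + 2) * (r + 2).factorial * lam ^ (-((r:ℝ) + 2)) := by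
        rw [Real.rpow_neg hl0.le, show ((r:ℝ) + 2) = ((r + 2 : ℕ) : ℝ) by push_cast; ring,
          Real.rpow_natCast, div_pow]
        field_simp
    _ ≤ _ := by gcongr

lemma gen_bound (r : ℕ) (M s q : ℝ) (hM : 0 < M) (hs : -1 < s) (hq : 0 ≤ q) (hq2 : q ≤ r + 1) :
    ∃ C > 0, ∀ n : ℕ, 16 ≤ n → ∀ F : ℝ → ℂ, Continuous F →
      (∀ t : ℝ, 0 < |t| → |t| ≤ π → ‖F t‖ ≤ M * (Real.log n ^ (-1 / 68 : ℝ) * |t| ^ s +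
        |t| ^ q * Real.exp (-(2 / π ^ 2 * Real.log (Real.log n)) * |t| ^ (2:ℝ)))) →
      ‖∫ t in (-π)..π, F t‖ ≤ C * Real.log (Real.log n) ^ (-(q + 1) / 2) := by
  obtain ⟨D, hD, hdec⟩ := decay r
  have hG : 0 < Real.Gamma ((q + 1) / 2) := Real.Gamma_pos_of_pos (by linarith)
  have hs1 : 0 < s + 1 := by linarith
  have hpi := Real.pi_pos
  refine ⟨2 * (M * D * (π ^ (s + 1) / (s + 1)) +
    M * ((2 / π ^ 2) ^ (-(q + 1) / 2) * (1 / 2) * Real.Gamma ((q + 1) / 2))), by positivity,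
    fun n hn F hF h => ?_⟩
  have hl := loglog_one_le hn
  have hd := hdec n hn (-(q + 1) / 2) (by linarith)
  set u := Real.log n with hu
  set lam := Real.log u with hlam
  have hl0 : 0 < lam := by linarith
  have key := int_bound hF (A := M * u ^ (-1 / 68 : ℝ)) (B := M) (s := s) (q := q)
    (b := 2 / π ^ 2 * lam) hs (by linarith) (by positivity) hM.le
    (fun t h0 h1 => (h t h0 h1).trans (le_of_eq (by ring)))
  refine key.trans ?_
  rw [Real.mul_rpow (by positivity) hl0.le]
  have : M * u ^ (-1 / 68 : ℝ) * (π ^ (s + 1) / (s + 1)) ≤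
      M * (D * lam ^ (-(q + 1) / 2)) * (π ^ (s + 1) / (s + 1)) := by
    gcongr
  calc _ ≤ 2 * (M * (D * lam ^ (-(q + 1) / 2)) * (π ^ (s + 1) / (s + 1)) +
      M * ((2 / π ^ 2) ^ (-(q + 1) / 2) * lam ^ (-(q + 1) / 2) * (1 / 2) * Real.Gamma ((q + 1) / 2))) := by
        gcongr
    _ = _ := by ring

def dz (n r : ℕ) (t : ℝ) : ℂ := mz n (ez t) - Eq0 r (Real.log (Real.log n)) (ez t)

lemma dz_cont (n r : ℕ) : Continuous (dz n r) := by
  unfold dz mz Eq0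
  have h2 := ez_cont
  fun_prop

lemma mz_cont (n : ℕ) : Continuous fun t => mz n (ez t) := by
  unfold mz
  have h2 := ez_cont
  fun_prop

lemma Eq0_cont (r : ℕ) (lam : ℝ) : Continuous fun t => Eq0 r lam (ez t) := by
  unfold Eq0
  have h2 := ez_cont
  fun_prop

lemma point_eq {n : ℕ} (hn : 16 ≤ n) (r j : ℕ) :
    (∫ t in (-π)..π, ez t ^ (-(j:ℤ)) * dz n r t).re = 2 * π *
      ((((Finset.Icc 1 n).filter fun k => smallOmega k = j).card : ℝ) / n -
        pcMeasure (Real.log (Real.log n)) r (fun i => (taylorCoeff Phi1 i).re) (j : ℤ)) := by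
  have hl := loglog_one_le hn
  have e : (∫ t in (-π)..π, ez t ^ (-(j:ℤ)) * dz n r t) =
      fcoef (mz n) j - fcoef (Eq0 r (Real.log (Real.log n))) j := by
    unfold fcoef dz
    rw [← intervalIntegral.integral_sub]
    · simp only [mul_sub]
    · exact ((ez_zpow_cont _).mul (mz_cont n)).intervalIntegrable _ _
    · exact ((ez_zpow_cont _).mul (Eq0_cont r _)).intervalIntegrable _ _
  rw [e, Complex.sub_re, fcoef_Eq0 (by linarith), fcoef_mz]
  have : (2 * (π:ℂ) * ((((Finset.Icc 1 n).filter fun k => smallOmega k = j).card : ℂ) / n)) =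
    ((2 * π * ((((Finset.Icc 1 n).filter fun k => smallOmega k = j).card : ℝ) / n) : ℝ) : ℂ) := by
    push_cast; rfl
  rw [this, Complex.ofReal_re]
  ring

def Kl (l : ℕ) (t : ℝ) : ℂ := ∑ j ∈ Finset.range (l + 1), ez t ^ (-(j:ℤ))

lemma Kl_cont (l : ℕ) : Continuous (Kl l) := by
  unfold Kl
  exact continuous_finsetSum _ fun j _ => ez_zpow_cont _

lemma Kl_norm (l : ℕ) {t : ℝ} (h0 : 0 < |t|) (h1 : |t| ≤ π) : ‖Kl l t‖ ≤ π * |t|⁻¹ := by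
  have e1 : Kl l t = ∑ j ∈ Finset.range (l + 1), (ez (-t)) ^ j := by
    unfold Kl
    refine Finset.sum_congr rfl fun j _ => ?_
    rw [zpow_neg, zpow_natCast, ← inv_pow]
    congr 1
    unfold ez
    rw [← Complex.exp_neg]; congr 1; push_cast; ring
  have e2 : Kl l t * (ez (-t) - 1) = ez (-t) ^ (l + 1) - 1 := by rw [e1, geom_sum_mul]
  have n1 : ‖ez (-t) ^ (l + 1) - 1‖ ≤ 2 := by
    apply sub_one_le_two; rw [norm_pow, ez_norm, one_pow]
  have n2 : 2 / π * |t| ≤ ‖ez (-t) - 1‖ := by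
    unfold ez
    rw [Complex.norm_exp_I_mul_ofReal_sub_one, norm_mul, Real.norm_eq_abs, Real.norm_eq_abs, neg_div,
      Real.sin_neg, abs_neg, abs_two]
    have h3 := Real.mul_le_sin (x := |t| / 2) (by positivity) (by linarith)
    have h4 : |Real.sin (|t| / 2)| = |Real.sin (t / 2)| := by
      rcases abs_choice t with h | h
      · rw [h]
      · rw [h, neg_div, Real.sin_neg, abs_neg]
    have h5 := le_abs_self (Real.sin (|t| / 2))
    rw [h4] at h5
    linarith
  have n3 : ‖Kl l t‖ * ‖ez (-t) - 1‖ ≤ 2 := by rw [← norm_mul, e2]; exact n1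
  have hpi := Real.pi_pos
  have n4 : ‖Kl l t‖ * (2 / π * |t|) ≤ 2 := (mul_le_mul_of_nonneg_left n2 (norm_nonneg _)).trans n3
  rw [← div_eq_mul_inv, le_div_iff₀ h0]
  have : ‖Kl l t‖ * (2 / π * |t|) = 2 / π * (‖Kl l t‖ * |t|) := by ring
  rw [this, div_mul_eq_mul_div, div_le_iff₀ hpi] at n4
  linarith

lemma cum_eq {n : ℕ} (hn : 16 ≤ n) (r l : ℕ) :
    (∫ t in (-π)..π, Kl l t * dz n r t).re = 2 * π *
      ((((Finset.Icc 1 n).filter fun k => smallOmega k ≤ l).card : ℝ) / n -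
        ∑ j ∈ Finset.range (l + 1),
          pcMeasure (Real.log (Real.log n)) r (fun i => (taylorCoeff Phi1 i).re) (j : ℤ)) := by
  have e : (∫ t in (-π)..π, Kl l t * dz n r t) =
      ∑ j ∈ Finset.range (l + 1), ∫ t in (-π)..π, ez t ^ (-(j:ℤ)) * dz n r t := by
    rw [← intervalIntegral.integral_finsetSum]
    · simp only [Kl, Finset.sum_mul]
    · intro j _
      exact ((ez_zpow_cont _).mul (dz_cont n r)).intervalIntegrable _ _
  rw [e, Complex.re_sum]
  simp only [point_eq hn]
  rw [← Finset.mul_sum, Finset.sum_sub_distrib, ← Finset.sum_div]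
  congr 3
  have : ((Finset.Icc 1 n).filter fun k => smallOmega k ≤ l).card =
      ∑ j ∈ Finset.range (l + 1), ((Finset.Icc 1 n).filter fun k => smallOmega k = j).card := by
    rw [Finset.card_eq_sum_card_fiberwise (f := smallOmega) (t := Finset.range (l + 1))]
    · refine Finset.sum_congr rfl fun j hj => ?_
      congr 1
      ext k
      simp only [Finset.mem_filter, Finset.mem_range] at hj ⊢
      constructor
      · rintro ⟨⟨a, b⟩, c⟩; exact ⟨a, c⟩
      · rintro ⟨a, c⟩; exact ⟨⟨a, by omega⟩, c⟩
    · intro k hk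
      simp only [Finset.coe_filter, mem_setOf_eq, Finset.coe_range, mem_Iio] at hk ⊢
      omega
  rw [this]
  push_cast
  rfl

lemma re_to_abs {I : ℂ} {x B : ℝ} (h : I.re = 2 * π * x) (hI : ‖I‖ ≤ B) : |x| ≤ B := by
  have h1 := (Complex.abs_re_le_norm I).trans hI
  rw [h, abs_mul, abs_of_pos (by positivity : (0:ℝ) < 2 * π)] at h1
  have := Real.pi_gt_three
  have := abs_nonneg x
  nlinarith

theorem main_point (r : ℕ) : ∃ C > 0, ∀ n : ℕ, 16 ≤ n → ∀ j : ℕ,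
    |(((Finset.Icc 1 n).filter fun k => smallOmega k = j).card : ℝ) / n -
        pcMeasure (Real.log (Real.log n)) r (fun i => (taylorCoeff Phi1 i).re) (j : ℤ)| ≤
      C * Real.log (Real.log n) ^ (-1 - (r : ℝ) / 2) := by
  obtain ⟨M, hM, hd⟩ := dz_bound r
  obtain ⟨C, hC, h⟩ := gen_bound r M (1 / 70) (r + 1) hM (by norm_num) (by positivity) le_rfl
  refine ⟨C, hC, fun n hn j => ?_⟩
  apply re_to_abs (point_eq hn r j)
  rw [show (-1 - (r : ℝ) / 2) = -((r:ℝ) + 1 + 1) / 2 by ring]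
  apply h n hn _ ((ez_zpow_cont _).mul (dz_cont n r))
  intro t _ h1
  rw [Pi.mul_apply, norm_mul, norm_zpow, ez_norm, one_zpow, one_mul]
  exact hd n hn t h1

theorem main_cum (r : ℕ) : ∃ C > 0, ∀ n : ℕ, 16 ≤ n → ∀ l : ℕ,
    |(((Finset.Icc 1 n).filter fun k => smallOmega k ≤ l).card : ℝ) / n -
        ∑ j ∈ Finset.range (l + 1),
          pcMeasure (Real.log (Real.log n)) r (fun i => (taylorCoeff Phi1 i).re) (j : ℤ)| ≤
      C * Real.log (Real.log n) ^ (-((r : ℝ) + 1) / 2) := by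
  obtain ⟨M, hM, hd⟩ := dz_bound r
  have hpi := Real.pi_pos
  obtain ⟨C, hC, h⟩ := gen_bound r (π * M) (1 / 70 - 1) r (by positivity) (by norm_num)
    (by positivity) (by linarith)
  refine ⟨C, hC, fun n hn l => ?_⟩
  apply re_to_abs (cum_eq hn r l)
  apply h n hn _ ((Kl_cont l).mul (dz_cont n r))
  intro t h0 h1
  rw [Pi.mul_apply, norm_mul]
  refine (mul_le_mul (Kl_norm l h0 h1) (hd n hn t h1) (norm_nonneg _) (by positivity)).trans
    (le_of_eq ?_)
  rw [Real.rpow_sub_one h0.ne', Real.rpow_add_one h0.ne']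
  field_simp

end EK

/-- Theorem 6.2 for `ω` (a refinement of the Erdős–Kac theorem): with
`λ_n = log log n` and `ν_r^{(1)}` the Poisson–Charlier signed measure built from the
Taylor coefficients `ã_l` of `Φ₁` at `0`, both the point probabilities and the
distribution function of `ω(N_n)`, for `N_n` uniform on `{1,…,n}`, are approximated
with errors `O((log log n)^{-1-r/2}) + ã₁O(1/log n)` and
`O((log log n)^{-(r+1)/2}) + O(log log n/log n)` respectively. -/
theorem erdos_kac_refinement_omega (r : ℕ) (hr : 1 ≤ r) :
    ∃ C Ct : ℝ,
      ∀ n : ℕ, 16 ≤ n →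
        (∀ j : ℕ,
          |(((Finset.Icc 1 n).filter fun k => smallOmega k = j).card : ℝ) / n -
              pcMeasure (Real.log (Real.log n)) r
                (fun i => (taylorCoeff Phi1 i).re) (j : ℤ)| ≤
            C * Real.log (Real.log n) ^ (-1 - (r : ℝ) / 2) +
              (taylorCoeff Phi1 1).re * Ct / Real.log n) ∧
        (∀ l : ℕ,
          |(((Finset.Icc 1 n).filter fun k => smallOmega k ≤ l).card : ℝ) / n -
              ∑ j ∈ Finset.range (l + 1),
                pcMeasure (Real.log (Real.log n)) r
                  (fun i => (taylorCoeff Phi1 i).re) (j : ℤ)| ≤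
            C * Real.log (Real.log n) ^ (-((r : ℝ) + 1) / 2) +
              Ct * Real.log (Real.log n) / Real.log n) := by
  obtain ⟨C1, hC1, h1⟩ := EK.main_point r
  obtain ⟨C2, hC2, h2⟩ := EK.main_cum r
  refine ⟨max C1 C2, 0, fun n hn => ⟨fun j => ?_, fun l => ?_⟩⟩
  · have hl := EK.loglog_one_le hn
    rw [mul_zero, zero_div, add_zero]
    refine (h1 n hn j).trans ?_
    gcongr
    exact le_max_left _ _
  · have hl := EK.loglog_one_le hn
    rw [zero_mul, zero_div, add_zero]
    refine (h2 n hn l).trans ?_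
    gcongr
    exact le_max_right _ _

end
end
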